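/- Let 1/2 < τ < 1 and let g be a smooth Riemannian metric (a smooth field of symmetric positive-definite 3×3 matrices) on E = {x ∈ ℝ³ : |x| ≥ 1} satisfying, for some C₀ > 0 and all x ∈ E: |g_{ij}(x) − δ_{ij}| ≤ C₀|x|^{−τ}, |∂_k g_{ij}(x)| ≤ C₀|x|^{−τ−1}, and |∂_k ∂_l g_{ij}(x)| ≤ C₀|x|^{−τ−2}. Then there exist ρ₀ ≥ 1 and k₁ > 0 such that for every ρ ≥ ρ₀ the following holds: if φ : {|x| ≥ ρ} → ℝ is continuous, smooth on {|x| > ρ}, g-harmonic on {|x| > ρ} (i.e. ∑_{i,j} ∂_i( √(det g) g^{ij} ∂_j φ ) = 0, where (g^{ij}) = g⁻¹), with φ = 0 on {|x| = ρ} and φ(x) → 1 as |x| → ∞, then there exists c ∈ ℝ with |c − ρ| ≤ k₁ ρ^{1−τ} such that the function W(x) := φ(x) − 1 + c/|x| satisfies, for all |x| ≥ ρ: |W(x)| ≤ k₁ ρ |x|^{−1−τ}, |∂_i W(x)| ≤ k₁ ρ |x|^{−2−τ} for each i, and |∂_i ∂_j W(x)| ≤ k₁ ρ |x|^{−3−τ}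 for each i, j. -/

import Mathlib

noncomputable section

open MeasureTheory Filter Topology Real

abbrev E3 : Type := EuclideanSpace ℝ (Fin 3)

/-- The `i`-th partial derivative (the gradient is defined a.e. for locally Lipschitz
functions; `fderiv` takes the junk value `0` where `ψ` is not differentiable). -/
def pd (ψ : E3 → ℝ) (i : Fin 3) (x : E3) : ℝ :=
  fderiv ℝ ψ x (EuclideanSpace.single i 1)

/-- `ψ` is locally Lipschitz on the set `S`. -/
def LocLipOn (S : Set E3) (ψ : E3 → ℝ) : Prop :=
  ∀ x ∈ S, ∃ (C : NNReal) (t : Set E3), t ∈ 𝓝[S] x ∧ LipschitzOnWith C ψ t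

/-- The `g`-volume of a set `K`, `∫_K √(det g(x)) dx`. -/
def gVol (g : E3 → Matrix (Fin 3) (Fin 3) ℝ) (K : Set E3) : ℝ :=
  ∫ x in K, Real.sqrt (g x).det

/-- The `g`-Dirichlet energy `(1/(4π)) ∫_S ∑ g^{ij} ∂_iψ ∂_jψ √(det g) dx`. -/
def gEnergyOn (S : Set E3) (g : E3 → Matrix (Fin 3) (Fin 3) ℝ) (ψ : E3 → ℝ) : ℝ :=
  (1 / (4 * π)) *
    ∫ x in S, (∑ i, ∑ j, (g x)⁻¹ i j * pd ψ i x * pd ψ j x) * Real.sqrt (g x).det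

/-- The `g`-capacity of a compact set `K`, relative to the domain `S`: the infimum of the
normalized `g`-Dirichlet energy over locally Lipschitz test functions on `S` vanishing on `K`
and tending to `1` at infinity. -/
def gCapOn (S : Set E3) (g : E3 → Matrix (Fin 3) (Fin 3) ℝ) (K : Set E3) : ℝ :=
  sInf { e | ∃ ψ : E3 → ℝ, LocLipOn S ψ ∧ (∀ x ∈ K, ψ x = 0) ∧
    Tendsto ψ (cocompact E3 ⊓ 𝓟 S) (𝓝 1) ∧ e = gEnergyOn S g ψ }

/-- The `g`-capacity of a compact set `K ⊆ ℝ³`. -/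
def gCap (g : E3 → Matrix (Fin 3) (Fin 3) ℝ) (K : Set E3) : ℝ :=
  gCapOn Set.univ g K

/-- `K` is an exhaustion of `S` by compact sets: each `K j` is compact, contained in the
interior of `K (j+1)` relative to `S`, and `⋃ j, K j = S`. -/
def IsExhaustion (S : Set E3) (K : ℕ → Set E3) : Prop :=
  (∀ j, IsCompact (K j) ∧ K j ⊆ S) ∧
  (∀ j, ∃ U : Set E3, IsOpen U ∧ K j ⊆ U ∩ S ∧ U ∩ S ⊆ K (j + 1)) ∧
  (⋃ j, K j) = S

/-- `g` is a continuous Riemannian metric on `ℝ³` that is `C⁰`-asymptotically flat. -/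
def IsC0AF (g : E3 → Matrix (Fin 3) (Fin 3) ℝ) : Prop :=
  (∀ i j, Continuous fun x => g x i j) ∧ (∀ x, (g x).IsSymm ∧ (g x).PosDef) ∧
  ∃ q > (0:ℝ), ∃ C > (0:ℝ), ∃ R > (0:ℝ), ∀ x : E3, R ≤ ‖x‖ → ∀ i j,
    |g x i j - (1 : Matrix (Fin 3) (Fin 3) ℝ) i j| ≤ C * ‖x‖ ^ (-q)


abbrev Sm (f : E3 → ℝ) (x : E3) : Prop := ContDiffAt ℝ (⊤ : ℕ∞) f x
/-- second partial derivative -/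
def Hs (f : E3 → ℝ) (i j : Fin 3) (x : E3) : ℝ := pd (pd f j) i x

lemma Sm.da {f : E3 → ℝ} {x : E3} (h : Sm f x) : DifferentiableAt ℝ f x :=
  ContDiffAt.differentiableAt h (by simp)

lemma Sm.pd {f : E3 → ℝ} {x : E3} (h : Sm f x) (i : Fin 3) : Sm (pd f i) x := by
  have h1 : ContDiffAt ℝ (⊤ : ℕ∞) (fderiv ℝ f) x := ContDiffAt.fderiv_right h (by simp)
  exact h1.clm_apply contDiffAt_const

lemma Sm.ev {f : E3 → ℝ} {x : E3} (h : Sm f x) : ∀ᶠ y in 𝓝 x, DifferentiableAt ℝ f y := by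
  have h1 : ContDiffAt ℝ 1 f x := h.of_le (by simp)
  filter_upwards [h1.eventually (by simp)] with y hy
  exact hy.differentiableAt (by simp)

lemma pd_congr {f g : E3 → ℝ} {x : E3} (h : f =ᶠ[𝓝 x] g) (i : Fin 3) : pd f i x = pd g i x := by
  unfold pd; rw [h.fderiv_eq]

lemma pd_ev {f g : E3 → ℝ} {x : E3} (h : f =ᶠ[𝓝 x] g) (i : Fin 3) : pd f i =ᶠ[𝓝 x] pd g i := by
  filter_upwards [h.eventuallyEq_nhds] with y hy using pd_congr hy i

lemma Hs_congr {f g : E3 → ℝ} {x : E3} (h : f =ᶠ[𝓝 x] g) (i j : Fin 3) : Hs f i j x = Hs g i j x :=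
  pd_congr (pd_ev h j) i

lemma pd_add {f g : E3 → ℝ} {x : E3} (hf : DifferentiableAt ℝ f x) (hg : DifferentiableAt ℝ g x)
    (i : Fin 3) : pd (fun y => f y + g y) i x = pd f i x + pd g i x := by
  unfold pd; rw [fderiv_fun_add hf hg]; rfl

lemma pd_sub {f g : E3 → ℝ} {x : E3} (hf : DifferentiableAt ℝ f x) (hg : DifferentiableAt ℝ g x)
    (i : Fin 3) : pd (fun y => f y - g y) i x = pd f i x - pd g i x := by
  unfold pd; rw [fderiv_fun_sub hf hg]; rfl

lemma pd_mul {f g : E3 → ℝ} {x : E3} (hf : DifferentiableAt ℝ f x) (hg : DifferentiableAt ℝ g x)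
    (i : Fin 3) : pd (fun y => f y * g y) i x = pd f i x * g x + f x * pd g i x := by
  unfold pd; rw [fderiv_fun_mul hf hg]; simp; ring

lemma pd_const (c : ℝ) (i : Fin 3) (x : E3) : pd (fun _ => c) i x = 0 := by
  unfold pd; simp

lemma pd_cmul (c : ℝ) {f : E3 → ℝ} {x : E3} (hf : DifferentiableAt ℝ f x)
    (i : Fin 3) : pd (fun y => c * f y) i x = c * pd f i x := by
  rw [pd_mul (differentiableAt_const c) hf, pd_const]; ring

lemma pd_sum {f : Fin 3 → E3 → ℝ} {x : E3} (hf : ∀ k, DifferentiableAt ℝ (f k) x)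
    (i : Fin 3) : pd (fun y => ∑ k, f k y) i x = ∑ k, pd (f k) i x := by
  unfold pd; rw [fderiv_fun_sum (fun k _ => hf k)]; simp

lemma pd_coord (j i : Fin 3) (x : E3) : pd (fun y => y j) i x = if i = j then 1 else 0 := by
  unfold pd
  have : (fun y : E3 => y j) = (EuclideanSpace.proj j : E3 →L[ℝ] ℝ) := by ext; simp
  rw [this, ContinuousLinearMap.fderiv]
  simp [eq_comm]

lemma sm_coord (j : Fin 3) (x : E3) : Sm (fun y => y j) x := by
  have : (fun y : E3 => y j) = (EuclideanSpace.proj j : E3 →L[ℝ] ℝ) := by ext; simp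
  rw [this]; exact (ContinuousLinearMap.contDiff _).contDiffAt

lemma Hs_add {f g : E3 → ℝ} {x : E3} (hf : Sm f x) (hg : Sm g x)
    (i j : Fin 3) : Hs (fun y => f y + g y) i j x = Hs f i j x + Hs g i j x := by
  unfold Hs
  have : pd (fun y => f y + g y) j =ᶠ[𝓝 x] fun y => pd f j y + pd g j y := by
    filter_upwards [hf.ev, hg.ev] with y h1 h2 using pd_add h1 h2 j
  rw [pd_congr this, pd_add (hf.pd j).da (hg.pd j).da]

lemma Hs_sub {f g : E3 → ℝ} {x : E3} (hf : Sm f x) (hg : Sm g x)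
    (i j : Fin 3) : Hs (fun y => f y - g y) i j x = Hs f i j x - Hs g i j x := by
  unfold Hs
  have : pd (fun y => f y - g y) j =ᶠ[𝓝 x] fun y => pd f j y - pd g j y := by
    filter_upwards [hf.ev, hg.ev] with y h1 h2 using pd_sub h1 h2 j
  rw [pd_congr this, pd_sub (hf.pd j).da (hg.pd j).da]

lemma Hs_const (c : ℝ) (i j : Fin 3) (x : E3) : Hs (fun _ => c) i j x = 0 := by
  unfold Hs
  have : pd (fun _ => c) j = fun _ => 0 := by funext y; exact pd_const c j y
  rw [this, pd_const]

lemma Hs_mul {f g : E3 → ℝ} {x : E3} (hf : Sm f x) (hg : Sm g x)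
    (i j : Fin 3) : Hs (fun y => f y * g y) i j x = Hs f i j x * g x + pd f j x * pd g i x
      + pd f i x * pd g j x + f x * Hs g i j x := by
  unfold Hs
  have : pd (fun y => f y * g y) j =ᶠ[𝓝 x] fun y => pd f j y * g y + f y * pd g j y := by
    filter_upwards [hf.ev, hg.ev] with y h1 h2 using pd_mul h1 h2 j
  rw [pd_congr this, pd_add (f := fun y => pd f j y * g y) (g := fun y => f y * pd g j y) ((hf.pd j).da.mul hg.da) (hf.da.mul (hg.pd j).da),
    pd_mul (hf.pd j).da hg.da, pd_mul hf.da (hg.pd j).da]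
  ring

lemma Hs_cmul (c : ℝ) {f : E3 → ℝ} {x : E3} (hf : Sm f x)
    (i j : Fin 3) : Hs (fun y => c * f y) i j x = c * Hs f i j x := by
  rw [Hs_mul contDiffAt_const hf, Hs_const, pd_const, pd_const]; ring

lemma fderiv_apply_sum (f : E3 → ℝ) (x ξ : E3) : fderiv ℝ f x ξ = ∑ i, pd f i x * ξ i := by
  have h : ξ = ∑ i, ξ i • (EuclideanSpace.single i (1:ℝ) : E3) := by
    ext k; simp [Finset.sum_apply, Pi.single_apply]
  conv_lhs => rw [h]
  simp [pd, mul_comm]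

lemma Hs_symm {f : E3 → ℝ} {x : E3} (hf : Sm f x) (i j : Fin 3) : Hs f i j x = Hs f j i x := by
  have hs : IsSymmSndFDerivAt ℝ f x := ContDiffAt.isSymmSndFDerivAt hf (by
    simp only [minSmoothness_of_isRCLikeNormedField]; exact WithTop.coe_le_coe.2 le_top)
  have h1 : ContDiffAt ℝ (⊤ : ℕ∞) (fderiv ℝ f) x := ContDiffAt.fderiv_right hf (by simp)
  have h2 : DifferentiableAt ℝ (fderiv ℝ f) x := h1.differentiableAt (by simp)
  have key : ∀ i j, Hs f i j x = fderiv ℝ (fderiv ℝ f) x (EuclideanSpace.single i 1)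
      (EuclideanSpace.single j 1) := by
    intro i j
    unfold Hs
    have : pd f j = fun y => fderiv ℝ f y (EuclideanSpace.single j 1) := rfl
    rw [this]
    conv_lhs => unfold pd
    rw [fderiv_clm_apply h2 (differentiableAt_const _)]
    simp
  rw [key, key]
  exact hs _ _

/-! one-dimensional 2-jets -/
def J2 (F : ℝ → ℝ) (A B : ℝ) : Prop :=
  ∃ F' : ℝ → ℝ, (∀ᶠ t in 𝓝 (0:ℝ), HasDerivAt F (F' t) t) ∧ F' 0 = A ∧ HasDerivAt F' B 0

lemma J2.add {F G : ℝ → ℝ} {A B C D : ℝ} (h : J2 F A B) (k : J2 G C D) :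
    J2 (fun t => F t + G t) (A + C) (B + D) := by
  obtain ⟨F', h1, h2, h3⟩ := h
  obtain ⟨G', k1, k2, k3⟩ := k
  refine ⟨fun t => F' t + G' t, ?_, by simp [h2, k2], h3.add k3⟩
  filter_upwards [h1, k1] with t a b using a.add b

lemma J2.neg {F : ℝ → ℝ} {A B : ℝ} (h : J2 F A B) : J2 (fun t => - F t) (-A) (-B) := by
  obtain ⟨F', h1, h2, h3⟩ := h
  refine ⟨fun t => - F' t, ?_, by simp [h2], h3.neg⟩
  filter_upwards [h1] with t a using a.neg

lemma J2_quad (a b c : ℝ) : J2 (fun t => a + b * t + c * t ^ 2) b (2 * c) := by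
  refine ⟨fun t => b + 2 * c * t, Eventually.of_forall fun t => ?_, by simp, ?_⟩
  · have := (((hasDerivAt_id t).const_mul b).const_add a).add (((hasDerivAt_id t).pow 2).const_mul c)
    refine HasDerivAt.congr_deriv this ?_
    simp; ring
  · have := ((hasDerivAt_id (0:ℝ)).const_mul (2*c)).const_add b
    refine HasDerivAt.congr_deriv this ?_
    simp

lemma J2.congr {F G : ℝ → ℝ} {A B : ℝ} (h : J2 F A B) (e : G =ᶠ[𝓝 0] F) : J2 G A B := by
  obtain ⟨F', h1, h2, h3⟩ := h
  refine ⟨F', ?_, h2, h3⟩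
  filter_upwards [h1, e.eventuallyEq_nhds] with t a b using a.congr_of_eventuallyEq b

lemma J2.max {F : ℝ → ℝ} {A B : ℝ} (h : J2 F A B) (hm : ∀ᶠ t in 𝓝 (0:ℝ), F t ≤ F 0) :
    A = 0 ∧ B ≤ 0 := by
  obtain ⟨F', h1, h2, h3⟩ := h
  have hm' : IsLocalMax F 0 := hm
  have hA : A = 0 := by rw [← h2]; exact hm'.hasDerivAt_eq_zero h1.self_of_nhds
  refine ⟨hA, ?_⟩
  by_contra hB
  push Not at hB
  have e : deriv F =ᶠ[𝓝 0] F' := by filter_upwards [h1] with t a using a.deriv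
  have h4 : deriv (deriv F) 0 = B := by rw [e.deriv_eq]; exact h3.deriv
  have hmin : IsLocalMin F 0 := isLocalMin_of_deriv_deriv_pos (by rw [h4]; exact hB)
    (by rw [e.eq_of_nhds, h2, hA]) h1.self_of_nhds.continuousAt
  have hc : F =ᶠ[𝓝 0] fun _ => F 0 := by
    filter_upwards [hm', hmin] with t a b using le_antisymm a b
  have e2 : deriv F =ᶠ[𝓝 0] fun _ => 0 := by
    filter_upwards [hc.eventuallyEq_nhds] with t a
    rw [a.deriv_eq]; simp
  have : B = 0 := by rw [← h4, e2.deriv_eq]; simp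
  linarith

lemma J2_line {f : E3 → ℝ} {x : E3} (hf : Sm f x) (ξ : E3) :
    J2 (fun t => f (x + t • ξ)) (∑ i, pd f i x * ξ i) (∑ i, ∑ j, Hs f i j x * (ξ i * ξ j)) := by
  have hl : ∀ t : ℝ, HasDerivAt (fun t : ℝ => x + t • ξ) ξ t := by
    intro t
    simpa using ((hasDerivAt_id t).smul_const ξ).const_add x
  have hgen : ∀ (g : E3 → ℝ) (t : ℝ), DifferentiableAt ℝ g (x + t • ξ) →
      HasDerivAt (fun t => g (x + t • ξ)) (∑ i, pd g i (x + t • ξ) * ξ i) t := by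
    intro g t hg
    have := hg.hasFDerivAt.comp_hasDerivAt t (hl t)
    rw [fderiv_apply_sum] at this
    exact this
  refine ⟨fun t => ∑ i, pd f i (x + t • ξ) * ξ i, ?_, by simp, ?_⟩
  · have hc : Tendsto (fun t : ℝ => x + t • ξ) (𝓝 0) (𝓝 x) := by
      have := (hl 0).continuousAt.tendsto
      simpa using this
    filter_upwards [hc.eventually hf.ev] with t ht using hgen f t ht
  · have : ∀ i ∈ Finset.univ, HasDerivAt (fun t : ℝ => pd f i (x + t • ξ) * ξ i)
        ((∑ j, Hs f j i x * ξ j) * ξ i) 0 := by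
      intro i _
      have h := hgen (pd f i) 0 (by simpa using (hf.pd i).da)
      have h2 := h.mul_const (ξ i)
      simpa [Hs] using h2
    have h3 := HasDerivAt.fun_sum this
    refine HasDerivAt.congr_deriv h3 ?_
    symm
    rw [Finset.sum_comm]
    refine Finset.sum_congr rfl fun i _ => ?_
    rw [Finset.sum_mul]
    refine Finset.sum_congr rfl fun j _ => by ring

/-! positivity -/
def Pos (Q : Fin 3 → Fin 3 → ℝ) : Prop :=
  ∀ P : Fin 3 → Fin 3 → ℝ, (∀ ξ : E3, ∑ i, ∑ j, P i j * (ξ i * ξ j) ≤ 0) →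
    ∑ i, ∑ j, Q i j * P i j ≤ 0

lemma Pos_of {Q : Fin 3 → Fin 3 → ℝ} (hs : ∀ i j, Q i j = Q j i)
    (hq : ∀ ξ : Fin 3 → ℝ, 0 ≤ ∑ i, ∑ j, Q i j * (ξ i * ξ j)) : Pos Q := by
  intro P hP
  have h : (Matrix.of Q).PosSemidef := by
    refine Matrix.PosSemidef.of_dotProduct_mulVec_nonneg ?_ ?_
    · ext i j; simp [Matrix.conjTranspose, hs i j]
    · intro ξ
      have := hq ξ
      simp only [Fin.sum_univ_three, dotProduct, Matrix.mulVec, Matrix.of_apply, Pi.star_apply, star_trivial] at this ⊢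
      linarith
  obtain ⟨m, A, hA⟩ := Matrix.posSemidef_iff_eq_sum_vecMulVec.mp h
  have hQ : ∀ i j, Q i j = ∑ k, A k i * A k j := by
    intro i j
    have := congrFun (congrFun hA i) j
    rw [Matrix.of_apply] at this
    rw [this, Matrix.sum_apply]
    simp [Matrix.vecMulVec_apply]
  have : ∑ i, ∑ j, Q i j * P i j = ∑ k, ∑ i, ∑ j, P i j * (A k i * A k j) := by
    simp_rw [hQ, Finset.sum_mul]
    rw [show (∑ i, ∑ j, ∑ k, A k i * A k j * P i j) = ∑ i, ∑ k, ∑ j, A k i * A k j * P i j from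
      Finset.sum_congr rfl fun i _ => Finset.sum_comm]
    rw [Finset.sum_comm]
    refine Finset.sum_congr rfl fun k _ => Finset.sum_congr rfl fun i _ =>
      Finset.sum_congr rfl fun j _ => by ring
  rw [this]
  refine Finset.sum_nonpos fun k _ => ?_
  have := hP (WithLp.toLp 2 (A k))
  simpa using this

/-- symmetric `Q` with entries of size at most `λ` and `3 λ ≤ m`: `m I + Q` is positive -/
lemma quad_bound {Q : Fin 3 → Fin 3 → ℝ} {l : ℝ}
    (hQ : ∀ i j, |Q i j| ≤ l) (ξ : Fin 3 → ℝ) :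
    |∑ i, ∑ j, Q i j * (ξ i * ξ j)| ≤ 3 * l * ∑ i, ξ i ^ 2 := by
  have hl : 0 ≤ l := (abs_nonneg _).trans (hQ 0 0)
  have h : ∀ i j, |Q i j * (ξ i * ξ j)| ≤ l * ((ξ i ^ 2 + ξ j ^ 2) / 2) := by
    intro i j
    rw [abs_mul]
    refine mul_le_mul (hQ i j) ?_ (abs_nonneg _) hl
    rw [abs_le]; constructor <;> nlinarith [sq_nonneg (ξ i + ξ j), sq_nonneg (ξ i - ξ j)]
  calc _ ≤ ∑ i, ∑ j, l * ((ξ i ^ 2 + ξ j ^ 2) / 2) :=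
        (Finset.abs_sum_le_sum_abs _ _).trans (Finset.sum_le_sum fun i _ =>
          (Finset.abs_sum_le_sum_abs _ _).trans (Finset.sum_le_sum fun j _ => h i j))
    _ = _ := by simp only [Fin.sum_univ_three]; ring

abbrev dl (i j : Fin 3) : ℝ := if i = j then 1 else 0

lemma Pos_near {Q : Fin 3 → Fin 3 → ℝ} (hs : ∀ i j, Q i j = Q j i) {l : ℝ} (hl : l ≤ 1 / 3)
    (hQ : ∀ i j, |Q i j - dl i j| ≤ l) : Pos Q := by
  refine Pos_of hs fun ξ => ?_
  have h := quad_bound hQ ξ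
  have e : ∑ i, ∑ j, (Q i j - dl i j) * (ξ i * ξ j) = ∑ i, ∑ j, Q i j * (ξ i * ξ j) - ∑ i, ξ i ^ 2 := by
    simp [Fin.sum_univ_three, dl]; ring
  rw [e, abs_le] at h
  have : 0 ≤ ∑ i, ξ i ^ 2 := Finset.sum_nonneg fun i _ => sq_nonneg _
  nlinarith

/-- maximum principle -/
lemma mp {Ω : Set E3} (hΩ : IsOpen Ω) {q : E3 → ℝ} (hsm : ∀ x ∈ Ω, Sm q x)
    (hv : ∀ η > 0, ∃ K ⊆ Ω, IsCompact K ∧ ∀ x ∈ Ω, x ∉ K → -η < q x)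
    (hL : ∀ x ∈ Ω, ∃ A : Fin 3 → Fin 3 → ℝ, Pos A ∧ ∃ B : Fin 3 → ℝ,
      ∑ i, ∑ j, A i j * Hs q i j x + ∑ i, B i * pd q i x < 0) :
    ∀ x ∈ Ω, 0 ≤ q x := by
  intro x hx
  by_contra hneg
  push Not at hneg
  obtain ⟨K, hKΩ, hK, hK2⟩ := hv (- q x) (by linarith)
  have hxK : x ∈ K := by
    by_contra h
    have := hK2 x hx h
    linarith
  have hcont : ContinuousOn q K := fun y hy => (hsm y (hKΩ hy)).continuousAt.continuousWithinAt
  obtain ⟨z, hz, hmin⟩ := hK.exists_isMinOn ⟨x, hxK⟩ hcont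
  have hzx : q z ≤ q x := hmin hxK
  have hloc : ∀ᶠ y in 𝓝 z, q z ≤ q y := by
    filter_upwards [hΩ.mem_nhds (hKΩ hz)] with y hy
    by_cases h : y ∈ K
    · exact hmin h
    · have := hK2 y hy h
      linarith
  have hj : ∀ ξ : E3, (∑ i, pd q i z * ξ i) = 0 ∧ 0 ≤ ∑ i, ∑ j, Hs q i j z * (ξ i * ξ j) := by
    intro ξ
    have hc : Tendsto (fun t : ℝ => z + t • ξ) (𝓝 0) (𝓝 z) := by
      have : Continuous (fun t : ℝ => z + t • ξ) := by fun_prop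
      simpa using this.tendsto 0
    have h := (J2_line (hsm z (hKΩ hz)) ξ).neg.max (by
      filter_upwards [hc.eventually hloc] with t ht
      simpa using ht)
    constructor <;> linarith [h.1, h.2]
  obtain ⟨A, hA, B, hAB⟩ := hL z (hKΩ hz)
  have h1 := hA (fun i j => - Hs q i j z) (fun ξ => by
    have := (hj ξ).2
    simp only [neg_mul, Finset.sum_neg_distrib]
    linarith)
  have h2 : ∀ i, pd q i z = 0 := by
    intro i
    have := (hj (EuclideanSpace.single i 1)).1
    simpa [Pi.single_apply] using this
  simp only [mul_neg, Finset.sum_neg_distrib] at h1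
  simp only [h2, mul_zero, Finset.sum_const_zero] at hAB
  linarith


lemma J2.cmul {F : ℝ → ℝ} {A B : ℝ} (c : ℝ) (h : J2 F A B) : J2 (fun t => c * F t) (c * A) (c * B) := by
  obtain ⟨F', h1, h2, h3⟩ := h
  refine ⟨fun t => c * F' t, ?_, by simp [h2], h3.const_mul c⟩
  filter_upwards [h1] with t a using a.const_mul c

lemma J2.sub {F G : ℝ → ℝ} {A B C D : ℝ} (h : J2 F A B) (k : J2 G C D) :
    J2 (fun t => F t - G t) (A - C) (B - D) := by
  simpa [sub_eq_add_neg] using h.add k.neg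

lemma J2_sq (p ξ : E3) : J2 (fun t => ‖p + t • ξ‖ ^ 2) (2 * inner ℝ p ξ) (2 * ‖ξ‖ ^ 2) := by
  have h := J2_quad (‖p‖ ^ 2) (2 * inner ℝ p ξ) (‖ξ‖ ^ 2)
  refine h.congr (Eventually.of_forall fun t => ?_)
  simp only [norm_add_sq_real, inner_smul_right, norm_smul, mul_pow, Real.norm_eq_abs, sq_abs]
  ring

lemma inner_sum3 (p q : E3) : inner ℝ p q = ∑ i, p i * q i := by
  simp [PiLp.inner_apply, mul_comm]

lemma norm_sq_sum (p : E3) : ‖p‖ ^ 2 = ∑ i, p i ^ 2 := by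
  simp [EuclideanSpace.norm_sq_eq]

lemma coord_le (p : E3) (i : Fin 3) : |p i| ≤ ‖p‖ := by
  simpa using PiLp.norm_apply_le p i

lemma line_tendsto (x ξ : E3) : Tendsto (fun t : ℝ => x + t • ξ) (𝓝 0) (𝓝 x) := by
  have : Continuous (fun t : ℝ => x + t • ξ) := by fun_prop
  simpa using this.tendsto 0

lemma hlp1 {K k p q d : ℝ} (hK : 0 ≤ K) (hk : 0 ≤ k) (hp : |p| ≤ 1 / 2) (hq : |q| ≤ d) :
    |2 * (K * p) + 2 * k * q| ≤ K + 2 * k * d := by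
  refine (abs_add_le _ _).trans ?_
  rw [abs_mul, abs_mul, abs_mul, abs_mul, abs_of_nonneg hK, abs_of_nonneg hk, abs_two]
  have h1 := mul_le_mul_of_nonneg_left hp hK
  have h2 := mul_le_mul_of_nonneg_left hq hk
  linarith

lemma hlp2 {K k c s d : ℝ} (hK : 0 ≤ K) (hk : 0 ≤ k) (h1 : c * s ≤ 1 / 2) (h2 : s ≤ 2 * d) :
    2 * (K * c + k) * s ≤ K + 4 * k * d := by
  have h1 := mul_le_mul_of_nonneg_left h1 hK
  have h2 := mul_le_mul_of_nonneg_left h2 hk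
  linarith

set_option maxHeartbeats 1000000 in
/-- linear algebra part of the doubling argument -/
lemma doubling_alg {aX aY P P' : Fin 3 → Fin 3 → ℝ} {e : E3} {k m K d s : ℝ}
    (hd : 0 < d) (hs : 0 < s) (hsd : s ≤ 2 * d) (he : ∑ i, e i ^ 2 = 1)
    (hk : 0 ≤ k) (hK : 0 ≤ K) (hm0 : 0 ≤ m) (hm : m * s ≤ K + 4 * k * d)
    (sX : ∀ i j, aX i j = aX j i) (sY : ∀ i j, aY i j = aY j i)
    (hY : ∀ i j, |aY i j - dl i j| ≤ 1 / 100)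
    (hXY : ∀ i j, |aX i j - aY i j| ≤ 1 / 100 / d * s)
    (G1 : ∀ ξ : E3, ∑ i, ∑ j, (P i j - P' i j - 4 * k * dl i j) * (ξ i * ξ j) ≤ 0)
    (G2 : ∀ ξ : E3, ∑ i, ∑ j, (P i j - m * dl i j) * (ξ i * ξ j) ≤ 0)
    (G3 : ∀ i, - P' i i - m ≤ 0)
    (G4 : ∑ i, ∑ j, (P i j - P' i j) * (e i * e j) + 2 * K / d - 4 * k ≤ 0) :
    ∑ i, ∑ j, aX i j * P i j - ∑ i, ∑ j, aY i j * P' i j ≤ 16 * k - (79 / 100) * (K / d) := by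
  obtain ⟨η, hη⟩ : ∃ η, η = 3 / 100 / d * s := ⟨_, rfl⟩
  have hη0 : 0 ≤ η := by rw [hη]; positivity
  have hη6 : η ≤ 6 / 100 := by
    rw [hη]
    rw [div_mul_eq_mul_div, div_le_iff₀ hd]; linarith
  have hmη : m * η ≤ 3 / 100 * (K / d) + 12 / 100 * k := by
    have : m * η = 3 / 100 / d * (m * s) := by rw [hη]; ring
    rw [this]
    calc 3 / 100 / d * (m * s) ≤ 3 / 100 / d * (K + 4 * k * d) := by gcongr
      _ = _ := by field_simp; ring
  have q1 : Pos (fun i j => aY i j - 1 / 2 * (e i * e j) - η * dl i j) := by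
    refine Pos_of (fun i j => ?_) (fun ξ => ?_)
    · simp only [sY i j, mul_comm (e i), dl, eq_comm]
    · have h := quad_bound hY ξ
      have hcs : (∑ i, e i * ξ i) ^ 2 ≤ (∑ i, e i ^ 2) * ∑ i, ξ i ^ 2 :=
        Finset.sum_mul_sq_le_sq_mul_sq _ _ _
      rw [he] at hcs
      have e1 : ∑ i, ∑ j, (aY i j - 1 / 2 * (e i * e j) - η * dl i j) * (ξ i * ξ j)
          = ∑ i, ∑ j, (aY i j - dl i j) * (ξ i * ξ j) - 1 / 2 * (∑ i, e i * ξ i) ^ 2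
            + (1 - η) * ∑ i, ξ i ^ 2 := by
        simp [Fin.sum_univ_three, dl]; ring
      have h0 : 0 ≤ ∑ i, ξ i ^ 2 := Finset.sum_nonneg fun i _ => sq_nonneg _
      rw [e1]
      have := (abs_le.1 h).1
      nlinarith
  have q2 : Pos (fun i j => aX i j - aY i j + η * dl i j) := by
    refine Pos_of (fun i j => ?_) (fun ξ => ?_)
    · simp only [sY i j, sX i j, dl, eq_comm]
    · have h := quad_bound hXY ξ
      have e1 : ∑ i, ∑ j, (aX i j - aY i j + η * dl i j) * (ξ i * ξ j)
          = ∑ i, ∑ j, (aX i j - aY i j) * (ξ i * ξ j) + η * ∑ i, ξ i ^ 2 := by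
        simp [Fin.sum_univ_three, dl]; ring
      rw [e1]
      have := (abs_le.1 h).1
      have e2 : 3 * (1 / 100 / d * s) = η := by rw [hη]; ring
      rw [e2] at this
      linarith
  have T1 := q1 _ G1
  have T2 := q2 _ G2
  have T3 : η * ((- P' 0 0 - m) + (- P' 1 1 - m) + (- P' 2 2 - m)) ≤ 0 :=
    mul_nonpos_of_nonneg_of_nonpos hη0 (by linarith [G3 0, G3 1, G3 2])
  have tr1 : ∑ i, aY i i ≤ 3.03 := by
    simp only [Fin.sum_univ_three]
    have h0 := (abs_le.1 (hY 0 0)).2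
    have h1 := (abs_le.1 (hY 1 1)).2
    have h2 := (abs_le.1 (hY 2 2)).2
    simp [dl] at h0 h1 h2
    linarith
  have tr2 : ∑ i, (aX i i - aY i i) ≤ η := by
    simp only [Fin.sum_univ_three]
    have h0 := (abs_le.1 (hXY 0 0)).2
    have h1 := (abs_le.1 (hXY 1 1)).2
    have h2 := (abs_le.1 (hXY 2 2)).2
    have : η = 1 / 100 / d * s + 1 / 100 / d * s + 1 / 100 / d * s := by rw [hη]; ring
    linarith
  have key : ∑ i, ∑ j, aX i j * P i j - ∑ i, ∑ j, aY i j * P' i j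
      = (∑ i, ∑ j, (aY i j - 1 / 2 * (e i * e j) - η * dl i j) * (P i j - P' i j - 4 * k * dl i j))
      + (∑ i, ∑ j, (aX i j - aY i j + η * dl i j) * (P i j - m * dl i j))
      + η * ((- P' 0 0 - m) + (- P' 1 1 - m) + (- P' 2 2 - m))
      + 1 / 2 * (∑ i, ∑ j, (P i j - P' i j) * (e i * e j))
      + 4 * k * (∑ i, aY i i - 1 / 2 * (∑ i, e i ^ 2) - 3 * η)
      + m * (∑ i, (aX i i - aY i i) + 6 * η) := by
    simp [Fin.sum_univ_three, dl]; ring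
  rw [key, he]
  have t1 : 4 * k * (∑ i, aY i i - 1 / 2 * 1 - 3 * η) ≤ 4 * k * 2.53 := by
    apply mul_le_mul_of_nonneg_left _ (by linarith)
    linarith
  have t2 : m * (∑ i, (aX i i - aY i i) + 6 * η) ≤ m * (7 * η) :=
    mul_le_mul_of_nonneg_left (by linarith) hm0
  have t3 : 2 * K / d = 2 * (K / d) := by ring
  rw [t3] at G4
  have : 0 ≤ K / d := by positivity
  linarith

set_option maxHeartbeats 1000000 in
lemma grad_est {x0 : E3} {d M N : ℝ} (hd : 0 < d) (hM : 0 < M) (hN : 0 ≤ N) {w : E3 → ℝ}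
    {a : E3 → Fin 3 → Fin 3 → ℝ} {b : E3 → Fin 3 → ℝ}
    (hw : ∀ x ∈ Metric.closedBall x0 d, Sm w x)
    (has : ∀ x ∈ Metric.closedBall x0 d, ∀ i j, a x i j = a x j i)
    (ha : ∀ x ∈ Metric.closedBall x0 d, ∀ i j, |a x i j - dl i j| ≤ 1 / 100)
    (hal : ∀ x ∈ Metric.closedBall x0 d, ∀ y ∈ Metric.closedBall x0 d, ∀ i j,
      |a x i j - a y i j| ≤ 1 / 100 / d * ‖x - y‖)
    (hb : ∀ x ∈ Metric.closedBall x0 d, ∀ i, |b x i| ≤ 1 / 100 / d)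
    (hwM : ∀ x ∈ Metric.closedBall x0 d, |w x| ≤ M)
    (hL : ∀ x ∈ Metric.closedBall x0 d,
      |∑ i, ∑ j, a x i j * Hs w i j x + ∑ i, b x i * pd w i x| ≤ N) (i : Fin 3) :
    |pd w i x0| ≤ 4 * N * d + 80 * M / d := by
  set K := 4 * N * d + 80 * M / d with hK
  have hKpos : 0 < K := by rw [hK]; positivity
  set k := 2 * M / d ^ 2 with hk
  have hkpos : 0 < k := by rw [hk]; positivity
  set B := Metric.closedBall x0 d with hB
  set Φ : E3 × E3 → ℝ := fun p => w p.1 - w p.2 - K * (‖p.1 - p.2‖ - ‖p.1 - p.2‖ ^ 2 / (4 * d))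
      - k * (‖p.1 - x0‖ ^ 2 + ‖p.2 - x0‖ ^ 2) with hΦ
  have memB : ∀ x, x ∈ B ↔ ‖x - x0‖ ≤ d := fun x => by rw [hB, mem_closedBall_iff_norm]
  have hsd : ∀ x ∈ B, ∀ y ∈ B, ‖x - y‖ ≤ 2 * d := by
    intro x hx y hy
    have h1 := (memB x).1 hx
    have h2 := (memB y).1 hy
    calc ‖x - y‖ = ‖(x - x0) - (y - x0)‖ := by congr 1; abel
      _ ≤ ‖x - x0‖ + ‖y - x0‖ := norm_sub_le _ _
      _ ≤ 2 * d := by linarith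
  have hψ : ∀ s, 0 ≤ s → s ≤ 2 * d → 0 ≤ s - s ^ 2 / (4 * d) := by
    intro s h1 h2
    have : s ^ 2 / (4 * d) ≤ s := by
      rw [div_le_iff₀ (by linarith)]; nlinarith
    linarith
  -- main claim
  have main : ∀ x ∈ B, ∀ y ∈ B, Φ (x, y) ≤ 0 := by
    by_contra hcon
    push Not at hcon
    obtain ⟨x1, hx1, y1, hy1, hpos1⟩ := hcon
    have hcomp : IsCompact (B ×ˢ B) := (isCompact_closedBall x0 d).prod (isCompact_closedBall x0 d)
    have hwc : ContinuousOn w B := fun y hy => (hw y hy).continuousAt.continuousWithinAt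
    have hcont : ContinuousOn Φ (B ×ˢ B) := by
      have h1 : ContinuousOn (fun p : E3 × E3 => w p.1) (B ×ˢ B) :=
        hwc.comp continuousOn_fst (fun p hp => hp.1)
      have h2 : ContinuousOn (fun p : E3 × E3 => w p.2) (B ×ˢ B) :=
        hwc.comp continuousOn_snd (fun p hp => hp.2)
      refine ((h1.sub h2).sub ?_).sub ?_
      · exact (by fun_prop : Continuous fun p : E3 × E3 => K * (‖p.1 - p.2‖ - ‖p.1 - p.2‖ ^ 2 / (4 * d))).continuousOn
      · exact (by fun_prop : Continuous fun p : E3 × E3 => k * (‖p.1 - x0‖ ^ 2 + ‖p.2 - x0‖ ^ 2)).continuousOn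
    obtain ⟨⟨X, Y⟩, ⟨hX, hY⟩, hmax⟩ := hcomp.exists_isMaxOn ⟨(x1, y1), hx1, hy1⟩ hcont
    simp only at hX hY
    have hpos : 0 < Φ (X, Y) := lt_of_lt_of_le hpos1 (hmax (Set.mk_mem_prod hx1 hy1))
    have hmax' : ∀ x ∈ B, ∀ y ∈ B, Φ (x, y) ≤ Φ (X, Y) := fun x hx y hy => hmax (Set.mk_mem_prod hx hy)
    have hkd : k * d ^ 2 = 2 * M := by rw [hk]; field_simp
    have hpsXY : 0 ≤ K * (‖X - Y‖ - ‖X - Y‖ ^ 2 / (4 * d)) :=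
      mul_nonneg hKpos.le (hψ _ (norm_nonneg _) (hsd X hX Y hY))
    have hwXY : w X - w Y ≤ 2 * M := by
      have h1 := (abs_le.1 (hwM X hX)).2
      have h2 := (abs_le.1 (hwM Y hY)).1
      linarith
    have hXd : ‖X - x0‖ < d := by
      by_contra h
      have h3 : d ^ 2 ≤ ‖X - x0‖ ^ 2 := by
        apply pow_le_pow_left₀ hd.le; linarith
      have : k * d ^ 2 ≤ k * (‖X - x0‖ ^ 2 + ‖Y - x0‖ ^ 2) := by
        apply mul_le_mul_of_nonneg_left _ hkpos.le; linarith [sq_nonneg ‖Y - x0‖]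
      simp only [hΦ] at hpos
      linarith
    have hYd : ‖Y - x0‖ < d := by
      by_contra h
      have h3 : d ^ 2 ≤ ‖Y - x0‖ ^ 2 := by
        apply pow_le_pow_left₀ hd.le; linarith
      have : k * d ^ 2 ≤ k * (‖X - x0‖ ^ 2 + ‖Y - x0‖ ^ 2) := by
        apply mul_le_mul_of_nonneg_left _ hkpos.le; linarith [sq_nonneg ‖X - x0‖]
      simp only [hΦ] at hpos
      linarith
    have hne : X - Y ≠ 0 := by
      intro h
      have h' : X = Y := sub_eq_zero.1 h
      simp only [hΦ, h'] at hpos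
      simp at hpos
      nlinarith [sq_nonneg ‖Y - x0‖]
    set z := X - Y with hz
    set s := ‖z‖ with hs
    have hspos : 0 < s := norm_pos_iff.2 hne
    have hs2d : s ≤ 2 * d := hsd X hX Y hY
    have nX : ∀ ξ : E3, ∀ᶠ t : ℝ in 𝓝 0, X + t • ξ ∈ B := by
      intro ξ
      apply (line_tendsto X ξ).eventually
      filter_upwards [Metric.ball_mem_nhds X (sub_pos.2 hXd)] with y hy
      rw [memB]
      rw [mem_ball_iff_norm] at hy
      calc ‖y - x0‖ = ‖(y - X) + (X - x0)‖ := by congr 1; abel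
        _ ≤ ‖y - X‖ + ‖X - x0‖ := norm_add_le _ _
        _ ≤ d := by linarith
    have nY : ∀ ξ : E3, ∀ᶠ t : ℝ in 𝓝 0, Y + t • ξ ∈ B := by
      intro ξ
      apply (line_tendsto Y ξ).eventually
      filter_upwards [Metric.ball_mem_nhds Y (sub_pos.2 hYd)] with y hy
      rw [memB]
      rw [mem_ball_iff_norm] at hy
      calc ‖y - x0‖ = ‖(y - Y) + (Y - x0)‖ := by congr 1; abel
        _ ≤ ‖y - Y‖ + ‖Y - x0‖ := norm_add_le _ _
        _ ≤ d := by linarith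
    set c := 1 / (2 * s) - 1 / (4 * d) with hc
    have hc0 : 0 ≤ c := by
      rw [hc, sub_nonneg]
      apply one_div_le_one_div_of_le (by linarith); linarith
    have hcs : c * s ≤ 1 / 2 := by
      have : c * s = 1 / 2 - s / (4 * d) := by rw [hc]; field_simp
      have : 0 ≤ s / (4 * d) := by positivity
      linarith
    have hcss : s - s ^ 2 / (4 * d) = s / 2 + c * s ^ 2 := by rw [hc]; field_simp; ring
    have hmaj : ∀ r : ℝ, r - r ^ 2 / (4 * d) ≤ s / 2 + c * r ^ 2 := by
      intro r
      have : s / 2 + c * r ^ 2 - (r - r ^ 2 / (4 * d)) = (s - r) ^ 2 / (2 * s) := by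
        rw [hc]; field_simp; ring
      have h2 : 0 ≤ (s - r) ^ 2 / (2 * s) := by positivity
      linarith
    have wX := hw X hX
    have wY := hw Y hY
    -- sync
    have G1 : ∀ ξ : E3, ∑ i, ∑ j, (Hs w i j X - Hs w i j Y - 4 * k * dl i j) * (ξ i * ξ j) ≤ 0 := by
      intro ξ
      have h := (((J2_line wX ξ).sub (J2_line wY ξ)).sub
        (((J2_sq (X - x0) ξ).add (J2_sq (Y - x0) ξ)).cmul k)).max (by
        filter_upwards [nX ξ, nY ξ] with t h1 h2
        have := hmax' _ h1 _ h2
        simp only [hΦ] at this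
        have e1 : X + t • ξ - (Y + t • ξ) = X - Y := by abel
        have e2 : X + t • ξ - x0 = X - x0 + t • ξ := by abel
        have e3 : Y + t • ξ - x0 = Y - x0 + t • ξ := by abel
        rw [e1, e2, e3] at this
        simp only [zero_smul, add_zero]
        linarith)
      have h2 := h.2
      rw [norm_sq_sum] at h2
      have e : ∑ i, ∑ j, (Hs w i j X - Hs w i j Y - 4 * k * dl i j) * (ξ i * ξ j)
        = ∑ i, ∑ j, Hs w i j X * (ξ i * ξ j) - ∑ i, ∑ j, Hs w i j Y * (ξ i * ξ j)
          - k * (2 * ∑ i, ξ i ^ 2 + 2 * ∑ i, ξ i ^ 2) := by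
        simp [Fin.sum_univ_three, dl]; ring
      rw [e]; exact h2
    have G2' : ∀ ξ : E3, (∑ i, pd w i X * ξ i) - K * c * (2 * inner ℝ z ξ) - k * (2 * inner ℝ (X - x0) ξ) = 0
        ∧ ∑ i, ∑ j, Hs w i j X * (ξ i * ξ j) - K * c * (2 * ‖ξ‖ ^ 2) - k * (2 * ‖ξ‖ ^ 2) ≤ 0 := by
      intro ξ
      refine (((J2_line wX ξ).sub ((J2_sq z ξ).cmul (K * c))).sub ((J2_sq (X - x0) ξ).cmul k)).max ?_
      filter_upwards [nX ξ] with t h1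
      have := hmax' _ h1 _ hY
      simp only [hΦ] at this
      have e1 : X + t • ξ - Y = z + t • ξ := by rw [hz]; abel
      have e2 : X + t • ξ - x0 = X - x0 + t • ξ := by abel
      rw [e1, e2, ← hz, ← hs, hcss] at this
      have h3 := mul_le_mul_of_nonneg_left (hmaj ‖z + t • ξ‖) hKpos.le
      simp only [zero_smul, add_zero, ← hs]
      linarith
    have G3' : ∀ ξ : E3, -(∑ i, pd w i Y * ξ i) - K * c * (2 * inner ℝ (-z) ξ) - k * (2 * inner ℝ (Y - x0) ξ) = 0
        ∧ -(∑ i, ∑ j, Hs w i j Y * (ξ i * ξ j)) - K * c * (2 * ‖ξ‖ ^ 2) - k * (2 * ‖ξ‖ ^ 2) ≤ 0 := by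
      intro ξ
      refine (((J2_line wY ξ).neg.sub ((J2_sq (-z) ξ).cmul (K * c))).sub ((J2_sq (Y - x0) ξ).cmul k)).max ?_
      filter_upwards [nY ξ] with t h1
      have := hmax' _ hX _ h1
      simp only [hΦ] at this
      have e1 : ‖X - (Y + t • ξ)‖ = ‖-z + t • ξ‖ := by
        rw [← norm_neg]; congr 1; rw [hz]; abel
      have e2 : Y + t • ξ - x0 = Y - x0 + t • ξ := by abel
      rw [e1, e2, ← hz, ← hs, hcss] at this
      have h3 := mul_le_mul_of_nonneg_left (hmaj ‖-z + t • ξ‖) hKpos.le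
      simp only [zero_smul, add_zero, norm_neg, ← hs]
      linarith
    set e : E3 := s⁻¹ • z with he
    have hen : ‖e‖ = 1 := by
      rw [he, norm_smul, norm_inv, Real.norm_eq_abs, abs_of_pos hspos, ← hs]; field_simp
    have hzse : z = s • e := by rw [he, smul_smul]; field_simp; simp
    have G4 : ∑ i, ∑ j, (Hs w i j X - Hs w i j Y) * (e i * e j) + 2 * K / d - 4 * k ≤ 0 := by
      have hq := J2_quad (s - s ^ 2 / (4 * d)) (2 - s / d) (- 1 / d)
      have h := ((((J2_line wX e).sub (J2_line wY (-e))).sub (hq.cmul K)).sub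
        (((J2_sq (X - x0) e).add (J2_sq (Y - x0) (-e))).cmul k)).max (by
        have hst : ∀ᶠ t : ℝ in 𝓝 0, - (s / 2) < t := lt_mem_nhds (by linarith)
        filter_upwards [nX e, nY (-e), hst] with t h1 h2 h3
        have := hmax' _ h1 _ h2
        simp only [hΦ] at this
        have e1 : ‖X + t • e - (Y + t • (-e))‖ = s + 2 * t := by
          have : X + t • e - (Y + t • (-e)) = (s + 2 * t) • e := by
            have : X + t • e - (Y + t • (-e)) = z + (2 * t) • e := by
              rw [hz, smul_neg, two_mul, add_smul]; abel
            rw [this, add_smul, ← hzse]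
          rw [this, norm_smul, hen, Real.norm_eq_abs, abs_of_pos (by linarith)]; ring
        have e2 : X + t • e - x0 = X - x0 + t • e := by abel
        have e3 : Y + t • (-e) - x0 = Y - x0 + t • (-e) := by abel
        rw [e1, e2, e3, ← hz, ← hs] at this
        have e4 : (s + 2 * t) - (s + 2 * t) ^ 2 / (4 * d) = s - s ^ 2 / (4 * d) + (2 - s / d) * t + -1 / d * t ^ 2 := by
          field_simp; ring
        rw [e4] at this
        simp only [zero_smul, add_zero, mul_zero, ne_eq, OfNat.ofNat_ne_zero, not_false_eq_true, zero_pow]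
        linarith)
      have h2 := h.2
      rw [norm_neg, hen] at h2
      have ee : ∑ i, ∑ j, (Hs w i j X - Hs w i j Y) * (e i * e j)
        = ∑ i, ∑ j, Hs w i j X * (e i * e j) - ∑ i, ∑ j, Hs w i j Y * ((-e) i * (-e) j) := by
        simp [Fin.sum_univ_three]; ring
      rw [ee]
      have : K * (2 * (-1 / d)) = - (2 * K / d) := by ring
      linarith
    have alg := doubling_alg (aX := a X) (aY := a Y) (P := fun i j => Hs w i j X)
      (P' := fun i j => Hs w i j Y) (e := e) (k := k) (m := 2 * (K * c + k)) (K := K) hd hspos hs2d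
      (by rw [← norm_sq_sum, hen]; norm_num) hkpos.le hKpos.le (by positivity)
      (hlp2 hKpos.le hkpos.le hcs hs2d) (has X hX) (has Y hY) (ha Y hY) (hal X hX Y hY) G1
      (fun ξ => by
        have h2 := (G2' ξ).2
        rw [norm_sq_sum] at h2
        have ee : ∑ i, ∑ j, (Hs w i j X - 2 * (K * c + k) * dl i j) * (ξ i * ξ j)
          = ∑ i, ∑ j, Hs w i j X * (ξ i * ξ j) - K * c * (2 * ∑ i, ξ i ^ 2) - k * (2 * ∑ i, ξ i ^ 2) := by
          simp [Fin.sum_univ_three, dl]; ring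
        rw [ee]; exact h2)
      (fun i => by
        have h2 := (G3' (EuclideanSpace.single i 1)).2
        simp at h2
        linarith) G4
    have gX : ∀ i, |pd w i X| ≤ K + 2 * k * d := by
      intro i
      have h2 := (G2' (EuclideanSpace.single i 1)).1
      rw [EuclideanSpace.inner_single_right, EuclideanSpace.inner_single_right] at h2
      simp only [PiLp.single_apply, mul_ite, mul_one, mul_zero, Finset.sum_ite_eq', Finset.mem_univ, if_true, one_mul, conj_trivial] at h2
      have : pd w i X = 2 * (K * (c * z i)) + 2 * k * (X - x0) i := by
        linarith
      rw [this]
      have h3 : |c * z i| ≤ 1 / 2 := by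
        rw [abs_mul, abs_of_nonneg hc0]
        exact (mul_le_mul_of_nonneg_left (coord_le z i) hc0).trans hcs
      have h4 : |(X - x0) i| ≤ d := (coord_le _ i).trans hXd.le
      exact hlp1 hKpos.le hkpos.le h3 h4
    have gY : ∀ i, |pd w i Y| ≤ K + 2 * k * d := by
      intro i
      have h2 := (G3' (EuclideanSpace.single i 1)).1
      rw [EuclideanSpace.inner_single_right, EuclideanSpace.inner_single_right] at h2
      simp only [PiLp.single_apply, mul_ite, mul_one, mul_zero, Finset.sum_ite_eq', Finset.mem_univ, if_true, one_mul, conj_trivial, PiLp.neg_apply] at h2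
      have : pd w i Y = 2 * (K * (c * z i)) - 2 * k * (Y - x0) i := by
        linarith
      rw [this]
      have h3 : |c * z i| ≤ 1 / 2 := by
        rw [abs_mul, abs_of_nonneg hc0]
        exact (mul_le_mul_of_nonneg_left (coord_le z i) hc0).trans hcs
      have h4 : |(Y - x0) i| ≤ d := (coord_le _ i).trans hYd.le
      rw [sub_eq_add_neg, ← mul_neg]
      exact hlp1 hKpos.le hkpos.le h3 (by rwa [abs_neg])
    have bb : ∀ Z ∈ B, (∀ i, |pd w i Z| ≤ K + 2 * k * d) → |∑ i, b Z i * pd w i Z| ≤ 3 / 100 * (K / d + 2 * k) := by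
      intro Z hZ hg
      refine (Finset.abs_sum_le_sum_abs _ _).trans ?_
      have : ∀ i ∈ Finset.univ, |b Z i * pd w i Z| ≤ 1 / 100 / d * (K + 2 * k * d) := by
        intro i _
        rw [abs_mul]
        exact mul_le_mul (hb Z hZ i) (hg i) (abs_nonneg _) (by positivity)
      refine (Finset.sum_le_sum this).trans ?_
      simp
      apply le_of_eq
      field_simp
    have bX := bb X hX gX
    have bY := bb Y hY gY
    have LX := hL X hX
    have LY := hL Y hY
    rw [abs_le] at bX bY LX LY
    have hKd : K / d = 4 * N + 40 * k := by rw [hK, hk]; field_simp; ring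
    rw [hKd] at alg bX bY
    linarith [bX.1, bX.2, bY.1, bY.2, LX.1, LY.2]
  -- conclusion
  have hx0B : x0 ∈ B := by rw [memB]; simpa using hd.le
  have hmain2 : ∀ x ∈ B, |w x - w x0| ≤ K * ‖x - x0‖ + k * ‖x - x0‖ ^ 2 := by
    intro x hx
    have h1 := main x hx x0 hx0B
    have h2 := main x0 hx0B x hx
    simp only [hΦ, sub_self, norm_zero] at h1 h2
    rw [norm_sub_rev x0 x] at h2
    have h3 : 0 ≤ K * (‖x - x0‖ ^ 2 / (4 * d)) := by positivity
    rw [abs_le]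
    constructor <;> nlinarith
  have hder : HasDerivAt (fun t : ℝ => w (x0 + t • (EuclideanSpace.single i (1:ℝ) : E3))) (pd w i x0) 0 := by
    have hl : HasDerivAt (fun t : ℝ => x0 + t • (EuclideanSpace.single i (1:ℝ) : E3)) (EuclideanSpace.single i (1:ℝ)) 0 := by
      simpa using ((hasDerivAt_id (0:ℝ)).smul_const (EuclideanSpace.single i (1:ℝ) : E3)).const_add x0
    have hf : HasFDerivAt w (fderiv ℝ w x0) (x0 + (0:ℝ) • (EuclideanSpace.single i (1:ℝ) : E3)) := by
      simpa using (hw x0 hx0B).da.hasFDerivAt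
    exact hf.comp_hasDerivAt 0 hl
  have hslope := hasDerivAt_iff_tendsto_slope.1 hder
  have hlim : Tendsto (fun t : ℝ => K + k * |t|) (𝓝[≠] 0) (𝓝 K) := by
    have : Continuous (fun t : ℝ => K + k * |t|) := by fun_prop
    have := (this.tendsto 0).mono_left (nhdsWithin_le_nhds (s := {0}ᶜ))
    simpa using this
  refine le_of_tendsto_of_tendsto hslope.abs hlim ?_
  have hev : ∀ᶠ t : ℝ in 𝓝[≠] 0, |t| ≤ d := by
    have : ∀ᶠ t : ℝ in 𝓝 0, |t| < d := by
      have := Metric.ball_mem_nhds (0:ℝ) hd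
      filter_upwards [this] with t ht
      simpa using ht
    filter_upwards [nhdsWithin_le_nhds this] with t ht using ht.le
  filter_upwards [hev, self_mem_nhdsWithin] with t ht hne
  have hn : ‖x0 + t • (EuclideanSpace.single i (1:ℝ) : E3) - x0‖ = |t| := by
    simp [norm_smul]
  have := hmain2 (x0 + t • (EuclideanSpace.single i (1:ℝ) : E3)) (by rw [memB, hn]; exact ht)
  rw [hn] at this
  simp only [slope_def_field, zero_smul, add_zero, sub_zero]
  rw [abs_div, div_le_iff₀ (abs_pos.2 hne)]
  linarith


/-- the operator -/
def Lo (a : E3 → Fin 3 → Fin 3 → ℝ) (b : E3 → Fin 3 → ℝ) (w : E3 → ℝ) (x : E3) : ℝ :=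
  ∑ i, ∑ j, a x i j * Hs w i j x + ∑ i, b x i * pd w i x

lemma Lo_add {a : E3 → Fin 3 → Fin 3 → ℝ} {b : E3 → Fin 3 → ℝ} {v w : E3 → ℝ} {x : E3}
    (hv : Sm v x) (hw : Sm w x) : Lo a b (fun y => v y + w y) x = Lo a b v x + Lo a b w x := by
  unfold Lo
  simp only [Hs_add hv hw, pd_add hv.da hw.da, mul_add, Finset.sum_add_distrib]; ring

lemma Lo_sub {a : E3 → Fin 3 → Fin 3 → ℝ} {b : E3 → Fin 3 → ℝ} {v w : E3 → ℝ} {x : E3}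
    (hv : Sm v x) (hw : Sm w x) : Lo a b (fun y => v y - w y) x = Lo a b v x - Lo a b w x := by
  unfold Lo
  simp only [Hs_sub hv hw, pd_sub hv.da hw.da, mul_sub, Finset.sum_sub_distrib]; ring

lemma Lo_cmul {a : E3 → Fin 3 → Fin 3 → ℝ} {b : E3 → Fin 3 → ℝ} (c : ℝ) {w : E3 → ℝ} {x : E3}
    (hw : Sm w x) : Lo a b (fun y => c * w y) x = c * Lo a b w x := by
  unfold Lo
  simp only [Hs_cmul c hw, pd_cmul c hw.da, mul_add, Finset.mul_sum]
  congr 1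
  · refine Finset.sum_congr rfl fun i _ => Finset.sum_congr rfl fun j _ => by ring
  · refine Finset.sum_congr rfl fun i _ => by ring

lemma Lo_const {a : E3 → Fin 3 → Fin 3 → ℝ} {b : E3 → Fin 3 → ℝ} (c : ℝ) {x : E3} :
    Lo a b (fun _ => c) x = 0 := by
  unfold Lo; simp [Hs_const, pd_const]

lemma sum3_abs {p q : Fin 3 → ℝ} {P Q : ℝ} (hp : ∀ i, |p i| ≤ P) (hq : ∀ i, |q i| ≤ Q) :
    |∑ i, p i * q i| ≤ 3 * (P * Q) := by
  have hP : 0 ≤ P := (abs_nonneg _).trans (hp 0)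
  refine (Finset.abs_sum_le_sum_abs _ _).trans ?_
  refine (Finset.sum_le_sum (g := fun _ => P * Q) fun i _ => ?_).trans (by simp)
  rw [abs_mul]
  exact mul_le_mul (hp i) (hq i) (abs_nonneg _) hP

lemma sum9_abs {p q : Fin 3 → Fin 3 → ℝ} {P Q : ℝ} (hp : ∀ i j, |p i j| ≤ P) (hq : ∀ i j, |q i j| ≤ Q) :
    |∑ i, ∑ j, p i j * q i j| ≤ 9 * (P * Q) := by
  refine (Finset.abs_sum_le_sum_abs _ _).trans ?_
  refine (Finset.sum_le_sum (g := fun _ => 3 * (P * Q)) fun i _ => sum3_abs (hp i) (hq i)).trans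
    (by simp; linarith)

lemma fderiv_norm_le {f : E3 → ℝ} {x : E3} {C : ℝ} (h : ∀ i, |pd f i x| ≤ C) : ‖fderiv ℝ f x‖ ≤ 3 * C := by
  have hC : 0 ≤ C := (abs_nonneg _).trans (h 0)
  refine ContinuousLinearMap.opNorm_le_bound _ (by positivity) fun ξ => ?_
  rw [fderiv_apply_sum, Real.norm_eq_abs]
  refine (sum3_abs h (coord_le ξ)).trans (by linarith)

lemma lip_of_pd {f : E3 → ℝ} {s : Set E3} (hs : Convex ℝ s) {C : ℝ} (hf : ∀ x ∈ s, DifferentiableAt ℝ f x)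
    (h : ∀ x ∈ s, ∀ i, |pd f i x| ≤ C) {x y : E3} (hx : x ∈ s) (hy : y ∈ s) :
    |f x - f y| ≤ 3 * C * ‖x - y‖ := by
  have := hs.norm_image_sub_le_of_norm_fderiv_le (𝕜 := ℝ) (f := f) (C := 3 * C) hf
    (fun z hz => fderiv_norm_le (h z hz)) hy hx
  simpa using this

lemma Hs_pd {V : E3 → ℝ} {x : E3} (hV : Sm V x) (i j k : Fin 3) :
    Hs (pd V k) i j x = pd (Hs V i j) k x := by
  have h1 : pd (Hs V i j) k x = pd (pd (pd V j) k) i x := by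
    have := Hs_symm (hV.pd j) k i
    exact this
  rw [h1]
  unfold Hs
  apply pd_congr
  have h2 : ContDiffAt ℝ 3 V x := hV.of_le (by exact WithTop.coe_le_coe.2 le_top)
  filter_upwards [h2.eventually (by simp)] with y hy
  have hs : IsSymmSndFDerivAt ℝ V y := hy.isSymmSndFDerivAt (by
    simp only [minSmoothness_of_isRCLikeNormedField]; norm_cast)
  have h1 : ContDiffAt ℝ 2 (fderiv ℝ V) y := hy.fderiv_right (by norm_cast)
  have h2 : DifferentiableAt ℝ (fderiv ℝ V) y := h1.differentiableAt (by simp)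
  have e : ∀ p q : Fin 3, pd (pd V p) q y =
      fderiv ℝ (fderiv ℝ V) y (EuclideanSpace.single q 1) (EuclideanSpace.single p 1) := by
    intro p q
    unfold pd
    rw [fderiv_clm_apply h2 (differentiableAt_const _)]
    simp
  rw [e, e]
  exact hs _ _

lemma Sm.hs {f : E3 → ℝ} {x : E3} (h : Sm f x) (i j : Fin 3) : Sm (Hs f i j) x := (h.pd j).pd i

lemma pd_Lo {a : E3 → Fin 3 → Fin 3 → ℝ} {b : E3 → Fin 3 → ℝ} {V : E3 → ℝ} {x : E3}
    (ha : ∀ i j, Sm (fun y => a y i j) x) (hb : ∀ i, Sm (fun y => b y i) x) (hV : Sm V x) (k : Fin 3) :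
    pd (Lo a b V) k x = Lo a b (pd V k) x + ∑ i, ∑ j, pd (fun y => a y i j) k x * Hs V i j x
      + ∑ i, pd (fun y => b y i) k x * pd V i x := by
  have e : Lo a b V = fun y => ∑ i, ∑ j, a y i j * Hs V i j y + ∑ i, b y i * pd V i y := rfl
  have d1 : ∀ i j, DifferentiableAt ℝ (fun y => a y i j * Hs V i j y) x := fun i j =>
    (ha i j).da.mul (hV.hs i j).da
  have d2 : ∀ i, DifferentiableAt ℝ (fun y => b y i * pd V i y) x := fun i =>
    (hb i).da.mul (hV.pd i).da
  rw [e, pd_add (DifferentiableAt.fun_sum fun i _ => DifferentiableAt.fun_sum fun j _ => d1 i j)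
    (DifferentiableAt.fun_sum fun i _ => d2 i), pd_sum (fun i => DifferentiableAt.fun_sum fun j _ => d1 i j), pd_sum d2]
  unfold Lo
  have e1 : ∀ i, pd (fun y => ∑ j, a y i j * Hs V i j y) k x = ∑ j, pd (fun y => a y i j) k x * Hs V i j x
      + ∑ j, a x i j * Hs (pd V k) i j x := by
    intro i
    rw [pd_sum (d1 i), ← Finset.sum_add_distrib]
    refine Finset.sum_congr rfl fun j _ => ?_
    rw [pd_mul (ha i j).da (hV.hs i j).da, Hs_pd hV]
  have e2 : ∀ i, pd (fun y => b y i * pd V i y) k x = pd (fun y => b y i) k x * pd V i x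
      + b x i * pd (pd V k) i x := by
    intro i
    rw [pd_mul (hb i).da (hV.pd i).da]
    congr 2
    exact Hs_symm hV k i
  simp only [e1, e2, Finset.sum_add_distrib]; ring


/-- coefficient hypotheses on a ball -/
structure CB (a : E3 → Fin 3 → Fin 3 → ℝ) (b : E3 → Fin 3 → ℝ) (x0 : E3) (d l : ℝ) : Prop where
  sa : ∀ x ∈ Metric.closedBall x0 d, ∀ i j, Sm (fun y => a y i j) x
  sb : ∀ x ∈ Metric.closedBall x0 d, ∀ i, Sm (fun y => b y i) x
  sy : ∀ x ∈ Metric.closedBall x0 d, ∀ i j, a x i j = a x j i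
  ha : ∀ x ∈ Metric.closedBall x0 d, ∀ i j, |a x i j - dl i j| ≤ l
  da : ∀ x ∈ Metric.closedBall x0 d, ∀ i j k, |pd (fun y => a y i j) k x| ≤ l / d
  hb : ∀ x ∈ Metric.closedBall x0 d, ∀ i, |b x i| ≤ l / d
  db : ∀ x ∈ Metric.closedBall x0 d, ∀ i k, |pd (fun y => b y i) k x| ≤ l / d ^ 2

lemma grad_sub {a : E3 → Fin 3 → Fin 3 → ℝ} {b : E3 → Fin 3 → ℝ} {x0 : E3} {d l : ℝ}
    (H : CB a b x0 d l) (hd : 0 < d) (hl : l ≤ 1 / 1300) {x : E3} {δ M N : ℝ} (hδ : 0 < δ) (hδd : δ ≤ d)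
    (hsub : Metric.closedBall x δ ⊆ Metric.closedBall x0 d) (hM : 0 < M) (hN : 0 ≤ N) {w : E3 → ℝ}
    (hw : ∀ y ∈ Metric.closedBall x δ, Sm w y) (hwM : ∀ y ∈ Metric.closedBall x δ, |w y| ≤ M)
    (hL : ∀ y ∈ Metric.closedBall x δ, |Lo a b w y| ≤ N) (i : Fin 3) :
    |pd w i x| ≤ 4 * N * δ + 80 * M / δ := by
  have hle : l / d ≤ 1 / 300 / δ := by
    rw [div_le_div_iff₀ hd hδ]
    have := mul_le_mul_of_nonneg_right hl hδ.le
    linarith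
  refine grad_est hδ hM hN hw (fun y hy => H.sy y (hsub hy)) (fun y hy i j => (H.ha y (hsub hy) i j).trans (by linarith))
    ?_ (fun y hy i => (H.hb y (hsub hy) i).trans (hle.trans ?_)) hwM hL i
  · intro y hy z hz i j
    refine (lip_of_pd (f := fun y => a y i j) (convex_closedBall x0 d) (fun p hp => (H.sa p hp i j).da)
      (fun p hp k => H.da p hp i j k) (hsub hy) (hsub hz)).trans ?_
    apply mul_le_mul_of_nonneg_right _ (norm_nonneg _)
    have : 1 / 100 / δ = 3 * (1 / 300 / δ) := by ring
    linarith
  · apply div_le_div_of_nonneg_right _ hδ.le; norm_num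

lemma int_alg {S N M d δ l P N1 G0 : ℝ} (hd : 0 < d) (hδ : 0 < δ) (hδd : δ ≤ d / 2) (hN : 0 ≤ N) (hM : 0 < M)
    (hl0 : 0 ≤ l) (hl : l ≤ 1 / 1300) (hS0 : 0 ≤ S)
    (hP : P ≤ 4 * N1 * δ + 80 * G0 / δ) (hG : G0 = 4 * N * δ + 80 * M / δ)
    (hN1 : N1 = N / d + 9 * (l / d * (S / δ ^ 2)) + 3 * (l / d ^ 2 * G0))
    (hS : S ≤ (2 * δ) ^ 2 * (9 * P)) : S ≤ 10 ^ 6 * (N * d ^ 2 + M) := by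
  have h1 : S ≤ 36 * (4 * (N * δ ^ 3 / d) + 36 * (l * (δ / d)) * S + 12 * l * (δ / d) ^ 2 * (G0 * δ) + 80 * (G0 * δ)) := by
    calc S ≤ (2 * δ) ^ 2 * (9 * P) := hS
      _ ≤ (2 * δ) ^ 2 * (9 * (4 * N1 * δ + 80 * G0 / δ)) := by gcongr
      _ = _ := by rw [hN1]; field_simp; ring
  have hr : δ / d ≤ 1 / 2 := by rw [div_le_iff₀ hd]; linarith
  have hr0 : 0 ≤ δ / d := by positivity
  have hr2 : (δ / d) ^ 2 ≤ 1 := by nlinarith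
  have hG1 : G0 * δ ≤ N * d ^ 2 + 80 * M := by
    have : G0 * δ = 4 * N * δ ^ 2 + 80 * M := by rw [hG]; field_simp
    rw [this]
    have : δ ^ 2 ≤ (d / 2) ^ 2 := by gcongr
    nlinarith
  have hG0 : 0 ≤ G0 * δ := by rw [hG]; positivity
  have h2 : N * δ ^ 3 / d ≤ N * d ^ 2 := by
    rw [div_le_iff₀ hd]
    have : δ ^ 3 ≤ d ^ 3 := by gcongr; linarith
    nlinarith
  have h3 : l * (δ / d) ≤ 1 / 2600 := by nlinarith
  have h4 : l * (δ / d) * S ≤ 1 / 2600 * S := by gcongr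
  have h5 : 12 * l * (δ / d) ^ 2 * (G0 * δ) ≤ 1 * (G0 * δ) := by
    gcongr
    nlinarith
  have : 0 ≤ N * d ^ 2 := by positivity
  linarith

set_option maxHeartbeats 800000 in
lemma int_est {a : E3 → Fin 3 → Fin 3 → ℝ} {b : E3 → Fin 3 → ℝ} {x0 : E3} {d l : ℝ}
    (H : CB a b x0 d l) (hd : 0 < d) (hl : l ≤ 1 / 1300) {M N : ℝ} (hM : 0 < M) (hN : 0 ≤ N) {V : E3 → ℝ}
    (hV : ∀ y ∈ Metric.closedBall x0 d, Sm V y) (hVM : ∀ y ∈ Metric.closedBall x0 d, |V y| ≤ M)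
    (hL : ∀ y ∈ Metric.closedBall x0 d, |Lo a b V y| ≤ N)
    (hdL : ∀ y ∈ Metric.closedBall x0 d, ∀ k, |pd (Lo a b V) k y| ≤ N / d) :
    (∀ i, |pd V i x0| ≤ 4 * N * d + 80 * M / d) ∧ ∀ i j, |Hs V i j x0| ≤ 10 ^ 6 * (N + M / d ^ 2) := by
  have hl0 : 0 ≤ l := (abs_nonneg _).trans (H.ha x0 (Metric.mem_closedBall_self hd.le) 0 0)
  refine ⟨fun i => grad_sub H hd hl hd le_rfl subset_rfl hM hN hV hVM hL i, ?_⟩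
  obtain ⟨G, hG⟩ : ∃ G : E3 → ℝ, G = fun x => (d - ‖x - x0‖) ^ 2 * ∑ i, ∑ j, |Hs V i j x| := ⟨_, rfl⟩
  have hGc : ContinuousOn G (Metric.closedBall x0 d) := by
    rw [hG]
    refine ContinuousOn.mul (by fun_prop) ?_
    refine continuousOn_finsetSum _ fun i _ => continuousOn_finsetSum _ fun j _ => ContinuousOn.abs ?_
    exact fun x hx => ((hV x hx).hs i j).continuousAt.continuousWithinAt
  obtain ⟨x1, hx1, hmax⟩ := (isCompact_closedBall x0 d).exists_isMaxOn ⟨x0, Metric.mem_closedBall_self hd.le⟩ hGc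
  have hsum0 : ∀ x, 0 ≤ ∑ i, ∑ j, |Hs V i j x| := fun x =>
    Finset.sum_nonneg fun i _ => Finset.sum_nonneg fun j _ => abs_nonneg _
  have hone : ∀ x i j, |Hs V i j x| ≤ ∑ i, ∑ j, |Hs V i j x| := by
    intro x i j
    refine (Finset.single_le_sum (f := fun j => |Hs V i j x|) (fun j _ => abs_nonneg _) (Finset.mem_univ j)).trans ?_
    exact Finset.single_le_sum (f := fun i => ∑ j, |Hs V i j x|) (fun i _ => Finset.sum_nonneg fun j _ => abs_nonneg _) (Finset.mem_univ i)
  have key : G x1 ≤ 10 ^ 6 * (N * d ^ 2 + M) := by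
    rcases eq_or_lt_of_le (mem_closedBall_iff_norm.1 hx1) with heq | hlt
    · have : G x1 = 0 := by rw [hG]; simp [heq]
      rw [this]; positivity
    obtain ⟨δ, hδe⟩ : ∃ δ, δ = (d - ‖x1 - x0‖) / 2 := ⟨_, rfl⟩
    have hδ : 0 < δ := by rw [hδe]; linarith
    have hδd : δ ≤ d / 2 := by rw [hδe]; linarith [norm_nonneg (x1 - x0)]
    have hnear : ∀ x ∈ Metric.closedBall x1 δ, δ ≤ d - ‖x - x0‖ := by
      intro x hx
      have h1 := mem_closedBall_iff_norm.1 hx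
      have h2 : ‖x - x0‖ ≤ ‖x - x1‖ + ‖x1 - x0‖ := by
        have := norm_add_le (x - x1) (x1 - x0)
        rwa [sub_add_sub_cancel] at this
      linarith
    have hsub : ∀ x ∈ Metric.closedBall x1 δ, Metric.closedBall x δ ⊆ Metric.closedBall x0 d := by
      intro x hx
      apply Metric.closedBall_subset_closedBall'
      rw [dist_eq_norm]; linarith [hnear x hx]
    have hin : Metric.closedBall x1 δ ⊆ Metric.closedBall x0 d := fun x hx =>
      hsub x hx (Metric.mem_closedBall_self hδ.le)
    obtain ⟨G0, hG0⟩ : ∃ G0, G0 = 4 * N * δ + 80 * M / δ := ⟨_, rfl⟩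
    have hG0p : 0 < G0 := by rw [hG0]; positivity
    have hgrad : ∀ x ∈ Metric.closedBall x1 δ, ∀ k, |pd V k x| ≤ G0 := by
      intro x hx k
      rw [hG0]
      exact grad_sub H hd hl hδ (by linarith) (hsub x hx) hM hN (fun y hy => hV y (hsub x hx hy))
        (fun y hy => hVM y (hsub x hx hy)) (fun y hy => hL y (hsub x hx hy)) k
    have hHs : ∀ x ∈ Metric.closedBall x1 δ, ∀ i j, |Hs V i j x| ≤ G x1 / δ ^ 2 := by
      intro x hx i j
      rw [le_div_iff₀ (by positivity)]
      have h1 : G x ≤ G x1 := hmax (hin hx)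
      refine le_trans ?_ h1
      rw [hG]
      have := hnear x hx
      calc |Hs V i j x| * δ ^ 2 ≤ (∑ i, ∑ j, |Hs V i j x|) * (d - ‖x - x0‖) ^ 2 := by
            gcongr
            exact hone x i j
        _ = _ := mul_comm _ _
    obtain ⟨N1, hN1⟩ : ∃ N1, N1 = N / d + 9 * (l / d * (G x1 / δ ^ 2)) + 3 * (l / d ^ 2 * G0) := ⟨_, rfl⟩
    have hGx0 : 0 ≤ G x1 := by rw [hG]; have := hsum0 x1; positivity
    have hN1p : 0 ≤ N1 := by rw [hN1]; positivity
    have hLw : ∀ k, ∀ x ∈ Metric.closedBall x1 δ, |Lo a b (pd V k) x| ≤ N1 := by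
      intro k x hx
      have hx' := hin hx
      have e := pd_Lo (H.sa x hx') (H.sb x hx') (hV x hx') k
      have e' : Lo a b (pd V k) x = pd (Lo a b V) k x - ∑ i, ∑ j, pd (fun y => a y i j) k x * Hs V i j x
        - ∑ i, pd (fun y => b y i) k x * pd V i x := by linarith
      rw [e', hN1]
      have t1 := hdL x hx' k
      have t2 := sum9_abs (fun i j => H.da x hx' i j k) (hHs x hx)
      have t3 := sum3_abs (fun i => H.db x hx' i k) (hgrad x hx)
      refine (abs_sub _ _).trans ?_
      refine add_le_add ((abs_sub _ _).trans (add_le_add t1 t2)) t3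
    have hfin : ∀ i j, |Hs V i j x1| ≤ 4 * N1 * δ + 80 * G0 / δ := by
      intro i j
      exact grad_sub H hd hl hδ (by linarith) hin hG0p hN1p (fun y hy => (hV y (hin hy)).pd j)
        (fun y hy => hgrad y hy j) (hLw j) i
    refine int_alg (P := 4 * N1 * δ + 80 * G0 / δ) hd hδ hδd hN hM hl0 hl hGx0 le_rfl hG0 hN1 ?_
    have h2 : ∑ i, ∑ j, |Hs V i j x1| ≤ 9 * (4 * N1 * δ + 80 * G0 / δ) := by
      refine (Finset.sum_le_sum fun i _ => Finset.sum_le_sum fun j _ => hfin i j).trans ?_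
      simp; linarith
    have h3 : G x1 = (2 * δ) ^ 2 * ∑ i, ∑ j, |Hs V i j x1| := by
      rw [hG, hδe]; ring
    rw [h3]
    gcongr
  intro i j
  have h1 : G x0 ≤ G x1 := hmax (Metric.mem_closedBall_self hd.le)
  have h2 : d ^ 2 * |Hs V i j x0| ≤ G x0 := by
    rw [hG]; simp only [sub_self, norm_zero, sub_zero]
    gcongr
    exact hone x0 i j
  have h3 : d ^ 2 * |Hs V i j x0| ≤ d ^ 2 * (10 ^ 6 * (N + M / d ^ 2)) := by
    refine (h2.trans (h1.trans key)).trans (le_of_eq ?_)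
    field_simp
  exact le_of_mul_le_mul_left h3 (by positivity)


/-- inverse norm -/
def ze (x : E3) : ℝ := ‖x‖⁻¹

lemma ze_pos {x : E3} (hx : x ≠ 0) : 0 < ze x := inv_pos.2 (norm_pos_iff.2 hx)

lemma sm_ze {x : E3} (hx : x ≠ 0) : Sm ze x :=
  (contDiffAt_norm ℝ hx).inv (norm_ne_zero_iff.2 hx)

lemma ze_sq {x : E3} (hx : x ≠ 0) : ze x ^ 2 * (x 0 ^ 2 + x 1 ^ 2 + x 2 ^ 2) = 1 := by
  have h := norm_sq_sum x
  rw [Fin.sum_univ_three] at h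
  rw [← h, ze]
  have := norm_ne_zero_iff.2 hx
  field_simp

lemma pd_ze {x : E3} (hx : x ≠ 0) (i : Fin 3) : pd ze i x = - (x i * ze x ^ 3) := by
  have hz := ze_sq hx
  have hev : (fun y : E3 => ze y * ze y * (y 0 * y 0 + y 1 * y 1 + y 2 * y 2)) =ᶠ[𝓝 x] fun _ => 1 := by
    filter_upwards [isOpen_ne.mem_nhds hx] with y hy
    rw [← ze_sq hy]; ring
  have h1 := pd_congr hev i
  have s := (sm_ze hx).da
  have c := fun j => (sm_coord j x).da
  have c2 := fun j => (c j).fun_mul (c j)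
  rw [pd_const, pd_mul (s.fun_mul s) (((c2 0).fun_add (c2 1)).fun_add (c2 2)), pd_mul s s,
    pd_add ((c2 0).fun_add (c2 1)) (c2 2), pd_add (c2 0) (c2 1), pd_mul (c 0) (c 0), pd_mul (c 1) (c 1), pd_mul (c 2) (c 2),
    pd_coord, pd_coord, pd_coord] at h1
  have hp := ze_pos hx
  have e : (if i = 0 then (1:ℝ) else 0) * x 0 + x 0 * (if i = 0 then 1 else 0)
    + ((if i = 1 then (1:ℝ) else 0) * x 1 + x 1 * (if i = 1 then 1 else 0))
    + ((if i = 2 then (1:ℝ) else 0) * x 2 + x 2 * (if i = 2 then 1 else 0)) = 2 * x i := by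
    fin_cases i <;> simp <;> ring
  rw [e] at h1
  have h2 : 2 * (pd ze i x) * (ze x ^ 2 * (x 0 ^ 2 + x 1 ^ 2 + x 2 ^ 2)) = - (2 * (x i * ze x ^ 3)) := by
    linear_combination (ze x) * h1
  rw [hz] at h2
  linarith

lemma pd_ze_pow {x : E3} (hx : x ≠ 0) (n : ℕ) (i : Fin 3) :
    pd (fun y => ze y ^ (n + 1)) i x = - ((n + 1 : ℕ) * x i * ze x ^ (n + 3)) := by
  induction n with
  | zero => simp [pd_ze hx]
  | succ n ih =>
    have : (fun y => ze y ^ (n + 1 + 1)) = fun y => ze y ^ (n + 1) * ze y := by funext y; ring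
    rw [this, pd_mul (f := fun y => ze y ^ (n + 1)) ((sm_ze hx).da.pow _) (sm_ze hx).da, ih, pd_ze hx]
    push_cast; ring

lemma sm_ze_pow {x : E3} (hx : x ≠ 0) (n : ℕ) : Sm (fun y => ze y ^ n) x := (sm_ze hx).pow n

lemma hs_ze {x : E3} (hx : x ≠ 0) (i j : Fin 3) :
    Hs ze i j x = - (dl i j * ze x ^ 3) + 3 * (x i * x j * ze x ^ 5) := by
  have hev : pd ze j =ᶠ[𝓝 x] fun y => (-1) * (y j * ze y ^ 3) := by
    filter_upwards [isOpen_ne.mem_nhds hx] with y hy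
    rw [pd_ze hy]; ring
  unfold Hs
  have s := (sm_ze_pow hx 3)
  have c := (sm_coord j x)
  rw [pd_congr hev, pd_cmul _ (c.da.fun_mul s.da), pd_mul c.da s.da, pd_coord, pd_ze_pow hx 2]
  push_cast; ring

lemma pd_hs_ze {x : E3} (hx : x ≠ 0) (i j k : Fin 3) :
    pd (Hs ze i j) k x = 3 * (dl i j * x k + dl k i * x j + dl k j * x i) * ze x ^ 5
      - 15 * (x i * x j * x k * ze x ^ 7) := by
  have hev : Hs ze i j =ᶠ[𝓝 x] fun y => (- dl i j) * ze y ^ 3 + 3 * (y i * y j * ze y ^ 5) := by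
    filter_upwards [isOpen_ne.mem_nhds hx] with y hy
    rw [hs_ze hy]; ring
  have s3 := (sm_ze_pow hx 3).da
  have s5 := (sm_ze_pow hx 5).da
  have ci := (sm_coord i x).da
  have cj := (sm_coord j x).da
  rw [pd_congr hev, pd_add (s3.const_mul _) (((ci.fun_mul cj).fun_mul s5).const_mul _), pd_cmul _ s3,
    pd_cmul _ ((ci.fun_mul cj).fun_mul s5), pd_mul (ci.fun_mul cj) s5, pd_mul ci cj, pd_coord, pd_coord,
    pd_ze_pow hx 2, pd_ze_pow hx 4]
  push_cast; ring

lemma lap_ze {x : E3} (hx : x ≠ 0) : ∑ i, ∑ j, dl i j * Hs ze i j x = 0 := by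
  simp only [hs_ze hx, Fin.sum_univ_three, dl]
  simp
  linear_combination (3 * ze x ^ 3) * ze_sq hx

lemma lap_pd_ze {x : E3} (hx : x ≠ 0) (k : Fin 3) : ∑ i, ∑ j, dl i j * Hs (pd ze k) i j x = 0 := by
  simp only [Hs_pd (sm_ze hx), pd_hs_ze hx, Fin.sum_univ_three, dl]
  have := ze_sq hx
  fin_cases k <;> simp <;> [linear_combination (-15 * x 0 * ze x ^ 5) * this; linear_combination (-15 * x 1 * ze x ^ 5) * this; linear_combination (-15 * x 2 * ze x ^ 5) * this]

lemma xz_le (x : E3) (i : Fin 3) : |x i| * ze x ≤ 1 := by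
  by_cases hx : x = 0
  · simp [hx]
  rw [ze, ← div_eq_mul_inv, div_le_one (norm_pos_iff.2 hx)]
  exact coord_le x i

lemma dl_abs (i j : Fin 3) : |dl i j| ≤ 1 := by
  unfold dl; split_ifs <;> simp

lemma pd_ze_le {x : E3} (hx : x ≠ 0) (i : Fin 3) : |pd ze i x| ≤ ze x ^ 2 := by
  have hp := (ze_pos hx).le
  rw [pd_ze hx, abs_neg, abs_mul, abs_of_nonneg (by positivity : 0 ≤ ze x ^ 3)]
  calc |x i| * ze x ^ 3 = (|x i| * ze x) * ze x ^ 2 := by ring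
    _ ≤ 1 * ze x ^ 2 := by gcongr; exact xz_le x i
    _ = _ := one_mul _

lemma hs_ze_le {x : E3} (hx : x ≠ 0) (i j : Fin 3) : |Hs ze i j x| ≤ 4 * ze x ^ 3 := by
  have hp := (ze_pos hx).le
  rw [hs_ze hx]
  have e : -(dl i j * ze x ^ 3) + 3 * (x i * x j * ze x ^ 5)
    = (- dl i j + 3 * ((x i * ze x) * (x j * ze x))) * ze x ^ 3 := by ring
  rw [e, abs_mul, abs_of_nonneg (by positivity : 0 ≤ ze x ^ 3)]
  gcongr
  have h : ∀ k, |x k * ze x| ≤ 1 := fun k => by rw [abs_mul, abs_of_nonneg hp]; exact xz_le x k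
  refine (abs_add_le _ _).trans ?_
  rw [abs_neg, abs_mul, abs_mul]
  have := mul_le_one₀ (h i) (abs_nonneg _) (h j)
  have h3 : |(3:ℝ)| = 3 := by norm_num
  rw [h3]
  linarith [dl_abs i j]

lemma hs_pd_ze_le {x : E3} (hx : x ≠ 0) (i j k : Fin 3) : |Hs (pd ze k) i j x| ≤ 24 * ze x ^ 4 := by
  have hp := (ze_pos hx).le
  rw [Hs_pd (sm_ze hx), pd_hs_ze hx]
  have e : 3 * (dl i j * x k + dl k i * x j + dl k j * x i) * ze x ^ 5 - 15 * (x i * x j * x k * ze x ^ 7)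
    = (3 * (dl i j * (x k * ze x)) + 3 * (dl k i * (x j * ze x)) + 3 * (dl k j * (x i * ze x))
      - 15 * ((x i * ze x) * (x j * ze x) * (x k * ze x))) * ze x ^ 4 := by ring
  rw [e, abs_mul, abs_of_nonneg (by positivity : 0 ≤ ze x ^ 4)]
  gcongr
  have h : ∀ k, |x k * ze x| ≤ 1 := fun k => by rw [abs_mul, abs_of_nonneg hp]; exact xz_le x k
  have h2 : ∀ p q r : Fin 3, |dl p q * (x r * ze x)| ≤ 1 := fun p q r => by
    rw [abs_mul]; exact mul_le_one₀ (dl_abs p q) (abs_nonneg _) (h r)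
  have h3 : |(x i * ze x) * (x j * ze x) * (x k * ze x)| ≤ 1 := by
    rw [abs_mul, abs_mul]; exact mul_le_one₀ (mul_le_one₀ (h i) (abs_nonneg _) (h j)) (abs_nonneg _) (h k)
  have a1 := abs_le.1 (h2 i j k)
  have a2 := abs_le.1 (h2 k i j)
  have a3 := abs_le.1 (h2 k j i)
  have a4 := abs_le.1 h3
  rw [abs_le]
  constructor <;> linarith [a1.1, a1.2, a2.1, a2.2, a3.1, a3.2, a4.1, a4.2]

lemma grad_ze_sq {x : E3} (hx : x ≠ 0) : ∑ i, pd ze i x ^ 2 = ze x ^ 4 := by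
  simp only [pd_ze hx, Fin.sum_univ_three]
  linear_combination (ze x ^ 4) * ze_sq hx

/-- coefficient hypotheses -/
structure Core (τ ε : ℝ) (a : E3 → Fin 3 → Fin 3 → ℝ) (b : E3 → Fin 3 → ℝ) : Prop where
  sa : ∀ x : E3, 1 / 2 < ‖x‖ → ∀ i j, Sm (fun y => a y i j) x
  sb : ∀ x : E3, 1 / 2 < ‖x‖ → ∀ i, Sm (fun y => b y i) x
  sy : ∀ x : E3, 1 / 2 < ‖x‖ → ∀ i j, a x i j = a x j i
  ha : ∀ x : E3, 1 / 2 < ‖x‖ → ∀ i j, |a x i j - dl i j| ≤ ε * ze x ^ τ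
  da : ∀ x : E3, 1 / 2 < ‖x‖ → ∀ i j k, |pd (fun y => a y i j) k x| ≤ ε * ze x ^ τ * ze x
  hb : ∀ x : E3, 1 / 2 < ‖x‖ → ∀ i, |b x i| ≤ ε * ze x ^ τ * ze x
  db : ∀ x : E3, 1 / 2 < ‖x‖ → ∀ i k, |pd (fun y => b y i) k x| ≤ ε * ze x ^ τ * ze x ^ 2

lemma ne0 {x : E3} {c : ℝ} (hc : 0 ≤ c) (hx : c < ‖x‖) : x ≠ 0 := norm_pos_iff.1 (hc.trans_lt hx)

lemma Lo_split {a : E3 → Fin 3 → Fin 3 → ℝ} {b : E3 → Fin 3 → ℝ} {w : E3 → ℝ} {x : E3} :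
    Lo a b w x = ∑ i, ∑ j, dl i j * Hs w i j x + ∑ i, ∑ j, (a x i j - dl i j) * Hs w i j x + ∑ i, b x i * pd w i x := by
  unfold Lo
  simp only [sub_mul, Finset.sum_sub_distrib]; ring

lemma Core.Lze {τ ε : ℝ} {a : E3 → Fin 3 → Fin 3 → ℝ} {b : E3 → Fin 3 → ℝ} (H : Core τ ε a b) {x : E3}
    (hx : 1 / 2 < ‖x‖) : |Lo a b ze x| ≤ 39 * ε * (ze x ^ τ * ze x ^ 3) := by
  have h0 := ne0 (by norm_num) hx
  rw [Lo_split, lap_ze h0, zero_add]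
  refine (abs_add_le _ _).trans ?_
  have t1 := sum9_abs (H.ha x hx) (hs_ze_le h0)
  have t2 := sum3_abs (H.hb x hx) (pd_ze_le h0)
  refine (add_le_add t1 t2).trans (le_of_eq (by ring))

lemma Core.dLze {τ ε : ℝ} {a : E3 → Fin 3 → Fin 3 → ℝ} {b : E3 → Fin 3 → ℝ} (H : Core τ ε a b) {x : E3}
    (hx : 1 / 2 < ‖x‖) (k : Fin 3) : |pd (Lo a b ze) k x| ≤ 267 * ε * (ze x ^ τ * ze x ^ 4) := by
  have h0 := ne0 (by norm_num) hx
  rw [pd_Lo (H.sa x hx) (H.sb x hx) (sm_ze h0), Lo_split, lap_pd_ze h0, zero_add]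
  refine (abs_add_le _ _).trans ((add_le_add ((abs_add_le _ _).trans (add_le_add ((abs_add_le _ _)) le_rfl)) le_rfl).trans ?_)
  have t1 := sum9_abs (H.ha x hx) (fun i j => hs_pd_ze_le h0 i j k)
  have t2 := sum3_abs (H.hb x hx) (fun i => hs_ze_le h0 i k)
  have t3 := sum9_abs (fun i j => H.da x hx i j k) (hs_ze_le h0)
  have t4 := sum3_abs (fun i => H.db x hx i k) (pd_ze_le h0)
  refine (add_le_add (add_le_add (add_le_add t1 t2) t3) t4).trans (le_of_eq (by ring))

lemma pd_comp {h : ℝ → ℝ} {h' : ℝ} {f : E3 → ℝ} {x : E3} (hf : DifferentiableAt ℝ f x) (hh : HasDerivAt h h' (f x)) (i : Fin 3) :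
    pd (fun y => h (f y)) i x = h' * pd f i x := by
  unfold pd
  have := (hh.comp_hasFDerivAt x hf.hasFDerivAt).fderiv
  have e : (fun y => h (f y)) = h ∘ f := rfl
  rw [e, this]; simp

lemma Hs_comp {h h' : ℝ → ℝ} {h'' : ℝ} {f : E3 → ℝ} {x : E3} (hf : Sm f x)
    (hh : ∀ᶠ s in 𝓝 (f x), HasDerivAt h (h' s) s) (hh' : HasDerivAt h' h'' (f x)) (i j : Fin 3) :
    Hs (fun y => h (f y)) i j x = h'' * (pd f i x * pd f j x) + h' (f x) * Hs f i j x := by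
  unfold Hs
  have : pd (fun y => h (f y)) j =ᶠ[𝓝 x] fun y => h' (f y) * pd f j y := by
    filter_upwards [hf.ev, hf.continuousAt.eventually hh] with y h1 h2 using pd_comp h1 h2 j
  rw [pd_congr this, pd_mul (f := fun y => h' (f y)) (hh'.differentiableAt.comp x hf.da) (hf.pd j).da, pd_comp hf.da hh']
  ring

lemma Lo_comp {a : E3 → Fin 3 → Fin 3 → ℝ} {b : E3 → Fin 3 → ℝ} {h h' : ℝ → ℝ} {h'' : ℝ} {f : E3 → ℝ} {x : E3} (hf : Sm f x)
    (hh : ∀ᶠ s in 𝓝 (f x), HasDerivAt h (h' s) s) (hh' : HasDerivAt h' h'' (f x)) :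
    Lo a b (fun y => h (f y)) x = h'' * (∑ i, ∑ j, a x i j * (pd f i x * pd f j x)) + h' (f x) * Lo a b f x := by
  unfold Lo
  simp only [Hs_comp hf hh hh', pd_comp hf.da hh.self_of_nhds, Fin.sum_univ_three]
  ring

/-- barrier lemma: `L (h ∘ ζ)` -/
lemma Core.barrier {τ ε : ℝ} {a : E3 → Fin 3 → Fin 3 → ℝ} {b : E3 → Fin 3 → ℝ} (H : Core τ ε a b)
    (he : ε ≤ 1 / 1000) (hτ : 0 < τ) {x : E3}
    (hx : 1 < ‖x‖) {h h' : ℝ → ℝ} {h'' : ℝ}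
    (hh : ∀ᶠ s in 𝓝 (ze x), HasDerivAt h (h' s) s) (hh' : HasDerivAt h' h'' (ze x)) (hc : h'' ≤ 0) :
    Lo a b (fun y => h (ze y)) x ≤ h'' * (99 / 100 * ze x ^ 4) + |h' (ze x)| * (39 * ε * (ze x ^ τ * ze x ^ 3)) := by
  have h0 := ne0 (by norm_num) hx
  have hx' : 1 / 2 < ‖x‖ := by linarith
  have hp := ze_pos h0
  rw [Lo_comp (sm_ze h0) hh hh']
  have hz1 : ze x ≤ 1 := by
    rw [ze]; exact inv_le_one_of_one_le₀ hx.le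
  have hzt : ze x ^ τ ≤ 1 := Real.rpow_le_one hp.le hz1 hτ.le
  have h2 : (∑ i, ∑ j, a x i j * (pd ze i x * pd ze j x)) ≥ 99 / 100 * ze x ^ 4 := by
    have q := quad_bound (H.ha x hx') (fun i => pd ze i x)
    rw [grad_ze_sq h0] at q
    have e : ∑ i, ∑ j, (a x i j - dl i j) * (pd ze i x * pd ze j x) = ∑ i, ∑ j, a x i j * (pd ze i x * pd ze j x)
      - ∑ i, pd ze i x ^ 2 := by
      simp [Fin.sum_univ_three, dl]; ring
    rw [e, grad_ze_sq h0] at q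
    have := (abs_le.1 q).1
    have h3 : ε * ze x ^ τ ≤ 1 / 1000 := by
      have := mul_le_mul he hzt (by positivity) (by norm_num)
      linarith
    have h4 : 3 * (ε * ze x ^ τ) * ze x ^ 4 ≤ 3 * (1 / 1000) * ze x ^ 4 := by gcongr
    have : 0 ≤ ze x ^ 4 := by positivity
    linarith
  have h5 : h' (ze x) * Lo a b ze x ≤ |h' (ze x)| * (39 * ε * (ze x ^ τ * ze x ^ 3)) := by
    refine (le_abs_self _).trans ?_
    rw [abs_mul]
    gcongr
    exact H.Lze hx'
  have h6 := mul_le_mul_of_nonpos_left h2 hc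
  linarith


/-- vanishing at the boundary and at infinity -/
def Van (Ω : Set E3) (w : E3 → ℝ) : Prop :=
  ∀ η > 0, ∃ K ⊆ Ω, IsCompact K ∧ ∀ x ∈ Ω, x ∉ K → |w x| < η

lemma van_of {Ω C : Set E3} {w : E3 → ℝ} (hC : IsClosed C) (hsub : Ω ⊆ C) (hc : ContinuousOn w C)
    (hz : ∀ x ∈ C, x ∉ Ω → w x = 0) (hinf : ∀ η > 0, ∃ R, ∀ x ∈ C, R < ‖x‖ → |w x| < η) : Van Ω w := by
  intro η hη
  obtain ⟨R, hR⟩ := hinf η hη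
  have h1 : IsCompact (Metric.closedBall (0:E3) R ∩ C) := (isCompact_closedBall 0 R).inter_right hC
  have h2 : IsClosed ((Metric.closedBall (0:E3) R ∩ C) ∩ (fun x => |w x|) ⁻¹' Set.Ici η) :=
    (hc.mono Set.inter_subset_right).abs.preimage_isClosed_of_isClosed h1.isClosed isClosed_Ici
  refine ⟨(Metric.closedBall (0:E3) R ∩ C) ∩ (fun x => |w x|) ⁻¹' Set.Ici η, ?_,
    h1.of_isClosed_subset h2 Set.inter_subset_left, ?_⟩
  · rintro x ⟨⟨_, hxC⟩, hx⟩
    by_contra hn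
    have := hz x hxC hn
    simp only [Set.mem_preimage, Set.mem_Ici, this, abs_zero] at hx
    linarith
  · intro x hx hn
    by_contra hcon
    rw [not_lt] at hcon
    apply hn
    refine ⟨⟨?_, hsub hx⟩, hcon⟩
    rw [mem_closedBall_zero_iff]
    by_contra h
    rw [not_le] at h
    exact absurd (hR x (hsub hx) h) (not_lt.2 hcon)

lemma cmp_van {Ω : Set E3} (hΩ : IsOpen Ω) {a : E3 → Fin 3 → Fin 3 → ℝ} {b : E3 → Fin 3 → ℝ}
    (hp : ∀ x ∈ Ω, Pos (a x)) {w B : E3 → ℝ} (hw : ∀ x ∈ Ω, Sm w x) (hB : ∀ x ∈ Ω, Sm B x)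
    (hB0 : ∀ x ∈ Ω, 0 ≤ B x) (hv : Van Ω w) (hL : ∀ x ∈ Ω, Lo a b B x < - |Lo a b w x|) :
    ∀ x ∈ Ω, |w x| ≤ B x := by
  intro x hx
  have h1 := mp hΩ (q := fun y => B y + w y) (fun y hy => (hB y hy).add (hw y hy))
    (fun η hη => by
      obtain ⟨K, hK, hKc, h⟩ := hv η hη
      exact ⟨K, hK, hKc, fun y hy hn => by linarith [hB0 y hy, (abs_lt.1 (h y hy hn)).1]⟩)
    (fun y hy => ⟨a y, hp y hy, b y, by
      have := Lo_add (a := a) (b := b) (hB y hy) (hw y hy)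
      have h2 := hL y hy
      unfold Lo at this h2
      rw [this]; linarith [(le_abs_self (∑ i, ∑ j, a y i j * Hs w i j y + ∑ i, b y i * pd w i y))]⟩) x hx
  have h2 := mp hΩ (q := fun y => B y - w y) (fun y hy => (hB y hy).sub (hw y hy))
    (fun η hη => by
      obtain ⟨K, hK, hKc, h⟩ := hv η hη
      exact ⟨K, hK, hKc, fun y hy hn => by linarith [hB0 y hy, (abs_lt.1 (h y hy hn)).2]⟩)
    (fun y hy => ⟨a y, hp y hy, b y, by
      have := Lo_sub (a := a) (b := b) (hB y hy) (hw y hy)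
      have h2 := hL y hy
      unfold Lo at this h2
      rw [this]; linarith [(neg_abs_le (∑ i, ∑ j, a y i j * Hs w i j y + ∑ i, b y i * pd w i y))]⟩) x hx
  rw [abs_le]; constructor <;> linarith

/-- exterior domain -/
abbrev Ex : Set E3 := {x | 1 < ‖x‖}

lemma Ex_open : IsOpen Ex := isOpen_lt continuous_const continuous_norm

/-- the normalized solution -/
structure VS (a : E3 → Fin 3 → Fin 3 → ℝ) (b : E3 → Fin 3 → ℝ) (v : E3 → ℝ) : Prop where
  c : ContinuousOn v {x | 1 ≤ ‖x‖}
  s : ∀ x ∈ Ex, Sm v x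
  z : ∀ x : E3, ‖x‖ = 1 → v x = 0
  l : ∀ η > 0, ∃ R, ∀ x : E3, R < ‖x‖ → |v x| < η
  e : ∀ x ∈ Ex, Lo a b v x = Lo a b ze x

lemma VS.van {a : E3 → Fin 3 → Fin 3 → ℝ} {b : E3 → Fin 3 → ℝ} {v : E3 → ℝ} (h : VS a b v) : Van Ex v :=
  van_of (C := {x | 1 ≤ ‖x‖}) (isClosed_le continuous_const continuous_norm) (fun x (hx : 1 < ‖x‖) => hx.le) h.c
    (fun x hx hn => h.z x (le_antisymm (not_lt.1 hn) hx)) (fun η hη => by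
      obtain ⟨R, hR⟩ := h.l η hη
      exact ⟨R, fun x _ => hR x⟩)

lemma ze_lt_one {x : E3} (hx : x ∈ Ex) : ze x < 1 := by
  rw [ze]; exact inv_lt_one_of_one_lt₀ hx

lemma Core.pos {τ ε : ℝ} {a : E3 → Fin 3 → Fin 3 → ℝ} {b : E3 → Fin 3 → ℝ} (H : Core τ ε a b)
    (he : ε ≤ 1 / 1000) (hτ : 0 < τ) {x : E3} (hx : x ∈ Ex) : Pos (a x) := by
  have hx' : 1 / 2 < ‖x‖ := by have : 1 < ‖x‖ := hx; linarith
  have h0 := ne0 (by norm_num) hx'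
  refine Pos_near (H.sy x hx') (l := 1 / 3) le_rfl fun i j => (H.ha x hx' i j).trans ?_
  have h1 : ze x ^ τ ≤ 1 := Real.rpow_le_one (ze_pos h0).le (ze_lt_one hx).le hτ.le
  have := mul_le_mul he h1 (Real.rpow_nonneg (ze_pos h0).le _) (by norm_num)
  linarith

/-- first barrier -/
lemma b0_deriv (τ : ℝ) {s : ℝ} (hs : 0 < s) :
    HasDerivAt (fun s : ℝ => s - s ^ (1 + τ)) (1 - (1 + τ) * s ^ τ) s := by
  have := (hasDerivAt_id' s).fun_sub (Real.hasDerivAt_rpow_const (p := 1 + τ) (Or.inl hs.ne'))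
  simpa using this

lemma b0_deriv2 (τ : ℝ) {s : ℝ} (hs : 0 < s) :
    HasDerivAt (fun s : ℝ => 1 - (1 + τ) * s ^ τ) (-((1 + τ) * (τ * s ^ (τ - 1)))) s := by
  have := ((Real.hasDerivAt_rpow_const (p := τ) (Or.inl hs.ne')).const_mul (1 + τ)).const_sub 1
  simpa using this

lemma zpow1 {τ s : ℝ} (hs : 0 < s) : s ^ (τ - 1) * s ^ 4 = s ^ τ * s ^ 3 := by
  rw [Real.rpow_sub_one hs.ne']; field_simp

lemma b0_le {τ s : ℝ} (hτ : 0 < τ) (hτ2 : τ < 1) (hs : 0 < s) (hs1 : s < 1) :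
    0 ≤ s - s ^ (1 + τ) ∧ s - s ^ (1 + τ) ≤ s * (1 - s) ∧ |1 - (1 + τ) * s ^ τ| ≤ 1 := by
  have h1 : s ^ τ ≤ 1 := Real.rpow_le_one hs.le hs1.le hτ.le
  have h2 : s ≤ s ^ τ := by
    have := Real.rpow_le_rpow_of_exponent_ge hs hs1.le hτ2.le
    simpa using this
  rw [Real.rpow_add hs, Real.rpow_one]
  refine ⟨by nlinarith, by nlinarith, ?_⟩
  rw [abs_le]; constructor <;> nlinarith

lemma Core.b0 {τ ε : ℝ} {a : E3 → Fin 3 → Fin 3 → ℝ} {b : E3 → Fin 3 → ℝ} (H : Core τ ε a b)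
    (he0 : 0 < ε) (he : ε ≤ 1 / 1000) (hτ : 1 / 2 < τ) (hτ2 : τ < 1) {x : E3} (hx : x ∈ Ex) :
    Lo a b (fun y => ze y - ze y ^ (1 + τ)) x ≤ - (1 / 2) * (ze x ^ τ * ze x ^ 3) := by
  have h0 := ne0 zero_le_one hx
  have hp := ze_pos h0
  have h := H.barrier he (by linarith) hx (h := fun s => s - s ^ (1 + τ))
    (h' := fun s => 1 - (1 + τ) * s ^ τ) (by
      filter_upwards [lt_mem_nhds hp] with s hs using b0_deriv τ hs) (b0_deriv2 τ hp) (by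
      have : 0 < (1 + τ) * (τ * ze x ^ (τ - 1)) := by positivity
      linarith)
  refine h.trans ?_
  have e : -((1 + τ) * (τ * ze x ^ (τ - 1))) * (99 / 100 * ze x ^ 4) = - (99 / 100 * ((1 + τ) * τ)) * (ze x ^ τ * ze x ^ 3) := by
    rw [← zpow1 hp]; ring
  rw [e]
  have hP : 0 < ze x ^ τ * ze x ^ 3 := by positivity
  have h1 : |1 - (1 + τ) * ze x ^ τ| * (39 * ε * (ze x ^ τ * ze x ^ 3)) ≤ 1 * (39 * (1 / 1000) * (ze x ^ τ * ze x ^ 3)) := by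
    gcongr
    exact (b0_le (by linarith) hτ2 hp (ze_lt_one hx)).2.2
  have h2 : - (99 / 100 * ((1 + τ) * τ)) * (ze x ^ τ * ze x ^ 3) ≤ - (7 / 10) * (ze x ^ τ * ze x ^ 3) := by
    apply mul_le_mul_of_nonneg_right _ hP.le
    nlinarith
  linarith

lemma sm_rpow {x : E3} (hx : x ≠ 0) (p : ℝ) : Sm (fun y => ze y ^ p) x :=
  (sm_ze hx).rpow_const_of_ne (ze_pos hx).ne'

lemma VS.st1 {τ ε : ℝ} {a : E3 → Fin 3 → Fin 3 → ℝ} {b : E3 → Fin 3 → ℝ} {v : E3 → ℝ} (h : VS a b v) (H : Core τ ε a b)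
    (he0 : 0 < ε) (he : ε ≤ 1 / 1000) (hτ : 1 / 2 < τ) (hτ2 : τ < 1) {x : E3} (hx : x ∈ Ex) :
    |v x| ≤ 100 * ε * (ze x * (1 - ze x)) := by
  have hb := fun (y : E3) (hy : y ∈ Ex) => b0_le (τ := τ) (by linarith) hτ2 (ze_pos (ne0 zero_le_one hy)) (ze_lt_one hy)
  have hs : ∀ y ∈ Ex, Sm (fun y => ze y - ze y ^ (1 + τ)) y := fun y hy =>
    (sm_ze (ne0 zero_le_one hy)).sub (sm_rpow (ne0 zero_le_one hy) _)
  have := cmp_van Ex_open (fun y hy => H.pos he (by linarith) hy) (b := b) (w := v)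
    (B := fun y => 100 * ε * (ze y - ze y ^ (1 + τ))) h.s (fun y hy => contDiffAt_const.mul (hs y hy))
    (fun y hy => mul_nonneg (by positivity) (hb y hy).1) h.van (by
      intro y hy
      rw [Lo_cmul _ (hs y hy), h.e y hy]
      have hy' : 1 / 2 < ‖y‖ := by have : 1 < ‖y‖ := hy; linarith
      have hp := ze_pos (ne0 zero_le_one hy)
      have h1 := H.Lze hy'
      have h2 := mul_le_mul_of_nonneg_left (H.b0 he0 he hτ hτ2 hy) (by positivity : 0 ≤ 100 * ε)
      have hP : 0 < ε * (ze y ^ τ * ze y ^ 3) := by positivity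
      nlinarith) x hx
  refine this.trans ?_
  have := (hb x hx).2.1
  gcongr


lemma ball_facts {x : E3} {d : ℝ} (hx : x ∈ Ex) (hd : 0 < d) (hdr : d ≤ (‖x‖ - 1) / 2) {y : E3}
    (hy : y ∈ Metric.closedBall x d) : y ∈ Ex ∧ (‖x‖ + 1) / 2 ≤ ‖y‖ ∧ ‖y‖ ≤ ‖x‖ + d ∧ 0 < ze y ∧ ze y < 1 ∧ ze y ≤ 2 * ze x ∧ d * ze y ≤ 1 := by
  have hx' : 1 < ‖x‖ := hx
  rw [mem_closedBall_iff_norm] at hy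
  have h1 : ‖x‖ ≤ ‖y‖ + ‖y - x‖ := by
    have := norm_sub_le y (y - x); rwa [sub_sub_cancel] at this
  have h2 : ‖y‖ ≤ ‖x‖ + ‖y - x‖ := by
    have := norm_add_le x (y - x); rwa [add_sub_cancel] at this
  have h3 : (‖x‖ + 1) / 2 ≤ ‖y‖ := by linarith
  have hyE : y ∈ Ex := by change 1 < ‖y‖; linarith
  have hyp : 0 < ‖y‖ := by linarith
  refine ⟨hyE, h3, by linarith, ze_pos (ne0 zero_le_one hyE), ze_lt_one hyE, ?_, ?_⟩
  · rw [ze, ze, ← div_eq_mul_inv, inv_eq_one_div, div_le_div_iff₀ hyp (by linarith)]; linarith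
  · rw [ze, ← div_eq_mul_inv, div_le_one hyp]; linarith

lemma rpow_le1 {τ s : ℝ} (hτ : 0 < τ) (hs : 0 < s) (h1 : s < 1) : s ^ τ ≤ 1 := Real.rpow_le_one hs.le h1.le hτ.le

lemma Core.cb {τ ε : ℝ} {a : E3 → Fin 3 → Fin 3 → ℝ} {b : E3 → Fin 3 → ℝ} (H : Core τ ε a b)
    (he0 : 0 < ε) (hτ : 0 < τ) {x : E3} (hx : x ∈ Ex) {d : ℝ} (hd : 0 < d) (hdr : d ≤ (‖x‖ - 1) / 2) : CB a b x d ε := by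
  have E2 : ∀ y ∈ Ex, 1 / 2 < ‖y‖ := fun y hy => by have : 1 < ‖y‖ := hy; linarith
  have F := fun (y : E3) (hy : y ∈ Metric.closedBall x d) => ball_facts hx hd hdr hy
  have k0 : ∀ y ∈ Metric.closedBall x d, ε * ze y ^ τ ≤ ε := fun y hy => by
    obtain ⟨h1, h2, h3, h4, h5, h6, h7⟩ := F y hy
    exact mul_le_of_le_one_right he0.le (rpow_le1 hτ h4 h5)
  have k1 : ∀ y ∈ Metric.closedBall x d, ε * ze y ^ τ * ze y ≤ ε / d := fun y hy => by
    obtain ⟨h1, h2, h3, h4, h5, h6, h7⟩ := F y hy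
    rw [le_div_iff₀ hd]
    calc ε * ze y ^ τ * ze y * d = (ε * ze y ^ τ) * (d * ze y) := by ring
      _ ≤ ε * 1 := mul_le_mul (k0 y hy) h7 (by positivity) he0.le
      _ = ε := mul_one _
  have k2 : ∀ y ∈ Metric.closedBall x d, ε * ze y ^ τ * ze y ^ 2 ≤ ε / d ^ 2 := fun y hy => by
    obtain ⟨h1, h2, h3, h4, h5, h6, h7⟩ := F y hy
    rw [le_div_iff₀ (by positivity)]
    calc ε * ze y ^ τ * ze y ^ 2 * d ^ 2 = (ε * ze y ^ τ) * (d * ze y) ^ 2 := by ring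
      _ ≤ ε * 1 := mul_le_mul (k0 y hy) (pow_le_one₀ (by positivity) h7) (by positivity) he0.le
      _ = ε := mul_one _
  exact ⟨fun y hy => H.sa y (E2 y (F y hy).1), fun y hy => H.sb y (E2 y (F y hy).1), fun y hy => H.sy y (E2 y (F y hy).1),
    fun y hy i j => (H.ha y (E2 y (F y hy).1) i j).trans (k0 y hy),
    fun y hy i j k => (H.da y (E2 y (F y hy).1) i j k).trans (k1 y hy),
    fun y hy i => (H.hb y (E2 y (F y hy).1) i).trans (k1 y hy),
    fun y hy i k => (H.db y (E2 y (F y hy).1) i k).trans (k2 y hy)⟩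

lemma Lo_eq_pd {a : E3 → Fin 3 → Fin 3 → ℝ} {b : E3 → Fin 3 → ℝ} {v : E3 → ℝ} (h : VS a b v) {x : E3} (hx : x ∈ Ex) (k : Fin 3) :
    pd (Lo a b v) k x = pd (Lo a b ze) k x := by
  apply pd_congr
  filter_upwards [Ex_open.mem_nhds hx] with y hy using h.e y hy

lemma VS.st2 {τ ε : ℝ} {a : E3 → Fin 3 → Fin 3 → ℝ} {b : E3 → Fin 3 → ℝ} {v : E3 → ℝ} (h : VS a b v) (H : Core τ ε a b)
    (he0 : 0 < ε) (he : ε ≤ 1 / 2000) (hτ : 1 / 2 < τ) (hτ2 : τ < 1) {x : E3} (hx : x ∈ Ex) :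
    (∀ i, |pd v i x| ≤ 10 ^ 10 * ε * ze x ^ 2) ∧ ∀ i j, |Hs v i j x| ≤ 10 ^ 10 * ε * (ze x ^ 3 * (1 - ze x)⁻¹) := by
  have hx' : 1 < ‖x‖ := hx
  have hτ0 : 0 < τ := by linarith
  obtain ⟨d, hde⟩ : ∃ d, d = (‖x‖ - 1) / 2 := ⟨_, rfl⟩
  have hd : 0 < d := by rw [hde]; linarith
  have F := fun (y : E3) (hy : y ∈ Metric.closedBall x d) => ball_facts hx hd hde.le hy
  have hz := ze_pos (ne0 zero_le_one hx)
  have hz1 := ze_lt_one hx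
  have hdz : 1 - ze x = 2 * d * ze x := by
    rw [hde, ze]; field_simp
  have hdz2 : d * ze x ≤ 1 / 2 := by linarith
  have E2 : ∀ y ∈ Ex, 1 / 2 < ‖y‖ := fun y hy => by have : 1 < ‖y‖ := hy; linarith
  have key := int_est (H.cb he0 hτ0 hx hd hde.le) hd (by linarith) (M := 1200 * ε * d * ze x ^ 2) (N := 3000 * ε * ze x ^ 3)
    (by positivity) (by positivity) (V := v) (fun y hy => h.s y (F y hy).1)
    (fun y hy => by
      obtain ⟨h1, h2, h3, h4, h5, h6, h7⟩ := F y hy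
      refine (h.st1 H he0 (by linarith) hτ hτ2 h1).trans ?_
      have h8 : 1 - ze y ≤ 3 * d * ze y := by
        have h1' : 1 < ‖y‖ := h1
        have : (1 - ze y) = (‖y‖ - 1) * ze y := by rw [ze]; field_simp
        rw [this]
        apply mul_le_mul_of_nonneg_right _ h4.le
        linarith
      calc 100 * ε * (ze y * (1 - ze y)) ≤ 100 * ε * (2 * ze x * (3 * d * (2 * ze x))) := by
            gcongr
            exact h8.trans (by gcongr)
        _ = _ := by ring)
    (fun y hy => by
      obtain ⟨h1, h2, h3, h4, h5, h6, h7⟩ := F y hy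
      rw [h.e y h1]
      refine (H.Lze (E2 y h1)).trans ?_
      calc 39 * ε * (ze y ^ τ * ze y ^ 3) ≤ 39 * ε * (1 * (2 * ze x) ^ 3) := by
            gcongr
            exact rpow_le1 hτ0 h4 h5
        _ = 312 * (ε * ze x ^ 3) := by ring
        _ ≤ 3000 * (ε * ze x ^ 3) := by gcongr; norm_num
        _ = _ := by ring)
    (fun y hy k => by
      obtain ⟨h1, h2, h3, h4, h5, h6, h7⟩ := F y hy
      rw [Lo_eq_pd h h1]
      refine (H.dLze (E2 y h1) k).trans ?_
      rw [le_div_iff₀ hd]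
      calc 267 * ε * (ze y ^ τ * ze y ^ 4) * d ≤ 267 * ε * (1 * (2 * ze x) ^ 4) * d := by
            gcongr
            exact rpow_le1 hτ0 h4 h5
        _ = 4272 * (ε * ze x ^ 3) * (d * ze x) := by ring
        _ ≤ 4272 * (ε * ze x ^ 3) * (1 / 2) := by gcongr
        _ ≤ 3000 * ε * ze x ^ 3 := by have : 0 < ε * ze x ^ 3 := by positivity
                                      linarith)
  constructor
  · intro i
    refine (key.1 i).trans ?_
    have e : 4 * (3000 * ε * ze x ^ 3) * d + 80 * (1200 * ε * d * ze x ^ 2) / d = (12000 * (d * ze x) + 96000) * (ε * ze x ^ 2) := by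
      field_simp; ring
    rw [e, mul_assoc]
    gcongr
    linarith
  · intro i j
    refine (key.2 i j).trans ?_
    rw [hdz]
    have e : 10 ^ 6 * (3000 * ε * ze x ^ 3 + 1200 * ε * d * ze x ^ 2 / d ^ 2) = (10 ^ 6 * (6000 * (d * ze x) + 2400)) * (ε * (ze x ^ 3 * (2 * d * ze x)⁻¹)) := by
      field_simp; ring
    rw [e, mul_assoc _ ε]
    gcongr
    linarith


/-- matrix action as a continuous linear map -/
def rl (R : Fin 3 → Fin 3 → ℝ) : E3 →L[ℝ] E3 :=
  LinearMap.toContinuousLinearMap (Matrix.toEuclideanLin (Matrix.of R))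

lemma rl_apply (R : Fin 3 → Fin 3 → ℝ) (x : E3) (k : Fin 3) : rl R x k = ∑ i, R k i * x i := by
  simp [rl, Matrix.toLpLin_apply, Matrix.mulVec, dotProduct]

lemma rl_single (R : Fin 3 → Fin 3 → ℝ) (i k : Fin 3) : rl R (EuclideanSpace.single i 1) k = R k i := by
  rw [rl_apply]; simp

lemma pd_rl {R : Fin 3 → Fin 3 → ℝ} {v : E3 → ℝ} {x : E3} (hv : DifferentiableAt ℝ v (rl R x)) (i : Fin 3) :
    pd (fun y => v (rl R y)) i x = ∑ k, pd v k (rl R x) * R k i := by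
  have h := (hv.hasFDerivAt.comp x (rl R).hasFDerivAt).fderiv
  have e : (fun y => v (rl R y)) = v ∘ rl R := rfl
  conv_lhs => rw [pd, e, h]
  simp only [ContinuousLinearMap.comp_apply]
  rw [fderiv_apply_sum]
  simp only [rl_single]

lemma sm_rl {R : Fin 3 → Fin 3 → ℝ} {v : E3 → ℝ} {x : E3} (hv : Sm v (rl R x)) : Sm (fun y => v (rl R y)) x :=
  ContDiffAt.comp x hv (rl R).contDiff.contDiffAt

lemma hs_rl {R : Fin 3 → Fin 3 → ℝ} {v : E3 → ℝ} {x : E3} (hv : Sm v (rl R x)) (i j : Fin 3) :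
    Hs (fun y => v (rl R y)) i j x = ∑ l, (∑ k, Hs v k l (rl R x) * R k i) * R l j := by
  unfold Hs
  have hev : pd (fun y => v (rl R y)) j =ᶠ[𝓝 x] fun y => ∑ l, R l j * pd v l (rl R y) := by
    filter_upwards [(rl R).continuous.continuousAt.eventually hv.ev] with y hy
    rw [pd_rl hy]
    exact Finset.sum_congr rfl fun l _ => mul_comm _ _
  have hd : ∀ l, DifferentiableAt ℝ (fun y => pd v l (rl R y)) x := fun l => (sm_rl (hv.pd l)).da
  rw [pd_congr hev, pd_sum (fun l => (hd l).const_mul _)]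
  refine Finset.sum_congr rfl fun l _ => ?_
  rw [pd_cmul _ (hd l), pd_rl (hv.pd l).da, mul_comm]

/-- orthogonality of a matrix -/
structure Orth (R : Fin 3 → Fin 3 → ℝ) : Prop where
  r : ∀ k l, ∑ i, R k i * R l i = dl k l
  c : ∀ i j, ∑ k, R k i * R k j = dl i j

lemma Orth.norm {R : Fin 3 → Fin 3 → ℝ} (h : Orth R) (x : E3) : ‖rl R x‖ = ‖x‖ := by
  have h1 : ‖rl R x‖ ^ 2 = ‖x‖ ^ 2 := by
    rw [norm_sq_sum, norm_sq_sum]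
    have c := fun i j => h.c i j
    simp only [rl_apply, Fin.sum_univ_three, dl] at c ⊢
    have c00 := c 0 0
    have c01 := c 0 1
    have c02 := c 0 2
    have c11 := c 1 1
    have c12 := c 1 2
    have c22 := c 2 2
    simp at c00 c01 c02 c11 c12 c22
    linear_combination (x 0) ^ 2 * c00 + x 1 ^ 2 * c11 + x 2 ^ 2 * c22 + 2 * x 0 * x 1 * c01 + 2 * x 0 * x 2 * c02 + 2 * x 1 * x 2 * c12
  exact (sq_eq_sq₀ (norm_nonneg _) (norm_nonneg _)).1 h1

lemma Lo_rl {a : E3 → Fin 3 → Fin 3 → ℝ} {b : E3 → Fin 3 → ℝ} {R : Fin 3 → Fin 3 → ℝ} {v : E3 → ℝ} {x : E3}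
    (hv : Sm v (rl R x)) :
    Lo a b (fun y => v (rl R y)) x = ∑ k, ∑ l, (∑ i, ∑ j, a x i j * (R k i * R l j)) * Hs v k l (rl R x)
      + ∑ k, (∑ i, b x i * R k i) * pd v k (rl R x) := by
  unfold Lo
  simp only [hs_rl hv, pd_rl hv.da]
  simp only [Fin.sum_univ_three]
  ring

lemma norm_le_sum (z : E3) {C : ℝ} (h : ∀ i, |z i| ≤ C) : ‖z‖ ≤ 3 * C := by
  have hC : 0 ≤ C := (abs_nonneg _).trans (h 0)
  have h1 : ‖z‖ ^ 2 ≤ (3 * C) ^ 2 := by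
    rw [norm_sq_sum, Fin.sum_univ_three]
    have := fun i => sq_le_sq' (abs_le.1 (h i)).1 (abs_le.1 (h i)).2
    nlinarith [this 0, this 1, this 2]
  exact le_of_sq_le_sq h1 (by positivity)

lemma rl_near {R : Fin 3 → Fin 3 → ℝ} {θ : ℝ} (hR : ∀ k i, |R k i - dl k i| ≤ θ) (x : E3) : ‖rl R x - x‖ ≤ 9 * θ * ‖x‖ := by
  refine (norm_le_sum (C := 3 * (θ * ‖x‖)) _ fun k => ?_).trans (le_of_eq (by ring))
  have e : (rl R x - x) k = ∑ i, (R k i - dl k i) * x i := by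
    rw [PiLp.sub_apply, rl_apply]
    simp [sub_mul, Finset.sum_sub_distrib, dl]
  rw [e]
  exact sum3_abs (hR k) (coord_le x)

lemma half_facts {τ : ℝ} (hτ0 : 0 < τ) (hτ2 : τ < 1) {x y : E3} (hx : x ∈ Ex) (hy : y ∈ Metric.closedBall x (‖x‖ / 2)) :
    1 / 2 ≤ ‖y‖ ∧ (y ∈ Metric.ball x (‖x‖ / 2) → 1 / 2 < ‖y‖) ∧ 0 < ze y ∧ ze y ≤ 2 * ze x ∧ ze y ^ τ ≤ 2 * ze x ^ τ := by
  have hx' : 1 < ‖x‖ := hx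
  rw [mem_closedBall_iff_norm] at hy
  have h1 : ‖x‖ ≤ ‖y‖ + ‖y - x‖ := by
    have := norm_sub_le y (y - x); rwa [sub_sub_cancel] at this
  have h3 : ‖x‖ / 2 ≤ ‖y‖ := by linarith
  have hyp : 0 < ‖y‖ := by linarith
  have hz : 0 < ze y := inv_pos.2 hyp
  have hzx := ze_pos (ne0 zero_le_one hx)
  have h2 : ze y ≤ 2 * ze x := by
    rw [ze, ze, ← div_eq_mul_inv, inv_eq_one_div, div_le_div_iff₀ hyp (by linarith)]; linarith
  refine ⟨by linarith, fun _ => by linarith, hz, h2, ?_⟩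
  refine (Real.rpow_le_rpow hz.le h2 hτ0.le).trans ?_
  rw [Real.mul_rpow (by norm_num) hzx.le]
  gcongr
  calc (2:ℝ) ^ τ ≤ 2 ^ (1:ℝ) := Real.rpow_le_rpow_of_exponent_le (by norm_num) hτ2.le
    _ = 2 := by norm_num

lemma lip_half {f : E3 → ℝ} {C : ℝ} {x z : E3} {θ : ℝ} (hθ : θ ≤ 1 / 18) (hx : x ∈ Ex)
    (hf : ∀ y ∈ Metric.closedBall x (‖x‖ / 2), DifferentiableAt ℝ f y)
    (hd : ∀ y ∈ Metric.closedBall x (‖x‖ / 2), ∀ i, |pd f i y| ≤ C * ze x) (hz : ‖z - x‖ ≤ 9 * θ * ‖x‖) :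
    |f x - f z| ≤ 27 * C * θ := by
  have hx' : 1 < ‖x‖ := hx
  have hzx : 0 < ze x := ze_pos (ne0 zero_le_one hx)
  have hm : z ∈ Metric.closedBall x (‖x‖ / 2) := by
    rw [mem_closedBall_iff_norm]; nlinarith
  have hC : 0 ≤ C * ze x := (abs_nonneg _).trans (hd x (Metric.mem_closedBall_self (by linarith)) 0)
  have := lip_of_pd (convex_closedBall x (‖x‖ / 2)) hf hd (Metric.mem_closedBall_self (by linarith)) hm
  refine this.trans ?_
  rw [norm_sub_rev]
  calc 3 * (C * ze x) * ‖z - x‖ ≤ 3 * (C * ze x) * (9 * θ * ‖x‖) := by gcongr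
    _ = 27 * C * θ * (ze x * ‖x‖) := by ring
    _ = _ := by rw [ze, inv_mul_cancel₀ (by linarith), mul_one]

set_option maxHeartbeats 800000 in
lemma VS.rot {τ ε : ℝ} {a : E3 → Fin 3 → Fin 3 → ℝ} {b : E3 → Fin 3 → ℝ} {v : E3 → ℝ} (h : VS a b v) (H : Core τ ε a b)
    (he0 : 0 < ε) (he : ε ≤ 1 / 2000) (hτ : 1 / 2 < τ) (hτ2 : τ < 1) {R : Fin 3 → Fin 3 → ℝ} (hO : Orth R)
    {θ : ℝ} (hR : ∀ k i, |R k i - dl k i| ≤ θ) (hθ : θ ≤ 1 / 18) {x : E3} (hx : x ∈ Ex) {A g : ℝ} (hA : 1 ≤ A) (hg : 1 ≤ g)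
    (h1 : ∀ i, |pd v i (rl R x)| ≤ A * ε * ze x ^ 2) (h2 : ∀ i j, |Hs v i j (rl R x)| ≤ A * ε * (ze x ^ 3 * g)) :
    |Lo a b (fun y => v (rl R y) - v y) x| ≤ 10 ^ 6 * A * ε * θ * (ze x ^ τ * ze x ^ 3 * g) := by
  have hx' : 1 < ‖x‖ := hx
  have hx2 : 1 / 2 < ‖x‖ := by linarith
  have hτ0 : 0 < τ := by linarith
  have hzx : 0 < ze x := ze_pos (ne0 zero_le_one hx)
  have hθ0 : 0 ≤ θ := (abs_nonneg _).trans (hR 0 0)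
  have hRE : rl R x ∈ Ex := by change 1 < ‖rl R x‖; rw [hO.norm]; exact hx
  have hn := rl_near hR x
  have Fh : ∀ y ∈ Metric.closedBall x (‖x‖ / 2), 1 / 2 < ‖y‖ ∧ 0 < ze y ∧ ze y ≤ 2 * ze x ∧ ze y ^ τ ≤ 2 * ze x ^ τ := by
    intro y hy
    have := half_facts hτ0 hτ2 hx hy
    refine ⟨?_, this.2.2⟩
    rw [mem_closedBall_iff_norm] at hy
    have h1 : ‖x‖ ≤ ‖y‖ + ‖y - x‖ := by
      have := norm_sub_le y (y - x); rwa [sub_sub_cancel] at this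
    linarith
  have La : ∀ k l, |a x k l - a (rl R x) k l| ≤ 27 * (4 * (ε * ze x ^ τ)) * θ := fun k l =>
    lip_half (f := fun y => a y k l) hθ hx (fun y hy => (H.sa y (Fh y hy).1 k l).da) (fun y hy i => by
      obtain ⟨f1, f2, f3, f4⟩ := Fh y hy
      refine (H.da y f1 k l i).trans ?_
      calc ε * ze y ^ τ * ze y ≤ ε * (2 * ze x ^ τ) * (2 * ze x) := by gcongr
        _ = _ := by ring) hn
  have Lb : ∀ k, |b x k - b (rl R x) k| ≤ 27 * (8 * (ε * ze x ^ τ * ze x)) * θ := fun k =>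
    lip_half (f := fun y => b y k) hθ hx (fun y hy => (H.sb y (Fh y hy).1 k).da) (fun y hy i => by
      obtain ⟨f1, f2, f3, f4⟩ := Fh y hy
      refine (H.db y f1 k i).trans ?_
      calc ε * ze y ^ τ * ze y ^ 2 ≤ ε * (2 * ze x ^ τ) * (2 * ze x) ^ 2 := by gcongr
        _ = _ := by ring) hn
  have Lf : |Lo a b ze x - Lo a b ze (rl R x)| ≤ 27 * (8544 * (ε * ze x ^ τ * ze x ^ 3)) * θ :=
    lip_half (f := Lo a b ze) hθ hx (fun y hy => by
      have f1 := (Fh y hy).1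
      have sz := sm_ze (ne0 (by norm_num) f1)
      unfold Lo
      refine DifferentiableAt.fun_add ?_ ?_
      · exact DifferentiableAt.fun_sum fun i _ => DifferentiableAt.fun_sum fun j _ => (H.sa y f1 i j).da.mul (sz.hs i j).da
      · exact DifferentiableAt.fun_sum fun i _ => (H.sb y f1 i).da.mul (sz.pd i).da) (fun y hy i => by
      obtain ⟨f1, f2, f3, f4⟩ := Fh y hy
      refine (H.dLze f1 i).trans ?_
      calc 267 * ε * (ze y ^ τ * ze y ^ 4) ≤ 267 * ε * ((2 * ze x ^ τ) * (2 * ze x) ^ 4) := by gcongr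
        _ = _ := by ring) hn
  have hRR : ∀ k l i j, |R k i * R l j - dl k i * dl l j| ≤ 3 * θ := by
    intro k l i j
    have e : R k i * R l j - dl k i * dl l j = (R k i - dl k i) * (R l j - dl l j) + (R k i - dl k i) * dl l j + dl k i * (R l j - dl l j) := by ring
    rw [e]
    refine (abs_add_le _ _).trans ((add_le_add ((abs_add_le _ _)) le_rfl).trans ?_)
    rw [abs_mul, abs_mul, abs_mul]
    have k1 := mul_le_mul (hR k i) ((hR l j).trans (by linarith : θ ≤ 1)) (abs_nonneg _) hθ0
    have k2 := mul_le_mul (hR k i) (dl_abs l j) (abs_nonneg _) hθ0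
    have k3 := mul_le_mul (dl_abs k i) (hR l j) (abs_nonneg _) zero_le_one
    linarith
  have Ca : ∀ k l, |(∑ i, ∑ j, a x i j * (R k i * R l j)) - a (rl R x) k l| ≤ 135 * (ε * ze x ^ τ) * θ := by
    intro k l
    have e : (∑ i, ∑ j, a x i j * (R k i * R l j)) - a (rl R x) k l
      = ∑ i, ∑ j, (a x i j - dl i j) * (R k i * R l j - dl k i * dl l j) + (a x k l - a (rl R x) k l) := by
      have e1 : ∑ i, ∑ j, (a x i j - dl i j) * (R k i * R l j - dl k i * dl l j)
        = ∑ i, ∑ j, a x i j * (R k i * R l j) - ∑ i, R k i * R l i - (a x k l - dl k l) := by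
        simp [sub_mul, mul_sub, Finset.sum_sub_distrib, dl]
      rw [e1, hO.r]; ring
    rw [e]
    refine (abs_add_le _ _).trans ?_
    have := sum9_abs (H.ha x hx2) (hRR k l)
    linarith [La k l]
  have Cb : ∀ k, |(∑ i, b x i * R k i) - b (rl R x) k| ≤ 219 * (ε * ze x ^ τ * ze x) * θ := by
    intro k
    have e : (∑ i, b x i * R k i) - b (rl R x) k = ∑ i, b x i * (R k i - dl k i) + (b x k - b (rl R x) k) := by
      simp [mul_sub, Finset.sum_sub_distrib, dl]
    rw [e]
    refine (abs_add_le _ _).trans ?_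
    have := sum3_abs (H.hb x hx2) (hR k)
    linarith [Lb k]
  have key : Lo a b (fun y => v (rl R y) - v y) x =
      ∑ k, ∑ l, ((∑ i, ∑ j, a x i j * (R k i * R l j)) - a (rl R x) k l) * Hs v k l (rl R x)
      + ∑ k, ((∑ i, b x i * R k i) - b (rl R x) k) * pd v k (rl R x) - (Lo a b ze x - Lo a b ze (rl R x)) := by
    rw [Lo_sub (sm_rl (h.s _ hRE)) (h.s x hx), Lo_rl (h.s _ hRE), h.e x hx, ← h.e _ hRE]
    simp only [Lo, sub_mul, Finset.sum_sub_distrib]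
    ring
  rw [key]
  refine (abs_sub _ _).trans ((add_le_add ((abs_add_le _ _)) le_rfl).trans ?_)
  have t1 := sum9_abs Ca h2
  have t2 := sum3_abs Cb h1
  obtain ⟨P, hP⟩ : ∃ P, P = ε * θ * (ze x ^ τ * ze x ^ 3) := ⟨_, rfl⟩
  have hP0 : 0 ≤ P := by rw [hP]; positivity
  have e1 : 9 * (135 * (ε * ze x ^ τ) * θ * (A * ε * (ze x ^ 3 * g))) = 1215 * ε * (A * g * P) := by rw [hP]; ring
  have e2 : 3 * (219 * (ε * ze x ^ τ * ze x) * θ * (A * ε * ze x ^ 2)) = 657 * ε * (A * 1 * P) := by rw [hP]; ring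
  have e3 : 27 * (8544 * (ε * ze x ^ τ * ze x ^ 3)) * θ = 230688 * (1 * 1 * P) := by rw [hP]; ring
  rw [e1] at t1
  rw [e2] at t2
  rw [e3] at Lf
  have e4 : 10 ^ 6 * A * ε * θ * (ze x ^ τ * ze x ^ 3 * g) = 10 ^ 6 * (A * g * P) := by rw [hP]; ring
  rw [e4]
  have q1 : A * 1 * P ≤ A * g * P := by gcongr
  have q2 : 1 * 1 * P ≤ A * g * P := by gcongr
  have q0 : 0 ≤ A * g * P := by positivity
  have q3 : ε * (A * g * P) ≤ 1 * (A * g * P) := by gcongr; linarith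
  have q4 : ε * (A * 1 * P) ≤ 1 * (A * g * P) := by gcongr; linarith
  linarith


/-- generic rotation matrix -/
def ro (u z : Fin 3 → ℝ) (c s : ℝ) (k i : Fin 3) : ℝ := dl k i + c * (u k * u i + z k * z i) + s * (z k * u i - u k * z i)

lemma ro_r {u z : Fin 3 → ℝ} {c s : ℝ} (hu : ∑ i, u i ^ 2 = 1) (hz : ∑ i, z i ^ 2 = 1) (huz : ∑ i, u i * z i = 0)
    (hcs : 2 * c + c ^ 2 + s ^ 2 = 0) (k l : Fin 3) : ∑ i, ro u z c s k i * ro u z c s l i = dl k l := by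
  have e : ∑ i, ro u z c s k i * ro u z c s l i = dl k l + 2 * c * (u k * u l + z k * z l)
      + ((c * u k + s * z k) * (c * u l + s * z l)) * ∑ i, u i ^ 2 + ((c * z k - s * u k) * (c * z l - s * u l)) * ∑ i, z i ^ 2
      + ((c * u k + s * z k) * (c * z l - s * u l) + (c * z k - s * u k) * (c * u l + s * z l)) * ∑ i, u i * z i := by
    have e1 : ∑ i, dl k i * dl l i = dl k l := by simp [dl]
    have e2 : ∀ k, ∀ f : Fin 3 → ℝ, ∑ i, dl k i * f i = f k := by intro k f; simp [dl]
    have e3 : ∀ i, ro u z c s k i * ro u z c s l i = dl k i * dl l i + (dl k i * ((c * u l + s * z l) * u i + (c * z l - s * u l) * z i))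
      + (dl l i * ((c * u k + s * z k) * u i + (c * z k - s * u k) * z i)) + ((c * u k + s * z k) * (c * u l + s * z l)) * u i ^ 2
      + ((c * z k - s * u k) * (c * z l - s * u l)) * z i ^ 2
      + ((c * u k + s * z k) * (c * z l - s * u l) + (c * z k - s * u k) * (c * u l + s * z l)) * (u i * z i) := by
      intro i; unfold ro; ring
    simp only [e3, Finset.sum_add_distrib, e1, e2, Finset.mul_sum]
    ring
  rw [e, hu, hz, huz]
  linear_combination (u k * u l + z k * z l) * hcs

lemma ro_orth {u z : Fin 3 → ℝ} {c s : ℝ} (hu : ∑ i, u i ^ 2 = 1) (hz : ∑ i, z i ^ 2 = 1) (huz : ∑ i, u i * z i = 0)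
    (hcs : 2 * c + c ^ 2 + s ^ 2 = 0) : Orth (ro u z c s) := by
  refine ⟨ro_r hu hz huz hcs, fun i j => ?_⟩
  have := ro_r hu hz huz (c := c) (s := -s) (by linear_combination hcs) i j
  rw [← this]
  refine Finset.sum_congr rfl fun k _ => ?_
  have h1 : ∀ k i : Fin 3, dl k i = dl i k := fun k i => by simp [dl, eq_comm]
  unfold ro; rw [h1 k i, h1 k j]; ring

lemma ro_near {p q : Fin 3} {t : ℝ} (ht : |t| ≤ 1) (k i : Fin 3) :
    |ro (fun k => dl k p) (fun k => dl k q) (Real.cos t - 1) (Real.sin t) k i - dl k i| ≤ 4 * |t| := by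
  have h1 : |Real.cos t - 1| ≤ |t| := by
    rw [abs_sub_comm, abs_of_nonneg (by linarith [Real.cos_le_one t])]
    have := Real.one_sub_sq_div_two_le_cos (x := t)
    nlinarith [abs_nonneg t, sq_abs t]
  have h2 := Real.abs_sin_le_abs (x := t)
  have d2 : ∀ a b c d : Fin 3, |dl a b * dl c d| ≤ 1 := fun a b c d => by
    rw [abs_mul]; exact mul_le_one₀ (dl_abs _ _) (abs_nonneg _) (dl_abs _ _)
  have h3 : |dl k p * dl i p + dl k q * dl i q| ≤ 2 := (abs_add_le _ _).trans (by linarith [d2 k p i p, d2 k q i q])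
  have h4 : |dl k q * dl i p - dl k p * dl i q| ≤ 2 := (abs_sub _ _).trans (by linarith [d2 k q i p, d2 k p i q])
  have e : ro (fun k => dl k p) (fun k => dl k q) (Real.cos t - 1) (Real.sin t) k i - dl k i =
    (Real.cos t - 1) * (dl k p * dl i p + dl k q * dl i q) + Real.sin t * (dl k q * dl i p - dl k p * dl i q) := by unfold ro; ring
  rw [e]
  refine (abs_add_le _ _).trans ?_
  rw [abs_mul, abs_mul]
  have := mul_le_mul h1 h3 (abs_nonneg _) (abs_nonneg _)
  have := mul_le_mul h2 h4 (abs_nonneg _) (abs_nonneg _)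
  linarith

/-- the rotation field derivative -/
def rw' (v : E3 → ℝ) (p q : Fin 3) (x : E3) : ℝ := x p * pd v q x - x q * pd v p x

lemma rw_deriv {v : E3 → ℝ} {x : E3} (hv : Sm v x) (p q : Fin 3) :
    HasDerivAt (fun t : ℝ => v (rl (ro (fun k => dl k p) (fun k => dl k q) (Real.cos t - 1) (Real.sin t)) x)) (rw' v p q x) 0 := by
  have e : ∀ t : ℝ, rl (ro (fun k => dl k p) (fun k => dl k q) (Real.cos t - 1) (Real.sin t)) x =
      x + (Real.cos t - 1) • (x p • EuclideanSpace.single p (1:ℝ) + x q • EuclideanSpace.single q (1:ℝ))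
       + Real.sin t • (x p • EuclideanSpace.single q (1:ℝ) - x q • EuclideanSpace.single p (1:ℝ)) := by
    intro t
    ext k
    have e1 : ∀ i, ro (fun k => dl k p) (fun k => dl k q) (Real.cos t - 1) (Real.sin t) k i * x i
      = dl k i * x i + (dl i p * ((Real.cos t - 1) * dl k p * x i) + dl i q * ((Real.cos t - 1) * dl k q * x i))
        + (dl i p * (Real.sin t * dl k q * x i) - dl i q * (Real.sin t * dl k p * x i)) := by
      intro i; unfold ro; ring
    have e2 : ∀ f : Fin 3 → ℝ, ∀ k, ∑ i, dl i k * f i = f k := by intro f k; simp [dl]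
    have e3 : ∀ f : Fin 3 → ℝ, ∀ k, ∑ i, dl k i * f i = f k := by intro f k; simp [dl]
    rw [rl_apply]
    simp only [e1, Finset.sum_add_distrib, Finset.sum_sub_distrib, e2, e3]
    have e4 : ∀ p, (EuclideanSpace.single p (1:ℝ) : E3) k = dl k p := by
      intro p; simp [dl]
    simp only [PiLp.add_apply, PiLp.sub_apply, PiLp.smul_apply, e4, smul_eq_mul]
    ring
  simp only [e]
  have h1 : HasDerivAt (fun t : ℝ => x + (Real.cos t - 1) • (x p • EuclideanSpace.single p (1:ℝ) + x q • EuclideanSpace.single q (1:ℝ))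
       + Real.sin t • (x p • EuclideanSpace.single q (1:ℝ) - x q • EuclideanSpace.single p (1:ℝ)))
       (x p • EuclideanSpace.single q (1:ℝ) - x q • EuclideanSpace.single p (1:ℝ) : E3) 0 := by
    have := ((((Real.hasDerivAt_cos 0).sub_const 1).smul_const (x p • EuclideanSpace.single p (1:ℝ) + x q • EuclideanSpace.single q (1:ℝ) : E3)).const_add x).fun_add
      ((Real.hasDerivAt_sin 0).smul_const (x p • EuclideanSpace.single q (1:ℝ) - x q • EuclideanSpace.single p (1:ℝ) : E3))
    rw [Real.sin_zero, Real.cos_zero, neg_zero, zero_smul, one_smul, zero_add] at this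
    exact this
  have h2 : HasFDerivAt v (fderiv ℝ v x) (x + (Real.cos 0 - 1) • (x p • EuclideanSpace.single p (1:ℝ) + x q • EuclideanSpace.single q (1:ℝ))
       + Real.sin 0 • (x p • EuclideanSpace.single q (1:ℝ) - x q • EuclideanSpace.single p (1:ℝ)) : E3) := by
    simpa using hv.da.hasFDerivAt
  have h3 := h2.comp_hasDerivAt 0 h1
  have e5 : fderiv ℝ v x (x p • EuclideanSpace.single q (1:ℝ) - x q • EuclideanSpace.single p (1:ℝ) : E3) = rw' v p q x := by
    simp [rw', pd]
  rw [e5] at h3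
  exact h3

lemma deriv_bd {f : ℝ → ℝ} {f' C : ℝ} (hf : HasDerivAt f f' 0) (hb : ∀ t, 0 < t → t ≤ 1 / 72 → |f t - f 0| ≤ C * t) : |f'| ≤ C := by
  have h1 := hf.tendsto_slope
  have h2 : Tendsto (slope f 0) (𝓝[>] 0) (𝓝 f') := h1.mono_left (nhdsWithin_mono _ (fun x hx => ne_of_gt hx))
  refine le_of_tendsto h2.abs ?_
  have : Set.Ioc (0:ℝ) (1 / 72) ∈ 𝓝[>] (0:ℝ) := Ioc_mem_nhdsGT (by norm_num)
  filter_upwards [this] with t ht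
  rw [slope_def_field, abs_div, sub_zero, abs_of_pos ht.1, div_le_iff₀ ht.1]
  exact hb t ht.1 ht.2

lemma VS.rotcmp {τ ε : ℝ} {a : E3 → Fin 3 → Fin 3 → ℝ} {b : E3 → Fin 3 → ℝ} {v : E3 → ℝ} (h : VS a b v) (H : Core τ ε a b)
    (he0 : 0 < ε) (he : ε ≤ 1 / 2000) (hτ : 1 / 2 < τ) (hτ2 : τ < 1) {A : ℝ} (hA : 10 ^ 10 ≤ A) {G : ℝ → ℝ} {B : E3 → ℝ}
    (hG : ∀ x ∈ Ex, 1 ≤ G (ze x)) (h2 : ∀ x ∈ Ex, ∀ i j, |Hs v i j x| ≤ A * ε * (ze x ^ 3 * G (ze x)))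
    (sB : ∀ x ∈ Ex, Sm B x) (B0 : ∀ x ∈ Ex, 0 ≤ B x)
    (LB : ∀ x ∈ Ex, Lo a b B x ≤ - (1 / 20) * (ze x ^ τ * ze x ^ 3 * G (ze x)))
    {R : Fin 3 → Fin 3 → ℝ} (hO : Orth R) {θ : ℝ} (hθ0 : 0 < θ)
    (hR : ∀ k i, |R k i - dl k i| ≤ θ) (hθ : θ ≤ 1 / 18) {x : E3} (hx : x ∈ Ex) :
    |v (rl R x) - v x| ≤ 10 ^ 8 * A * ε * θ * B x := by
  have hA0 : 0 < A := by linarith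
  have hRE : ∀ y ∈ Ex, rl R y ∈ Ex := fun y hy => by change 1 < ‖rl R y‖; rw [hO.norm]; exact hy
  have zR : ∀ y, ze (rl R y) = ze y := fun y => by rw [ze, ze, hO.norm]
  have sw : ∀ y ∈ Ex, Sm (fun y => v (rl R y) - v y) y := fun y hy => (sm_rl (h.s _ (hRE y hy))).sub (h.s y hy)
  refine cmp_van Ex_open (fun y hy => H.pos (by linarith) (by linarith) hy) (b := b) (w := fun y => v (rl R y) - v y)
    (B := fun y => 10 ^ 8 * A * ε * θ * B y) sw (fun y hy => contDiffAt_const.mul (sB y hy))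
    (fun y hy => mul_nonneg (by positivity) (B0 y hy)) ?_ ?_ x hx
  · refine van_of (C := {x | 1 ≤ ‖x‖}) (isClosed_le continuous_const continuous_norm) (fun x (hx : 1 < ‖x‖) => hx.le) ?_ ?_ ?_
    · refine ContinuousOn.sub (h.c.comp (rl R).continuous.continuousOn fun y (hy : 1 ≤ ‖y‖) => ?_) h.c
      change 1 ≤ ‖rl R y‖; rw [hO.norm]; exact hy
    · intro y hy hn
      have : ‖y‖ = 1 := le_antisymm (not_lt.1 hn) hy
      rw [h.z y this, h.z (rl R y) (by rw [hO.norm, this]), sub_zero]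
    · intro η hη
      obtain ⟨r, hr⟩ := h.l (η / 2) (by linarith)
      refine ⟨r, fun y _ hy => (abs_sub _ _).trans_lt ?_⟩
      have := hr y hy
      have := hr (rl R y) (by rw [hO.norm]; exact hy)
      linarith
  · intro y hy
    rw [Lo_cmul _ (sB y hy)]
    have hz := ze_pos (ne0 zero_le_one hy)
    have k1 := h.rot H he0 he hτ hτ2 hO hR hθ hy (by linarith : 1 ≤ A) (hG y hy) (fun i => by
      have := (h.st2 H he0 he hτ hτ2 (hRE y hy)).1 i
      rw [zR] at this
      refine this.trans ?_
      gcongr) (fun i j => by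
      have := h2 _ (hRE y hy) i j
      rwa [zR] at this)
    have k2 := mul_le_mul_of_nonneg_left (LB y hy) (by positivity : 0 ≤ 10 ^ 8 * A * ε * θ)
    have hgp := hG y hy
    have hP : 0 < A * ε * θ * (ze y ^ τ * ze y ^ 3 * G (ze y)) := by positivity
    linarith

lemma VS.rotder {τ ε : ℝ} {a : E3 → Fin 3 → Fin 3 → ℝ} {b : E3 → Fin 3 → ℝ} {v : E3 → ℝ} (h : VS a b v) (H : Core τ ε a b)
    (he0 : 0 < ε) (he : ε ≤ 1 / 2000) (hτ : 1 / 2 < τ) (hτ2 : τ < 1) {A : ℝ} (hA : 10 ^ 10 ≤ A) {G : ℝ → ℝ} {B : E3 → ℝ}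
    (hG : ∀ x ∈ Ex, 1 ≤ G (ze x)) (h2 : ∀ x ∈ Ex, ∀ i j, |Hs v i j x| ≤ A * ε * (ze x ^ 3 * G (ze x)))
    (sB : ∀ x ∈ Ex, Sm B x) (B0 : ∀ x ∈ Ex, 0 ≤ B x)
    (LB : ∀ x ∈ Ex, Lo a b B x ≤ - (1 / 20) * (ze x ^ τ * ze x ^ 3 * G (ze x)))
    {x : E3} (hx : x ∈ Ex) (p q : Fin 3) : |rw' v p q x| ≤ 4 * 10 ^ 8 * A * ε * B x := by
  by_cases hpq : p = q
  · subst hpq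
    have := B0 x hx
    simp only [rw', sub_self, abs_zero]
    positivity
  refine deriv_bd (rw_deriv (h.s x hx) p q) fun t ht0 ht => ?_
  have e0 : rl (ro (fun k => dl k p) (fun k => dl k q) (Real.cos 0 - 1) (Real.sin 0)) x = x := by
    ext k; rw [rl_apply]; simp [ro, dl]
  rw [e0]
  have hO : Orth (ro (fun k => dl k p) (fun k => dl k q) (Real.cos t - 1) (Real.sin t)) :=
    ro_orth (by simp [dl]) (by simp [dl]) (by simp [dl, Ne.symm hpq]) (by linear_combination Real.sin_sq_add_cos_sq t)
  have := h.rotcmp H he0 he hτ hτ2 hA hG h2 sB B0 LB hO (θ := 4 * t) (by linarith) (fun k i => by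
    have := ro_near (p := p) (q := q) (t := t) (by rw [abs_of_pos ht0]; linarith) k i
    rwa [abs_of_pos ht0] at this) (by linarith) hx
  refine this.trans (le_of_eq (by ring))


lemma Lo_coord {a : E3 → Fin 3 → Fin 3 → ℝ} {b : E3 → Fin 3 → ℝ} {f : E3 → ℝ} {x : E3} (hf : Sm f x) (p : Fin 3) :
    Lo a b (fun y => y p * f y) x = x p * Lo a b f x + ∑ j, a x p j * pd f j x + ∑ i, a x i p * pd f i x + b x p * f x := by
  have h1 : ∀ i j, Hs (fun y : E3 => y p) i j x = 0 := by
    intro i j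
    unfold Hs
    have : pd (fun y : E3 => y p) j = fun _ => if j = p then 1 else 0 := by ext y; exact pd_coord p j y
    rw [this, pd_const]
  unfold Lo
  simp only [Hs_mul (sm_coord p x) hf, pd_mul (sm_coord p x).da hf.da, h1, pd_coord]
  have e2 : ∀ f : Fin 3 → ℝ, ∑ i, (if i = p then (1:ℝ) else 0) * f i = f p := by intro f; simp
  have r1 : ∀ i j, a x i j * (0 * f x + (if j = p then 1 else 0) * pd f i x + (if i = p then 1 else 0) * pd f j x + x p * Hs f i j x)
    = (if j = p then 1 else 0) * (a x i j * pd f i x) + (if i = p then 1 else 0) * (a x i j * pd f j x) + x p * (a x i j * Hs f i j x) := by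
    intro i j; ring
  have r2 : ∀ i, b x i * ((if i = p then 1 else 0) * f x + x p * pd f i x) = (if i = p then 1 else 0) * (b x i * f x) + x p * (b x i * pd f i x) := by
    intro i; ring
  simp only [r1, r2, Finset.sum_add_distrib, e2, ← Finset.mul_sum]
  ring

lemma sm_rw {v : E3 → ℝ} {x : E3} (hv : Sm v x) (p q : Fin 3) : Sm (rw' v p q) x :=
  ((sm_coord p x).mul (hv.pd q)).sub ((sm_coord q x).mul (hv.pd p))

lemma Lo_rw {a : E3 → Fin 3 → Fin 3 → ℝ} {b : E3 → Fin 3 → ℝ} {v : E3 → ℝ} {x : E3} (hv : Sm v x)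
    (hs : ∀ i j, a x i j = a x j i) (p q : Fin 3) :
    Lo a b (rw' v p q) x = x p * Lo a b (pd v q) x - x q * Lo a b (pd v p) x
      + 2 * (∑ j, (a x p j - dl p j) * Hs v j q x - ∑ j, (a x q j - dl q j) * Hs v j p x) + (b x p * pd v q x - b x q * pd v p x) := by
  have e : rw' v p q = fun y => y p * pd v q y - y q * pd v p y := rfl
  rw [e, Lo_sub ((sm_coord p x).mul (hv.pd q)) ((sm_coord q x).mul (hv.pd p)), Lo_coord (hv.pd q), Lo_coord (hv.pd p)]
  have e1 : ∀ p q, ∑ j, (a x p j - dl p j) * Hs v j q x = ∑ j, a x p j * pd (pd v q) j x - Hs v p q x := by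
    intro p q
    simp [sub_mul, Finset.sum_sub_distrib, dl, Hs]
  have e2 : ∀ p q, ∑ i, a x i p * pd (pd v q) i x = ∑ j, a x p j * pd (pd v q) j x := by
    intro p q; exact Finset.sum_congr rfl fun i _ => by rw [hs i p]
  rw [e1, e1, e2, e2, Hs_symm hv q p]
  ring

lemma VS.Lrw {τ ε : ℝ} {a : E3 → Fin 3 → Fin 3 → ℝ} {b : E3 → Fin 3 → ℝ} {v : E3 → ℝ} (h : VS a b v) (H : Core τ ε a b)
    (he0 : 0 < ε) (hτ : 0 < τ) {x : E3} (hx : x ∈ Ex) (hx3 : ‖x‖ ≤ 5 / 2) {P Q : ℝ}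
    (hP : ∀ i, |pd v i x| ≤ P) (hQ : ∀ i j, |Hs v i j x| ≤ Q) (p q : Fin 3) :
    |Lo a b (rw' v p q) x| ≤ ε * (1400 + 60 * Q + 20 * P) := by
  have hx2 : 1 / 2 < ‖x‖ := by have : 1 < ‖x‖ := hx; linarith
  have hz := ze_pos (ne0 zero_le_one hx)
  have hz1 := (ze_lt_one hx).le
  have hzt : ze x ^ τ ≤ 1 := rpow_le1 hτ hz (ze_lt_one hx)
  have hzt0 : 0 ≤ ze x ^ τ := Real.rpow_nonneg hz.le _
  have hQ0 : 0 ≤ Q := (abs_nonneg _).trans (hQ 0 0)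
  have hP0 : 0 ≤ P := (abs_nonneg _).trans (hP 0)
  have n0 : ε * ze x ^ τ ≤ ε := mul_le_of_le_one_right he0.le hzt
  have n1 : ε * ze x ^ τ * ze x ≤ ε := (mul_le_of_le_one_right (by positivity) hz1).trans n0
  have n2 : ε * ze x ^ τ * ze x ^ 2 ≤ ε := (mul_le_of_le_one_right (by positivity) (pow_le_one₀ hz.le hz1)).trans n0
  have n4 : ze x ^ τ * ze x ^ 4 ≤ 1 := mul_le_one₀ hzt (by positivity) (pow_le_one₀ hz.le hz1)
  have k1 : ∀ q, |Lo a b (pd v q) x| ≤ 267 * ε + 9 * (ε * Q) + 3 * (ε * P) := by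
    intro q
    have e := pd_Lo (H.sa x hx2) (H.sb x hx2) (h.s x hx) q
    rw [Lo_eq_pd h hx] at e
    have e' : Lo a b (pd v q) x = pd (Lo a b ze) q x - ∑ i, ∑ j, pd (fun y => a y i j) q x * Hs v i j x
      - ∑ i, pd (fun y => b y i) q x * pd v i x := by linarith
    rw [e']
    have m1 := H.dLze hx2 q
    have m1' : 267 * ε * (ze x ^ τ * ze x ^ 4) ≤ 267 * ε * 1 := by gcongr
    have m2 := sum9_abs (fun i j => (H.da x hx2 i j q).trans n1) hQ
    have m3 := sum3_abs (fun i => (H.db x hx2 i q).trans n2) hP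
    refine (abs_sub _ _).trans ((add_le_add (abs_sub _ _) le_rfl).trans ?_)
    linarith
  have k2 : ∀ p q, |x p * Lo a b (pd v q) x| ≤ 5 / 2 * (267 * ε + 9 * (ε * Q) + 3 * (ε * P)) := fun p q => by
    rw [abs_mul]
    exact mul_le_mul ((coord_le x p).trans hx3) (k1 q) (abs_nonneg _) (by norm_num)
  have k3 : ∀ p q, |∑ j, (a x p j - dl p j) * Hs v j q x| ≤ 3 * (ε * Q) := fun p q =>
    sum3_abs (fun j => (H.ha x hx2 p j).trans n0) (fun j => hQ j q)
  have k4 : ∀ p q, |b x p * pd v q x| ≤ ε * P := fun p q => by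
    rw [abs_mul]
    exact mul_le_mul ((H.hb x hx2 p).trans n1) (hP q) (abs_nonneg _) he0.le
  rw [Lo_rw (h.s x hx) (H.sy x hx2)]
  have a1 := abs_sub (x p * Lo a b (pd v q) x) (x q * Lo a b (pd v p) x)
  have a2 := abs_sub (∑ j, (a x p j - dl p j) * Hs v j q x) (∑ j, (a x q j - dl q j) * Hs v j p x)
  have a3 := abs_sub (b x p * pd v q x) (b x q * pd v p x)
  refine (abs_add_le _ _).trans ((add_le_add (abs_add_le _ _) le_rfl).trans ?_)
  rw [abs_mul 2, abs_two]
  have hεQ : 0 ≤ ε * Q := by positivity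
  have hεP : 0 ≤ ε * P := by positivity
  linarith [k2 p q, k2 q p, k3 p q, k3 q p, k4 p q, k4 q p]

/-- linear algebra: a symmetric matrix is controlled by its trace and angular contractions -/
lemma mat_alg {x : Fin 3 → ℝ} {r T : ℝ} (hr : 1 ≤ r) (hxr : x 0 ^ 2 + x 1 ^ 2 + x 2 ^ 2 = r ^ 2) (hxi : ∀ i, |x i| ≤ r)
    {m : Fin 3 → Fin 3 → ℝ} (hT : ∀ p q k, |x p * m q k - x q * m p k| ≤ T) (hs : ∀ i j, m i j = m j i) (q k : Fin 3) :
    |m q k| ≤ |m 0 0 + m 1 1 + m 2 2| + 21 * T := by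
  have hr0 : 0 < r := by linarith
  have hT0 : 0 ≤ T := (abs_nonneg _).trans (hT 0 0 0)
  obtain ⟨y, hy⟩ : ∃ y : Fin 3 → ℝ, ∀ k, y k = x 0 * m 0 k + x 1 * m 1 k + x 2 * m 2 k := ⟨_, fun _ => rfl⟩
  have m3 : ∀ f g : Fin 3 → ℝ, ∀ G, (∀ i, |f i| ≤ r) → (∀ i, |g i| ≤ G) → |f 0 * g 0 + f 1 * g 1 + f 2 * g 2| ≤ 3 * (r * G) := by
    intro f g G hf hg
    have := sum3_abs hf hg
    rwa [Fin.sum_univ_three] at this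
  have s1 : ∀ q k, |r ^ 2 * m q k - x q * y k| ≤ 3 * (r * T) := by
    intro q k
    have := m3 x (fun p => x p * m q k - x q * m p k) T hxi (fun p => hT p q k)
    have e : r ^ 2 * m q k - x q * y k = x 0 * (x 0 * m q k - x q * m 0 k) + x 1 * (x 1 * m q k - x q * m 1 k) + x 2 * (x 2 * m q k - x q * m 2 k) := by
      rw [← hxr, hy]; ring
    rw [e]; exact this
  obtain ⟨Y, hY⟩ : ∃ Y, Y = x 0 * y 0 + x 1 * y 1 + x 2 * y 2 := ⟨_, rfl⟩
  obtain ⟨t, ht⟩ : ∃ t, t = m 0 0 + m 1 1 + m 2 2 := ⟨_, rfl⟩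
  have s2 : |r ^ 2 * t - Y| ≤ 9 * (r * T) := by
    have e : r ^ 2 * t - Y = (r ^ 2 * m 0 0 - x 0 * y 0) + (r ^ 2 * m 1 1 - x 1 * y 1) + (r ^ 2 * m 2 2 - x 2 * y 2) := by rw [ht, hY]; ring
    rw [e]
    refine (abs_add_le _ _).trans ((add_le_add (abs_add_le _ _) le_rfl).trans ?_)
    linarith [s1 0 0, s1 1 1, s1 2 2]
  have s3 : ∀ q, |r ^ 2 * y q - x q * Y| ≤ 9 * (r ^ 2 * T) := by
    intro q
    have := m3 x (fun k => r ^ 2 * m q k - x q * y k) _ hxi (fun k => s1 q k)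
    have e : r ^ 2 * y q - x q * Y = x 0 * (r ^ 2 * m q 0 - x q * y 0) + x 1 * (r ^ 2 * m q 1 - x q * y 1) + x 2 * (r ^ 2 * m q 2 - x q * y 2) := by
      rw [hY, hy q, hs q 0, hs q 1, hs q 2]; ring
    rw [e]; refine this.trans (le_of_eq (by ring))
  have s4 : |r ^ 2 * (r ^ 2 * m q k) - x q * x k * (r ^ 2 * t)| ≤ 21 * (r ^ 3 * T) := by
    have e : r ^ 2 * (r ^ 2 * m q k) - x q * x k * (r ^ 2 * t) = r ^ 2 * (r ^ 2 * m q k - x q * y k) + x q * (r ^ 2 * y k - x k * Y) - x q * x k * (r ^ 2 * t - Y) := by ring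
    rw [e]
    refine (abs_sub _ _).trans ((add_le_add (abs_add_le _ _) le_rfl).trans ?_)
    rw [abs_mul, abs_mul, abs_mul, abs_mul, abs_of_pos (by positivity : 0 < r ^ 2)]
    have c1 := mul_le_mul_of_nonneg_left (s1 q k) (by positivity : 0 ≤ r ^ 2)
    have c2 := mul_le_mul (hxi q) (s3 k) (abs_nonneg _) hr0.le
    have c3 := mul_le_mul (mul_le_mul (hxi q) (hxi k) (abs_nonneg _) hr0.le) s2 (abs_nonneg _) (by positivity)
    linarith
  have s5 : r ^ 4 * |m q k| ≤ r ^ 4 * (|t| + 21 * T) := by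
    have c1 : |r ^ 2 * (r ^ 2 * m q k)| ≤ |r ^ 2 * (r ^ 2 * m q k) - x q * x k * (r ^ 2 * t)| + |x q * x k * (r ^ 2 * t)| := by
      have := abs_add_le (r ^ 2 * (r ^ 2 * m q k) - x q * x k * (r ^ 2 * t)) (x q * x k * (r ^ 2 * t))
      rwa [sub_add_cancel] at this
    have c2 : |x q * x k * (r ^ 2 * t)| ≤ r * r * (r ^ 2 * |t|) := by
      rw [abs_mul, abs_mul, abs_mul, abs_of_pos (by positivity : 0 < r ^ 2)]
      have := mul_le_mul (hxi q) (hxi k) (abs_nonneg _) hr0.le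
      gcongr
    have c3 : |r ^ 2 * (r ^ 2 * m q k)| = r ^ 4 * |m q k| := by
      rw [abs_mul, abs_mul, abs_of_pos (by positivity : 0 < r ^ 2)]; ring
    have c4 : r ^ 3 * T ≤ r ^ 4 * T := by
      apply mul_le_mul_of_nonneg_right _ hT0
      exact pow_le_pow_right₀ hr (by norm_num)
    rw [c3] at c1
    linarith
  rw [← ht]
  exact le_of_mul_le_mul_left s5 (by positivity)

lemma VS.hess {τ ε : ℝ} {a : E3 → Fin 3 → Fin 3 → ℝ} {b : E3 → Fin 3 → ℝ} {v : E3 → ℝ} (h : VS a b v) (H : Core τ ε a b)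
    (he0 : 0 < ε) (he : ε ≤ 1 / 2000) (hτ : 0 < τ) {x : E3} (hx : x ∈ Ex) {P D : ℝ}
    (hP : ∀ i, |pd v i x| ≤ P) (hD : ∀ p q i, |pd (rw' v p q) i x| ≤ D) (i j : Fin 3) :
    |Hs v i j x| ≤ 400 * ε + 500 * P + 210 * D := by
  have hx1 : 1 < ‖x‖ := hx
  have hx2 : 1 / 2 < ‖x‖ := by linarith
  have hz := ze_pos (ne0 zero_le_one hx)
  have hz1 := (ze_lt_one hx).le
  have hzt : ze x ^ τ ≤ 1 := rpow_le1 hτ hz (ze_lt_one hx)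
  have hzt0 : 0 ≤ ze x ^ τ := Real.rpow_nonneg hz.le _
  have hP0 : 0 ≤ P := (abs_nonneg _).trans (hP 0)
  have hD0 : 0 ≤ D := (abs_nonneg _).trans (hD 0 0 0)
  have n0 : ε * ze x ^ τ ≤ ε := mul_le_of_le_one_right he0.le hzt
  have n1 : ε * ze x ^ τ * ze x ≤ ε := (mul_le_of_le_one_right (by positivity) hz1).trans n0
  have n3 : ze x ^ τ * ze x ^ 3 ≤ 1 := mul_le_one₀ hzt (by positivity) (pow_le_one₀ hz.le hz1)
  have hv := h.s x hx
  have hT : ∀ p q k, |x p * Hs v q k x - x q * Hs v p k x| ≤ D + 2 * P := by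
    intro p q k
    have e : pd (rw' v p q) k x = dl k p * pd v q x + x p * Hs v k q x - (dl k q * pd v p x + x q * Hs v k p x) := by
      have e : rw' v p q = fun y => y p * pd v q y - y q * pd v p y := rfl
      rw [e, pd_sub ((sm_coord p x).da.fun_mul (hv.pd q).da) ((sm_coord q x).da.fun_mul (hv.pd p).da),
        pd_mul (sm_coord p x).da (hv.pd q).da, pd_mul (sm_coord q x).da (hv.pd p).da, pd_coord, pd_coord]
      rfl
    have e2 : x p * Hs v q k x - x q * Hs v p k x = pd (rw' v p q) k x - dl k p * pd v q x + dl k q * pd v p x := by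
      rw [e, Hs_symm hv q k, Hs_symm hv p k]; ring
    rw [e2]
    have d1 : ∀ k p q, |dl k p * pd v q x| ≤ P := fun k p q => by
      rw [abs_mul]; exact (mul_le_of_le_one_left (abs_nonneg _) (dl_abs k p)).trans (hP q)
    refine (abs_add_le _ _).trans ((add_le_add (abs_sub _ _) le_rfl).trans ?_)
    linarith [d1 k p q, d1 k q p, hD p q k]
  obtain ⟨S, hS⟩ : ∃ S, S = ∑ i, ∑ j, |Hs v i j x| := ⟨_, rfl⟩
  have hle : ∀ i j, |Hs v i j x| ≤ S := fun i j => by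
    rw [hS]
    exact (Finset.single_le_sum (f := fun j => |Hs v i j x|) (fun _ _ => abs_nonneg _) (Finset.mem_univ j)).trans
      (Finset.single_le_sum (f := fun i => ∑ j, |Hs v i j x|) (fun _ _ => Finset.sum_nonneg fun _ _ => abs_nonneg _) (Finset.mem_univ i))
  have htr : |Hs v 0 0 x + Hs v 1 1 x + Hs v 2 2 x| ≤ 39 * ε + ε * S + 3 * (ε * P) := by
    have e0 : ∑ i, ∑ j, dl i j * Hs v i j x = Hs v 0 0 x + Hs v 1 1 x + Hs v 2 2 x := by
      simp [dl, Fin.sum_univ_three]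
    have e1 := Lo_split (a := a) (b := b) (w := v) (x := x)
    rw [e0, h.e x hx] at e1
    have e2 : Hs v 0 0 x + Hs v 1 1 x + Hs v 2 2 x = Lo a b ze x - ∑ i, ∑ j, (a x i j - dl i j) * Hs v i j x - ∑ i, b x i * pd v i x := by linarith
    rw [e2]
    refine (abs_sub _ _).trans ((add_le_add (abs_sub _ _) le_rfl).trans ?_)
    have c1 := H.Lze hx2
    have c1' : 39 * ε * (ze x ^ τ * ze x ^ 3) ≤ 39 * ε * 1 := by gcongr
    have c2 : |∑ i, ∑ j, (a x i j - dl i j) * Hs v i j x| ≤ ε * S := by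
      rw [hS, Finset.mul_sum]
      refine (Finset.abs_sum_le_sum_abs _ _).trans (Finset.sum_le_sum fun i _ => ?_)
      rw [Finset.mul_sum]
      refine (Finset.abs_sum_le_sum_abs _ _).trans (Finset.sum_le_sum fun j _ => ?_)
      rw [abs_mul]
      exact mul_le_mul_of_nonneg_right ((H.ha x hx2 i j).trans n0) (abs_nonneg _)
    have c3 := sum3_abs (fun i => (H.hb x hx2 i).trans n1) hP
    linarith
  have hnq := norm_sq_sum x
  rw [Fin.sum_univ_three] at hnq
  have key : ∀ q k, |Hs v q k x| ≤ 39 * ε + ε * S + 3 * (ε * P) + 21 * (D + 2 * P) := fun q k =>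
    (mat_alg (x := x) hx1.le hnq.symm (coord_le x) (m := fun i j => Hs v i j x) hT (fun i j => Hs_symm hv i j) q k).trans (by linarith)
  have hSle : S ≤ 9 * (39 * ε + ε * S + 3 * (ε * P) + 21 * (D + 2 * P)) := by
    rw [hS]
    refine (Finset.sum_le_sum fun i _ => Finset.sum_le_sum fun j _ => key i j).trans ?_
    rw [← hS]
    simp
    linarith
  have hS0 : 0 ≤ S := (abs_nonneg _).trans (hle 0 0)
  have f1 : ε * S ≤ 1 / 2000 * S := by gcongr
  have f2 : ε * P ≤ 1 / 2000 * P := by gcongr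
  linarith [hle i j]


lemma Core.bar {τ ε : ℝ} {a : E3 → Fin 3 → Fin 3 → ℝ} {b : E3 → Fin 3 → ℝ} (H : Core τ ε a b)
    (he0 : 0 < ε) (he : ε ≤ 1 / 2000) (hτ : 1 / 2 < τ) (hτ2 : τ < 1) {x : E3} (hx : x ∈ Ex) {q q' : ℝ → ℝ} {q'' G : ℝ}
    (hq : ∀ s, 0 < s → s < 1 → HasDerivAt q (q' s) s) (hq' : HasDerivAt q' q'' (ze x)) (hG : 1 ≤ G) (hG2 : ze x ≤ 1 / 2 → G ≤ 2)
    (h1 : |q' (ze x)| ≤ G) (h2 : q'' ≤ - (1 / 4) * G) :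
    Lo a b (fun y => (ze y - ze y ^ (1 + τ)) + q (ze y)) x ≤ - (1 / 20) * (ze x ^ τ * ze x ^ 3 * G) := by
  have h0 := ne0 zero_le_one hx
  have hp := ze_pos h0
  have hp1 := ze_lt_one hx
  have hm : 0 < (1 + τ) * (τ * ze x ^ (τ - 1)) := by positivity
  have h := H.barrier (by linarith) (by linarith) hx (h := fun s => (s - s ^ (1 + τ)) + q s)
    (h' := fun s => (1 - (1 + τ) * s ^ τ) + q' s) (by
      filter_upwards [Ioo_mem_nhds hp hp1] with s hs using (b0_deriv τ hs.1).fun_add (hq s hs.1 hs.2)) ((b0_deriv2 τ hp).fun_add hq') (by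
      linarith)
  refine h.trans ?_
  have e : (-((1 + τ) * (τ * ze x ^ (τ - 1))) + q'') * (99 / 100 * ze x ^ 4) = - (99 / 100 * ((1 + τ) * τ)) * (ze x ^ τ * ze x ^ 3)
     + q'' * (99 / 100 * ze x ^ 4) := by
    rw [← zpow1 hp]; ring
  rw [e]
  have hzt : ze x ^ τ ≤ 1 := rpow_le1 (by linarith) hp hp1
  obtain ⟨P, hPe⟩ : ∃ P, P = ze x ^ τ * ze x ^ 3 := ⟨_, rfl⟩
  have hP : 0 < P := by rw [hPe]; positivity
  rw [← hPe]
  have c1 : |1 - (1 + τ) * ze x ^ τ + q' (ze x)| * (39 * ε * P) ≤ (2 * G) * (39 * (1 / 2000) * P) := by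
    have := (abs_add_le (1 - (1 + τ) * ze x ^ τ) (q' (ze x))).trans (add_le_add (b0_le (by linarith) hτ2 hp (ze_lt_one hx)).2.2 h1)
    gcongr
    linarith
  have c2 : - (99 / 100 * ((1 + τ) * τ)) * P ≤ - (7 / 10) * P := by
    apply mul_le_mul_of_nonneg_right _ hP.le
    nlinarith
  have c3 : q'' * (99 / 100 * ze x ^ 4) ≤ (- (1 / 4) * G) * (99 / 100 * ze x ^ 4) := by gcongr
  have hPG : 0 < P * G := by positivity
  rcases le_total (ze x) (1 / 2) with hz | hz
  · have := mul_le_mul_of_nonneg_left (hG2 hz) hP.le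
    have : 0 ≤ (1 / 4) * G * (99 / 100 * ze x ^ 4) := by positivity
    linarith
  · have c4 : P ≤ 2 * ze x ^ 4 := by
      rw [hPe]
      have : ze x ^ 4 = ze x * ze x ^ 3 := by ring
      rw [this, ← mul_assoc]
      apply mul_le_mul_of_nonneg_right _ (by positivity)
      linarith
    have := mul_le_mul_of_nonneg_right c4 (by linarith : 0 ≤ G)
    linarith

lemma rpow_sum2 {d γ : ℝ} (hd : 0 < d) : d ^ (1 / 2 - γ) = d ^ (-γ) * d ^ (1 / 2 : ℝ) ∧ d ^ (3 / 2 - γ) = d ^ (-γ) * d ^ (1 / 2 : ℝ) * d := by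
  constructor
  · rw [← Real.rpow_add hd]; congr 1; ring
  · rw [← Real.rpow_add hd, ← Real.rpow_add_one hd.ne']; congr 1; ring

lemma rpow_up {c γ : ℝ} (hc : 1 ≤ c) (h1 : γ ≤ 1) : c ^ γ ≤ c := by
  have := Real.rpow_le_rpow_of_exponent_le hc h1
  simpa using this

lemma rpow_negle {s t c γ : ℝ} (ht : 0 < t) (hc : 1 ≤ c) (hst : t / c ≤ s) (hγ : 0 ≤ γ) (h1 : γ ≤ 1) : s ^ (-γ) ≤ c * t ^ (-γ) := by
  have hc0 : 0 < c := by linarith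
  have h2 : 0 < t / c := by positivity
  refine (Real.rpow_le_rpow_of_nonpos h2 hst (by linarith)).trans ?_
  rw [Real.div_rpow ht.le hc0.le, Real.rpow_neg hc0.le, div_inv_eq_mul, mul_comm]
  apply mul_le_mul_of_nonneg_right (rpow_up hc h1) (by positivity)

lemma VS.pass {τ ε : ℝ} {a : E3 → Fin 3 → Fin 3 → ℝ} {b : E3 → Fin 3 → ℝ} {v : E3 → ℝ} (h : VS a b v) (H : Core τ ε a b)
    (he0 : 0 < ε) (he : ε ≤ 1 / 2000) (hτ : 1 / 2 < τ) (hτ2 : τ < 1) {A γ : ℝ} (hA : 10 ^ 10 ≤ A) (hγ1 : 1 / 2 ≤ γ) (hγ2 : γ ≤ 1) {B : E3 → ℝ}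
    (h2 : ∀ x ∈ Ex, ∀ i j, |Hs v i j x| ≤ A * ε * (ze x ^ 3 * (1 - ze x) ^ (-γ)))
    (sB : ∀ x ∈ Ex, Sm B x) (B0 : ∀ x ∈ Ex, 0 ≤ B x) (B1 : ∀ x ∈ Ex, B x ≤ 2 * (1 - ze x) ^ (3 / 2 - γ))
    (LB : ∀ x ∈ Ex, Lo a b B x ≤ - (1 / 20) * (ze x ^ τ * ze x ^ 3 * (1 - ze x) ^ (-γ)))
    {x : E3} (hx : x ∈ Ex) (i j : Fin 3) : |Hs v i j x| ≤ 10 ^ 16 * A * ε * (ze x ^ 3 * (1 - ze x) ^ (1 / 2 - γ)) := by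
  have hA0 : 0 < A := by linarith
  have hx1 : 1 < ‖x‖ := hx
  have hz := ze_pos (ne0 zero_le_one hx)
  have hz1 := ze_lt_one hx
  have hzn : ze x * ‖x‖ = 1 := by rw [ze]; exact inv_mul_cancel₀ (by linarith)
  have hG1 : ∀ y ∈ Ex, 1 ≤ (1 - ze y) ^ (-γ) := fun y hy =>
    Real.one_le_rpow_of_pos_of_le_one_of_nonpos (by linarith [ze_lt_one hy]) (by linarith [ze_pos (ne0 zero_le_one hy)]) (by linarith)
  have hF1 : 1 ≤ (1 - ze x) ^ (1 / 2 - γ) :=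
    Real.one_le_rpow_of_pos_of_le_one_of_nonpos (by linarith) (by linarith) (by linarith)
  rcases le_or_gt 2 ‖x‖ with hx2 | hx2
  · refine ((h.st2 H he0 he hτ hτ2 hx).2 i j).trans ?_
    have hzh : ze x ≤ 1 / 2 := by nlinarith
    have : (1 - ze x)⁻¹ ≤ 2 * (1 - ze x) ^ (1 / 2 - γ) := by
      refine (inv_le_of_inv_le₀ (by norm_num) (by linarith) : (1 - ze x)⁻¹ ≤ 2).trans (by linarith)
    calc 10 ^ 10 * ε * (ze x ^ 3 * (1 - ze x)⁻¹) ≤ 10 ^ 10 * ε * (ze x ^ 3 * (2 * (1 - ze x) ^ (1 / 2 - γ))) := by gcongr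
      _ = 2 * 10 ^ 10 * (ε * (ze x ^ 3 * (1 - ze x) ^ (1 / 2 - γ))) := by ring
      _ ≤ 10 ^ 16 * A * (ε * (ze x ^ 3 * (1 - ze x) ^ (1 / 2 - γ))) := by
        apply mul_le_mul_of_nonneg_right _ (by positivity); linarith
      _ = _ := by ring
  obtain ⟨d, hde⟩ : ∃ d, d = (‖x‖ - 1) / 2 := ⟨_, rfl⟩
  have hd : 0 < d := by rw [hde]; linarith
  have hd1 : d ≤ 1 := by linarith
  have F := fun (y : E3) (hy : y ∈ Metric.closedBall x d) => ball_facts hx hd hde.le hy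
  have F2 : ∀ y ∈ Metric.closedBall x d, ‖y‖ ≤ 5 / 2 ∧ d / 3 ≤ 1 - ze y ∧ 1 - ze y ≤ 3 * d := by
    intro y hy
    obtain ⟨f1, f2, f3, f4, f5, f6, f7⟩ := F y hy
    have hn : ze y * ‖y‖ = 1 := by rw [ze]; exact inv_mul_cancel₀ (by linarith)
    have e : 1 - ze y = (‖y‖ - 1) * ze y := by linear_combination -hn
    have l1 : 1 / 3 ≤ ze y := by nlinarith
    refine ⟨by linarith, ?_, ?_⟩
    · rw [e]
      calc d / 3 = d * (1 / 3) := by ring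
        _ ≤ _ := mul_le_mul (by linarith) l1 (by norm_num) (by linarith)
    · rw [e]
      calc (‖y‖ - 1) * ze y ≤ (3 * d) * 1 := mul_le_mul (by linarith) f5.le f4.le (by linarith)
        _ = _ := by ring
  obtain ⟨K, hK⟩ : ∃ K, K = d ^ (-γ) := ⟨_, rfl⟩
  obtain ⟨s, hs⟩ : ∃ s, s = d ^ (1 / 2 : ℝ) := ⟨_, rfl⟩
  obtain ⟨r1, r2⟩ := rpow_sum2 (d := d) (γ := γ) hd
  rw [← hK, ← hs] at r1 r2
  have hK1 : 1 ≤ K := by rw [hK]; exact Real.one_le_rpow_of_pos_of_le_one_of_nonpos hd hd1 (by linarith)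
  have hs0 : 0 < s := by rw [hs]; positivity
  have hds : d ≤ s := by
    rw [hs]
    have := Real.rpow_le_rpow_of_exponent_ge hd hd1 (by norm_num : (1/2:ℝ) ≤ 1)
    simpa using this
  have hKs : 1 ≤ K * s := by
    rw [← r1]; exact Real.one_le_rpow_of_pos_of_le_one_of_nonpos hd hd1 (by linarith)
  have hD : ∀ p q i, |pd (rw' v p q) i x| ≤ 2 * 10 ^ 11 * A * ε * (K * s) := by
    intro p q i
    have := grad_sub (H.cb he0 (by linarith) hx hd hde.le) hd (by linarith) hd le_rfl subset_rfl
      (M := 24 * 10 ^ 8 * A * ε * (K * s * d)) (N := A * ε * K) (by positivity) (by positivity) (w := rw' v p q)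
      (fun y hy => sm_rw (h.s y (F y hy).1) p q) (fun y hy => by
        obtain ⟨f1, f2, f3, f4, f5, f6, f7⟩ := F y hy
        obtain ⟨g1, g2, g3⟩ := F2 y hy
        refine (h.rotder H he0 he hτ hτ2 hA (G := fun s => (1 - s) ^ (-γ)) hG1 h2 sB B0 LB f1 p q).trans ?_
        have k1 : (1 - ze y) ^ (3 / 2 - γ) ≤ 3 * (K * s * d) := by
          refine (Real.rpow_le_rpow (by linarith) g3 (by linarith)).trans ?_
          rw [Real.mul_rpow (by norm_num) hd.le, r2]
          apply mul_le_mul_of_nonneg_right (rpow_up (by norm_num) (by linarith)) (by positivity)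
        calc 4 * 10 ^ 8 * A * ε * B y ≤ 4 * 10 ^ 8 * A * ε * (2 * (3 * (K * s * d))) := by
              have := B1 y f1
              gcongr
              linarith
          _ = _ := by ring) (fun y hy => by
        obtain ⟨f1, f2, f3, f4, f5, f6, f7⟩ := F y hy
        obtain ⟨g1, g2, g3⟩ := F2 y hy
        have q1 : ∀ i j, |Hs v i j y| ≤ A * ε * (3 * K) := fun i j => (h2 y f1 i j).trans (by
          have k1 : (1 - ze y) ^ (-γ) ≤ 3 * K := by
            rw [hK]; exact rpow_negle hd (by norm_num) g2 (by linarith) hγ2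
          have k2 : ze y ^ 3 ≤ 1 := pow_le_one₀ f4.le f5.le
          have := hG1 y f1
          calc A * ε * (ze y ^ 3 * (1 - ze y) ^ (-γ)) ≤ A * ε * (1 * (3 * K)) := by gcongr
            _ = _ := by ring)
        have q2 : ∀ i, |pd v i y| ≤ A * ε := fun i => ((h.st2 H he0 he hτ hτ2 f1).1 i).trans (by
          have k2 : ze y ^ 2 ≤ 1 := pow_le_one₀ f4.le f5.le
          calc 10 ^ 10 * ε * ze y ^ 2 ≤ A * ε * 1 := by gcongr
            _ = _ := by ring)
        refine (h.Lrw H he0 (by linarith) f1 g1 q2 q1 p q).trans ?_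
        have w1 : A * ε * (3 * K) ≤ A * (1 / 2000) * (3 * K) := by gcongr
        have w2 : A * ε ≤ A * (1 / 2000) := by gcongr
        have w3 : A ≤ A * K := le_mul_of_one_le_right hA0.le hK1
        calc ε * (1400 + 60 * (A * ε * (3 * K)) + 20 * (A * ε)) ≤ ε * (A * K) := by
              gcongr
              linarith
          _ = _ := by ring) i
    refine this.trans ?_
    have e : 80 * (24 * 10 ^ 8 * A * ε * (K * s * d)) / d = 1920 * 10 ^ 8 * (A * ε * (K * s)) := by field_simp; ring
    rw [e]
    have : A * ε * K * d ≤ A * ε * K * s := by gcongr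
    have : 0 < A * ε * (K * s) := by positivity
    linarith
  have hP : ∀ i, |pd v i x| ≤ A * ε := fun i => ((h.st2 H he0 he hτ hτ2 hx).1 i).trans (by
    have k2 : ze x ^ 2 ≤ 1 := pow_le_one₀ hz.le hz1.le
    calc 10 ^ 10 * ε * ze x ^ 2 ≤ A * ε * 1 := by gcongr
      _ = _ := by ring)
  have := h.hess H he0 he (by linarith) hx hP hD i j
  refine this.trans ?_
  have m1 : 1 - ze x = 2 * d * ze x := by rw [hde, ze]; field_simp
  have m2 : K * s ≤ 2 * (1 - ze x) ^ (1 / 2 - γ) := by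
    rw [← r1]
    have e : 1 / 2 - γ = - (γ - 1 / 2) := by ring
    rw [e]
    refine rpow_negle (by linarith) (by norm_num) ?_ (by linarith) (by linarith)
    rw [m1]; nlinarith
  have m3 : 1 ≤ 8 * ze x ^ 3 := by
    have : 1 / 2 ≤ ze x := by nlinarith
    have := pow_le_pow_left₀ (by norm_num) this 3
    linarith
  obtain ⟨E, hE⟩ : ∃ E, E = (1 - ze x) ^ (1 / 2 - γ) := ⟨_, rfl⟩
  rw [← hE] at m2 hF1 ⊢
  have m4 : E ≤ 8 * (ze x ^ 3 * E) := by
    have := mul_le_mul_of_nonneg_right m3 (by linarith : 0 ≤ E); linarith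
  have Ap : 0 < A * ε := by positivity
  have m5 : ε ≤ A * ε := le_mul_of_one_le_left he0.le (by linarith)
  have m6 : A * ε ≤ A * ε * (8 * (ze x ^ 3 * E)) := le_mul_of_one_le_right Ap.le (by linarith)
  have m7 : A * ε * (K * s) ≤ A * ε * (16 * (ze x ^ 3 * E)) := mul_le_mul_of_nonneg_left (by linarith) Ap.le
  linarith

lemma q1_deriv (p : ℝ) {s : ℝ} (h1 : s < 1) : HasDerivAt (fun s : ℝ => (1 - s) ^ p) (-(p * (1 - s) ^ (p - 1))) s := by
  have := ((hasDerivAt_id' s).const_sub 1).rpow_const (p := p) (Or.inl (by linarith : (1 - s) ≠ 0))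
  refine this.congr_deriv (by ring)

lemma sm_q {x : E3} (hx : x ∈ Ex) (p : ℝ) : Sm (fun y => (1 - ze y) ^ p) x :=
  (contDiffAt_const.sub (sm_ze (ne0 zero_le_one hx))).rpow_const_of_ne (sub_ne_zero.2 (ze_lt_one hx).ne')

lemma sm_b0 {τ : ℝ} {x : E3} (hx : x ∈ Ex) : Sm (fun y => ze y - ze y ^ (1 + τ)) x :=
  (sm_ze (ne0 zero_le_one hx)).sub (sm_rpow (ne0 zero_le_one hx) _)

lemma VS.p1 {τ ε : ℝ} {a : E3 → Fin 3 → Fin 3 → ℝ} {b : E3 → Fin 3 → ℝ} {v : E3 → ℝ} (h : VS a b v) (H : Core τ ε a b)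
    (he0 : 0 < ε) (he : ε ≤ 1 / 2000) (hτ : 1 / 2 < τ) (hτ2 : τ < 1)
    {x : E3} (hx : x ∈ Ex) (i j : Fin 3) : |Hs v i j x| ≤ 10 ^ 26 * ε * (ze x ^ 3 * (1 - ze x) ^ (-(1/2):ℝ)) := by
  have sp : ∀ y ∈ Ex, 0 < 1 - ze y ∧ 1 - ze y ≤ 1 := fun y hy => ⟨by linarith [ze_lt_one hy], by linarith [ze_pos (ne0 zero_le_one hy)]⟩
  have := h.pass H he0 he hτ hτ2 (A := 10 ^ 10) (γ := 1) le_rfl (by norm_num) le_rfl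
    (B := fun y => (ze y - ze y ^ (1 + τ)) + (1 - ze y) ^ (1 / 2 : ℝ)) (fun y hy i j => by
      rw [Real.rpow_neg_one]; exact (h.st2 H he0 he hτ hτ2 hy).2 i j)
    (fun y hy => (sm_b0 hy).add (sm_q hy _))
    (fun y hy => by
      have := (b0_le (τ := τ) (by linarith) hτ2 (ze_pos (ne0 zero_le_one hy)) (ze_lt_one hy)).1
      have := Real.rpow_nonneg (sp y hy).1.le (1 / 2)
      linarith)
    (fun y hy => by
      have h1 := (b0_le (τ := τ) (by linarith) hτ2 (ze_pos (ne0 zero_le_one hy)) (ze_lt_one hy)).2.1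
      have h2 := Real.rpow_le_rpow_of_exponent_ge (sp y hy).1 (sp y hy).2 (by norm_num : (1/2:ℝ) ≤ 1)
      rw [Real.rpow_one] at h2
      have e : (3 / 2 - 1 : ℝ) = 1 / 2 := by norm_num
      rw [e]
      have := mul_le_of_le_one_left (sp y hy).1.le (ze_lt_one hy).le
      linarith)
    (fun y hy => by
      obtain ⟨s0, s1⟩ := sp y hy
      have hd : HasDerivAt (fun s : ℝ => -(1 / 2 * (1 - s) ^ (1 / 2 - 1 : ℝ))) (-(1 / 4) * (1 - ze y) ^ (-(3 / 2) : ℝ)) (ze y) := by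
        refine (((q1_deriv (1 / 2 - 1) (ze_lt_one hy)).const_mul (1 / 2)).neg).congr_deriv ?_
        have e : (1 / 2 - 1 - 1 : ℝ) = -(3 / 2) := by norm_num
        rw [e]; ring
      refine H.bar he0 he hτ hτ2 hy (q := fun s => (1 - s) ^ (1 / 2 : ℝ)) (q' := fun s : ℝ => -(1 / 2 * (1 - s) ^ (1 / 2 - 1 : ℝ))) (G := (1 - ze y) ^ (-1 : ℝ)) (fun s _ hs => q1_deriv (1 / 2) hs) hd
        (Real.one_le_rpow_of_pos_of_le_one_of_nonpos s0 s1 (by norm_num)) ?_ ?_ ?_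
      · intro hz
        rw [Real.rpow_neg_one]
        exact inv_le_of_inv_le₀ (by norm_num) (by linarith)
      · rw [abs_neg, abs_of_nonneg (by positivity)]
        have h2 := Real.rpow_le_rpow_of_exponent_ge s0 s1 (by norm_num : (-1:ℝ) ≤ 1 / 2 - 1)
        have := Real.rpow_nonneg s0.le (1 / 2 - 1)
        linarith
      · have h2 := Real.rpow_le_rpow_of_exponent_ge s0 s1 (by norm_num : (-(3 / 2):ℝ) ≤ -1)
        linarith) hx i j
  have e : (1 / 2 - 1 : ℝ) = -(1 / 2) := by norm_num
  rw [e] at this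
  refine this.trans (le_of_eq (by ring))

lemma VS.p2 {τ ε : ℝ} {a : E3 → Fin 3 → Fin 3 → ℝ} {b : E3 → Fin 3 → ℝ} {v : E3 → ℝ} (h : VS a b v) (H : Core τ ε a b)
    (he0 : 0 < ε) (he : ε ≤ 1 / 2000) (hτ : 1 / 2 < τ) (hτ2 : τ < 1)
    {x : E3} (hx : x ∈ Ex) (i j : Fin 3) : |Hs v i j x| ≤ 10 ^ 42 * ε * ze x ^ 3 := by
  have sp : ∀ y ∈ Ex, 0 < 1 - ze y ∧ 1 - ze y ≤ 1 := fun y hy => ⟨by linarith [ze_lt_one hy], by linarith [ze_pos (ne0 zero_le_one hy)]⟩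
  have := h.pass H he0 he hτ hτ2 (A := 10 ^ 26) (γ := 1 / 2) (by norm_num) le_rfl (by norm_num)
    (B := fun y => (ze y - ze y ^ (1 + τ)) + ((1 - ze y) - 1 / 2 * (1 - ze y) ^ (3 / 2 : ℝ))) (fun y hy i j => h.p1 H he0 he hτ hτ2 hy i j)
    (fun y hy => (sm_b0 hy).add ((contDiffAt_const.sub (sm_ze (ne0 zero_le_one hy))).sub (contDiffAt_const.mul (sm_q hy _))))
    (fun y hy => by
      have := (b0_le (τ := τ) (by linarith) hτ2 (ze_pos (ne0 zero_le_one hy)) (ze_lt_one hy)).1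
      have h2 := Real.rpow_le_rpow_of_exponent_ge (sp y hy).1 (sp y hy).2 (by norm_num : (1:ℝ) ≤ 3 / 2)
      rw [Real.rpow_one] at h2
      linarith [(sp y hy).1])
    (fun y hy => by
      have h1 := (b0_le (τ := τ) (by linarith) hτ2 (ze_pos (ne0 zero_le_one hy)) (ze_lt_one hy)).2.1
      have h2 := Real.rpow_nonneg (sp y hy).1.le (3 / 2)
      have e : (3 / 2 - 1 / 2 : ℝ) = 1 := by norm_num
      rw [e, Real.rpow_one]
      have := mul_le_of_le_one_left (sp y hy).1.le (ze_lt_one hy).le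
      linarith)
    (fun y hy => by
      obtain ⟨s0, s1⟩ := sp y hy
      have hd0 : ∀ s : ℝ, 0 < s → s < 1 → HasDerivAt (fun s : ℝ => (1 - s) - 1 / 2 * (1 - s) ^ (3 / 2 : ℝ)) (-1 + 3 / 4 * (1 - s) ^ (1 / 2 : ℝ)) s := by
        intro s _ hs
        refine (((hasDerivAt_id' s).const_sub 1).fun_sub ((q1_deriv (3 / 2) hs).const_mul (1 / 2))).congr_deriv ?_
        have e : (3 / 2 - 1 : ℝ) = 1 / 2 := by norm_num
        rw [e]; ring
      have hd : HasDerivAt (fun s : ℝ => -1 + 3 / 4 * (1 - s) ^ (1 / 2 : ℝ)) (-(3 / 8) * (1 - ze y) ^ (-(1 / 2) : ℝ)) (ze y) := by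
        refine (((q1_deriv (1 / 2) (ze_lt_one hy)).const_mul (3 / 4)).const_add (-1)).congr_deriv ?_
        have e : (1 / 2 - 1 : ℝ) = -(1 / 2) := by norm_num
        rw [e]; ring
      have g1 : 1 ≤ (1 - ze y) ^ (-(1 / 2) : ℝ) := Real.one_le_rpow_of_pos_of_le_one_of_nonpos s0 s1 (by norm_num)
      refine H.bar he0 he hτ hτ2 hy (q := fun s => (1 - s) - 1 / 2 * (1 - s) ^ (3 / 2 : ℝ)) (q' := fun s : ℝ => -1 + 3 / 4 * (1 - s) ^ (1 / 2 : ℝ)) (G := (1 - ze y) ^ (-(1/2) : ℝ)) hd0 hd g1 ?_ ?_ ?_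
      · intro hz
        have := rpow_negle (s := 1 - ze y) (t := 1) (c := 2) (γ := 1 / 2) one_pos (by norm_num) (by linarith) (by norm_num) (by norm_num)
        rw [Real.one_rpow] at this
        linarith
      · have h2 := Real.rpow_le_one s0.le s1 (by norm_num : (0:ℝ) ≤ 1 / 2)
        have := Real.rpow_nonneg s0.le (1 / 2)
        rw [abs_le]; constructor <;> linarith
      · linarith) hx i j
  rw [sub_self, Real.rpow_zero] at this
  refine this.trans (le_of_eq (by ring))


/-- flat Laplacian -/
abbrev L0 (w : E3 → ℝ) (x : E3) : ℝ := Lo (fun _ => dl) (fun _ _ => 0) w x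

lemma Core_flat {τ ε : ℝ} (he : 0 < ε) : Core τ ε (fun _ => dl) (fun _ _ => 0) := by
  have P : ∀ x : E3, 1 / 2 < ‖x‖ → 0 < ze x := fun x hx => ze_pos (ne0 (by norm_num) hx)
  refine ⟨fun x _ i j => contDiffAt_const, fun x _ i => contDiffAt_const, fun x _ i j => by simp [dl, eq_comm], fun x hx i j => ?_,
    fun x hx i j k => ?_, fun x hx i => ?_, fun x hx i k => ?_⟩
  · have := P x hx
    rw [sub_self, abs_zero]; positivity
  · have := P x hx
    rw [pd_const, abs_zero]; positivity
  · have := P x hx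
    rw [abs_zero]; positivity
  · have := P x hx
    rw [pd_const, abs_zero]; positivity

lemma VS.lap {τ ε : ℝ} {a : E3 → Fin 3 → Fin 3 → ℝ} {b : E3 → Fin 3 → ℝ} {v : E3 → ℝ} (h : VS a b v) (H : Core τ ε a b)
    (he0 : 0 < ε) (he : ε ≤ 1 / 2000) (hτ : 1 / 2 < τ) (hτ2 : τ < 1) {x : E3} (hx : x ∈ Ex) :
    |L0 v x| ≤ 10 ^ 40 * ε * (ze x ^ τ * ze x ^ 3) := by
  have hx2 : 1 / 2 < ‖x‖ := by have : 1 < ‖x‖ := hx; linarith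
  have hz := ze_pos (ne0 zero_le_one hx)
  have e1 := Lo_split (a := a) (b := b) (w := v) (x := x)
  rw [h.e x hx] at e1
  have e2 : L0 v x = Lo a b ze x - ∑ i, ∑ j, (a x i j - dl i j) * Hs v i j x - ∑ i, b x i * pd v i x := by
    rw [e1]; unfold L0 Lo; simp; ring
  rw [e2]
  refine (abs_sub _ _).trans ((add_le_add (abs_sub _ _) le_rfl).trans ?_)
  have c1 := H.Lze hx2
  have c2 := sum9_abs (H.ha x hx2) (fun i j => h.p2 H he0 he hτ hτ2 hx i j)
  have c3 := sum3_abs (H.hb x hx2) (h.st2 H he0 he hτ hτ2 hx).1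
  obtain ⟨P, hP⟩ : ∃ P, P = ε * (ze x ^ τ * ze x ^ 3) := ⟨_, rfl⟩
  have hP0 : 0 < P := by rw [hP]; positivity
  have f1 : ε * ze x ^ τ * (10 ^ 42 * ε * ze x ^ 3) = 10 ^ 42 * (ε * P) := by rw [hP]; ring
  have f2 : ε * ze x ^ τ * ze x * (10 ^ 10 * ε * ze x ^ 2) = 10 ^ 10 * (ε * P) := by rw [hP]; ring
  have f3 : 39 * ε * (ze x ^ τ * ze x ^ 3) = 39 * P := by rw [hP]; ring
  have f4 : 10 ^ 40 * ε * (ze x ^ τ * ze x ^ 3) = 10 ^ 40 * P := by rw [hP]; ring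
  rw [f1] at c2
  rw [f2] at c3
  rw [f3] at c1
  rw [f4]
  have : ε * P ≤ 1 / 2000 * P := by gcongr
  linarith

lemma L0_mul {f g : E3 → ℝ} {x : E3} (hf : Sm f x) (hg : Sm g x) :
    L0 (fun y => f y * g y) x = f x * L0 g x + g x * L0 f x + 2 * ∑ i, pd f i x * pd g i x := by
  unfold L0 Lo
  simp only [Hs_mul hf hg, dl, Fin.sum_univ_three]
  simp
  ring

/-- linear function -/
def ln (n : Fin 3 → ℝ) (x : E3) : ℝ := ∑ i, n i * x i

lemma sm_ln (n : Fin 3 → ℝ) (x : E3) : Sm (ln n) x := by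
  unfold ln
  exact ContDiffAt.sum fun i _ => contDiffAt_const.mul (sm_coord i x)

lemma pd_ln (n : Fin 3 → ℝ) (k : Fin 3) : pd (ln n) k = fun _ => n k := by
  ext x
  unfold ln
  rw [pd_sum (fun i => ((sm_coord i x).da.const_mul _))]
  simp only [pd_cmul _ (sm_coord _ x).da, pd_coord]
  simp

lemma ln_le {n : Fin 3 → ℝ} (hn : ∑ i, n i ^ 2 = 1) (x : E3) : ln n x ≤ ‖x‖ := by
  have h := norm_sq_sum x
  rw [Fin.sum_univ_three] at h hn
  apply le_of_sq_le_sq _ (norm_nonneg _)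
  rw [h, ln, Fin.sum_univ_three]
  have e : (x 0 ^ 2 + x 1 ^ 2 + x 2 ^ 2) = (n 0 ^ 2 + n 1 ^ 2 + n 2 ^ 2) * (x 0 ^ 2 + x 1 ^ 2 + x 2 ^ 2) := by rw [hn, one_mul]
  rw [e]
  nlinarith [sq_nonneg (n 0 * x 1 - n 1 * x 0), sq_nonneg (n 0 * x 2 - n 2 * x 0), sq_nonneg (n 1 * x 2 - n 2 * x 1)]

lemma psi_lap {τ : ℝ} (hτ : 1 / 2 < τ) (hτ2 : τ < 1) {n : Fin 3 → ℝ} (hn : ∑ i, n i ^ 2 = 1) {x : E3} (hx : x ∈ Ex) (hl : 0 < ln n x) :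
    Sm (fun y => ln n y ^ τ * ze y ^ (1 + 2 * τ)) x ∧
    L0 (fun y => ln n y ^ τ * ze y ^ (1 + 2 * τ)) x ≤ - (τ * (1 - τ)) * (ze x ^ τ * ze x ^ 3) := by
  have h0 := ne0 zero_le_one hx
  have hz := ze_pos h0
  have s1 : Sm (fun y => ln n y ^ τ) x := (sm_ln n x).rpow_const_of_ne hl.ne'
  have s2 : Sm (fun y => ze y ^ (1 + 2 * τ)) x := sm_rpow h0 _
  have d : ∀ (p : ℝ) {s : ℝ}, 0 < s → HasDerivAt (fun s : ℝ => s ^ p) (p * s ^ (p - 1)) s := fun p s hs =>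
    Real.hasDerivAt_rpow_const (Or.inl hs.ne')
  have l1 : L0 (fun y => ln n y ^ τ) x = τ * ((τ - 1) * ln n x ^ (τ - 1 - 1)) := by
    have := Lo_comp (a := fun _ => dl) (b := fun _ _ => 0) (sm_ln n x) (h := fun s => s ^ τ) (h' := fun s => τ * s ^ (τ - 1))
      (by filter_upwards [lt_mem_nhds hl] with s hs using d τ hs) ((d (τ - 1) hl).const_mul τ)
    rw [L0, this]
    have e : Lo (fun _ => dl) (fun _ _ => 0) (ln n) x = 0 := by
      unfold Lo Hs; simp [pd_ln, pd_const]
    have e2 : ∑ i, ∑ j, dl i j * (pd (ln n) i x * pd (ln n) j x) = 1 := by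
      rw [← hn]; simp [pd_ln, dl, sq]
    rw [e, e2]; ring
  have l2 : L0 (fun y => ze y ^ (1 + 2 * τ)) x = (1 + 2 * τ) * (2 * τ) * (ze x ^ (1 + 2 * τ) * ze x ^ 2) := by
    have := Lo_comp (a := fun _ => dl) (b := fun _ _ => 0) (sm_ze h0) (h := fun s => s ^ (1 + 2 * τ)) (h' := fun s => (1 + 2 * τ) * s ^ (1 + 2 * τ - 1))
      (by filter_upwards [lt_mem_nhds hz] with s hs using d _ hs) ((d (1 + 2 * τ - 1) hz).const_mul (1 + 2 * τ))
    rw [L0, this]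
    have e : Lo (fun _ => dl) (fun _ _ => 0) ze x = 0 := by
      have := lap_ze h0
      unfold Lo; simp only [this]; simp
    have e2 : ∑ i, ∑ j, dl i j * (pd ze i x * pd ze j x) = ze x ^ 4 := by
      rw [← grad_ze_sq h0]; simp [dl, sq]
    have e3 : ze x ^ (1 + 2 * τ - 1 - 1) * ze x ^ 4 = ze x ^ (1 + 2 * τ) * ze x ^ 2 := by
      rw [Real.rpow_sub_one hz.ne', Real.rpow_sub_one hz.ne']; field_simp
    rw [e, e2, mul_zero, add_zero, mul_assoc, mul_assoc, e3]; ring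
  have l3 : ∑ i, pd (fun y => ln n y ^ τ) i x * pd (fun y => ze y ^ (1 + 2 * τ)) i x = - (τ * (1 + 2 * τ)) * (ln n x ^ τ * (ze x ^ (1 + 2 * τ) * ze x ^ 2)) := by
    have c1 : ∀ i, pd (fun y => ln n y ^ τ) i x = τ * ln n x ^ (τ - 1) * n i := fun i => by
      have := pd_comp (sm_ln n x).da (d τ hl) i
      rw [this, pd_ln]
    have c2 : ∀ i, pd (fun y => ze y ^ (1 + 2 * τ)) i x = (1 + 2 * τ) * ze x ^ (1 + 2 * τ - 1) * pd ze i x := fun i =>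
      pd_comp (sm_ze h0).da (d (1 + 2 * τ) hz) i
    have c3 : ∀ i, τ * ln n x ^ (τ - 1) * n i * ((1 + 2 * τ) * ze x ^ (1 + 2 * τ - 1) * -(x i * ze x ^ 3))
      = - (τ * (1 + 2 * τ)) * (ln n x ^ (τ - 1) * (ze x ^ (1 + 2 * τ - 1) * ze x ^ 3)) * (n i * x i) := fun i => by ring
    simp only [c1, c2, pd_ze h0, c3, ← Finset.mul_sum]
    have c4 : ze x ^ (1 + 2 * τ - 1) * ze x ^ 3 = ze x ^ (1 + 2 * τ) * ze x ^ 2 := by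
      rw [Real.rpow_sub_one hz.ne']; field_simp
    have c5 : ln n x ^ (τ - 1) * ln n x = ln n x ^ τ := by
      rw [Real.rpow_sub_one hl.ne']; field_simp
    have c6 : ∑ i, n i * x i = ln n x := rfl
    rw [c4, c6, ← c5]; ring
  refine ⟨s1.mul s2, ?_⟩
  rw [L0_mul s1 s2, l1, l2, l3]
  have k1 : ze x ^ (2 - τ) ≤ ln n x ^ (τ - 1 - 1) := by
    have := Real.rpow_le_rpow_of_nonpos hl (ln_le hn x) (by linarith : τ - 1 - 1 ≤ 0)
    refine le_trans (le_of_eq ?_) this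
    have e : 2 - τ = - (τ - 1 - 1) := by ring
    rw [ze, e, Real.inv_rpow (norm_nonneg _), Real.rpow_neg (norm_nonneg _), inv_inv]
  have k2 : ze x ^ (1 + 2 * τ) * ze x ^ (2 - τ) = ze x ^ τ * ze x ^ 3 := by
    rw [← Real.rpow_natCast (ze x) 3, ← Real.rpow_add hz, ← Real.rpow_add hz]; congr 1; push_cast; ring
  have k3 := mul_le_mul_of_nonneg_left k1 (by positivity : 0 ≤ ze x ^ (1 + 2 * τ))
  rw [k2] at k3
  have k4 := mul_le_mul_of_nonneg_left k3 (mul_nonneg (by linarith) (by linarith) : 0 ≤ τ * (1 - τ))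
  linarith

/-- reflection matrix -/
def rf (n : Fin 3 → ℝ) (k i : Fin 3) : ℝ := dl k i - 2 * (n k * n i)

lemma rf_orth {n : Fin 3 → ℝ} (hn : ∑ i, n i ^ 2 = 1) : Orth (rf n) := by
  have r : ∀ k l, ∑ i, rf n k i * rf n l i = dl k l := by
    intro k l
    have e2 : ∀ k, ∀ f : Fin 3 → ℝ, ∑ i, dl k i * f i = f k := by intro k f; simp [dl]
    have e3 : ∀ i, rf n k i * rf n l i = dl k i * dl l i - 2 * n l * (dl k i * n i) - 2 * n k * (dl l i * n i) + 4 * (n k * n l) * n i ^ 2 := by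
      intro i; unfold rf; ring
    have e1 : ∑ i, dl k i * dl l i = dl k l := by simp [dl]
    simp only [e3, Finset.sum_add_distrib, Finset.sum_sub_distrib, ← Finset.mul_sum, e1, e2, hn]
    ring
  refine ⟨r, fun i j => ?_⟩
  rw [← r i j]
  have h1 : ∀ k i : Fin 3, rf n k i = rf n i k := fun k i => by simp only [rf, dl, eq_comm, mul_comm]
  exact Finset.sum_congr rfl fun k _ => by rw [h1 k i, h1 k j]

lemma rf_apply (n : Fin 3 → ℝ) (x : E3) (k : Fin 3) : rl (rf n) x k = x k - 2 * (ln n x * n k) := by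
  rw [rl_apply, ln, Finset.sum_mul, Finset.mul_sum]
  have : ∀ i, rf n k i * x i = dl k i * x i - 2 * (n i * x i * n k) := by intro i; unfold rf; ring
  simp only [this, Finset.sum_sub_distrib]
  simp [dl]

lemma VS.refl {τ ε : ℝ} {a : E3 → Fin 3 → Fin 3 → ℝ} {b : E3 → Fin 3 → ℝ} {v : E3 → ℝ} (h : VS a b v) (H : Core τ ε a b)
    (he0 : 0 < ε) (he : ε ≤ 1 / 2000) (hτ : 1 / 2 < τ) (hτ2 : τ < 1) {n : Fin 3 → ℝ} (hn : ∑ i, n i ^ 2 = 1)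
    {x : E3} (hx : x ∈ Ex) (hl : 0 < ln n x) :
    |v (rl (rf n) x) - v x| ≤ 10 ^ 41 * (τ * (1 - τ))⁻¹ * ε * (ze x ^ τ * ze x) := by
  have hO := rf_orth hn
  have hc : 0 < τ * (1 - τ) := mul_pos (by linarith) (by linarith)
  have hRE : ∀ y ∈ Ex, rl (rf n) y ∈ Ex := fun y hy => by change 1 < ‖rl (rf n) y‖; rw [hO.norm]; exact hy
  have zR : ∀ y, ze (rl (rf n) y) = ze y := fun y => by rw [ze, ze, hO.norm]
  have lc : Continuous (ln n) := by unfold ln; fun_prop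
  have sw : ∀ y ∈ Ex, Sm (fun y => v (rl (rf n) y) - v y) y := fun y hy => (sm_rl (h.s _ (hRE y hy))).sub (h.s y hy)
  have key := cmp_van (Ω := {y | y ∈ Ex ∧ 0 < ln n y}) (Ex_open.inter (isOpen_lt continuous_const lc)) (a := fun _ => dl) (b := fun _ _ => 0)
    (fun y hy => Pos_near (fun i j => by simp [dl, eq_comm]) (l := 1 / 3) le_rfl (fun i j => by simp))
    (w := fun y => v (rl (rf n) y) - v y)
    (B := fun y => 10 ^ 41 * (τ * (1 - τ))⁻¹ * ε * (ln n y ^ τ * ze y ^ (1 + 2 * τ))) (fun y hy => sw y hy.1)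
    (fun y hy => contDiffAt_const.mul (psi_lap hτ hτ2 hn hy.1 hy.2).1)
    (fun y hy => by
      have := hy.2
      have := ze_pos (ne0 zero_le_one hy.1)
      positivity) ?_ ?_ x ⟨hx, hl⟩
  · refine key.trans ?_
    have hz := ze_pos (ne0 zero_le_one hx)
    have k1 : ln n x ^ τ * ze x ^ (1 + 2 * τ) ≤ ze x ^ τ * ze x := by
      have := Real.rpow_le_rpow hl.le (ln_le hn x) (by linarith : 0 ≤ τ)
      have e : ‖x‖ ^ τ * ze x ^ (1 + 2 * τ) = ze x ^ τ * ze x := by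
        have : ‖x‖ = (ze x)⁻¹ := by rw [ze, inv_inv]
        rw [this, Real.inv_rpow hz.le, ← Real.rpow_neg hz.le, ← Real.rpow_add hz, ← Real.rpow_add_one hz.ne']; congr 1; ring
      rw [← e]
      gcongr
    gcongr
  · refine van_of (C := {y : E3 | 1 ≤ ‖y‖} ∩ {y | 0 ≤ ln n y}) ((isClosed_le continuous_const continuous_norm).inter (isClosed_le continuous_const lc))
      (fun x hx => ⟨(show (1:ℝ) < ‖x‖ from hx.1).le, hx.2.le⟩) ?_ ?_ ?_
    · refine ContinuousOn.sub (h.c.comp (rl (rf n)).continuous.continuousOn fun y hy => ?_) (h.c.mono Set.inter_subset_left)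
      change 1 ≤ ‖rl (rf n) y‖; rw [hO.norm]; exact hy.1
    · rintro y ⟨hy1, hy2⟩ hn'
      by_cases hy : ‖y‖ = 1
      · rw [h.z y hy, h.z (rl (rf n) y) (by rw [hO.norm, hy]), sub_zero]
      · have hl0 : ln n y = 0 := by
          apply le_antisymm _ hy2
          by_contra hcon
          exact hn' ⟨lt_of_le_of_ne hy1 (Ne.symm hy), not_le.1 hcon⟩
        have : rl (rf n) y = y := by ext k; rw [rf_apply, hl0]; ring
        rw [this, sub_self]
    · intro η hη
      obtain ⟨r, hr⟩ := h.l (η / 2) (by linarith)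
      refine ⟨r, fun y _ hy => (abs_sub _ _).trans_lt ?_⟩
      have := hr y hy
      have := hr (rl (rf n) y) (by rw [hO.norm]; exact hy)
      linarith
  · rintro y ⟨hy, hly⟩
    have hz := ze_pos (ne0 zero_le_one hy)
    obtain ⟨p1, p2⟩ := psi_lap hτ hτ2 hn hy hly
    rw [Lo_cmul _ p1]
    have e : Lo (fun _ => dl) (fun _ _ => 0) (fun y => v (rl (rf n) y) - v y) y = L0 v (rl (rf n) y) - L0 v y := by
      rw [Lo_sub (sm_rl (h.s _ (hRE y hy))) (h.s y hy), Lo_rl (h.s _ (hRE y hy))]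
      congr 1
      have e3 : ∀ k l, ∑ i, ∑ j, dl i j * (rf n k i * rf n l j) = dl k l := fun k l => by
        rw [← hO.r k l]; simp [dl]
      simp only [e3, L0, Lo]; simp
    rw [e]
    have a1 := h.lap H he0 he hτ hτ2 hy
    have a2 := h.lap H he0 he hτ hτ2 (hRE y hy)
    rw [zR] at a2
    have a3 := abs_sub (L0 v (rl (rf n) y)) (L0 v y)
    have a4 := mul_le_mul_of_nonneg_left p2 (by positivity : 0 ≤ 10 ^ 41 * (τ * (1 - τ))⁻¹ * ε)
    have a5 : 10 ^ 41 * (τ * (1 - τ))⁻¹ * ε * (-(τ * (1 - τ)) * (ze y ^ τ * ze y ^ 3)) = - 10 ^ 41 * (ε * (ze y ^ τ * ze y ^ 3)) := by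
      have : (τ * (1 - τ))⁻¹ * (τ * (1 - τ)) = 1 := inv_mul_cancel₀ hc.ne'
      linear_combination (-10 ^ 41 * ε * (ze y ^ τ * ze y ^ 3)) * this
    rw [a5] at a4
    have : 0 < ε * (ze y ^ τ * ze y ^ 3) := by positivity
    linarith


lemma kt_ge {τ : ℝ} (hτ : 1 / 2 < τ) (hτ2 : τ < 1) : 1 ≤ (τ * (1 - τ))⁻¹ := by
  have hc : 0 < τ * (1 - τ) := mul_pos (by linarith) (by linarith)
  apply (one_le_inv₀ hc).2
  nlinarith

lemma VS.osc {τ ε : ℝ} {a : E3 → Fin 3 → Fin 3 → ℝ} {b : E3 → Fin 3 → ℝ} {v : E3 → ℝ} (h : VS a b v) (H : Core τ ε a b)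
    (he0 : 0 < ε) (he : ε ≤ 1 / 2000) (hτ : 1 / 2 < τ) (hτ2 : τ < 1) {x x' : E3} (hx : x ∈ Ex) (hn : ‖x'‖ = ‖x‖) :
    |v x' - v x| ≤ 10 ^ 41 * (τ * (1 - τ))⁻¹ * ε * (ze x ^ τ * ze x) := by
  have hz := ze_pos (ne0 zero_le_one hx)
  have hk := kt_ge hτ hτ2
  by_cases hxx : x' = x
  · rw [hxx, sub_self, abs_zero]; positivity
  have hs : 0 < ‖x - x'‖ := norm_pos_iff.2 (sub_ne_zero.2 (Ne.symm hxx))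
  have q1 := norm_sq_sum (x - x')
  have q2 := norm_sq_sum x
  have q3 := norm_sq_sum x'
  rw [hn] at q3
  obtain ⟨s, hse⟩ : ∃ s, s = ‖x - x'‖ := ⟨_, rfl⟩
  rw [← hse] at hs q1
  simp only [PiLp.sub_apply, Fin.sum_univ_three] at q1 q2 q3
  have hl : ln (fun i => (x i - x' i) / s) x = s / 2 := by
    simp only [ln, Fin.sum_univ_three]
    field_simp
    linear_combination - q1 - q2 + q3
  have key := h.refl H he0 he hτ hτ2 (n := fun i => (x i - x' i) / s) (by
    simp only [Fin.sum_univ_three]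
    field_simp
    linear_combination - q1) hx (by rw [hl]; positivity)
  have e : rl (rf (fun i => (x i - x' i) / s)) x = x' := by
    ext k
    rw [rf_apply, hl]; field_simp; ring
  rwa [e] at key

lemma cmp2 {r : ℝ} {q : E3 → ℝ} (hc : ContinuousOn q {x | r ≤ ‖x‖}) (hs : ∀ x : E3, r < ‖x‖ → Sm q x)
    (hb : ∀ x : E3, ‖x‖ = r → 0 ≤ q x) (hi : ∀ η > 0, ∃ R, ∀ x : E3, R < ‖x‖ → |q x| < η)
    (hL : ∀ x : E3, r < ‖x‖ → L0 q x < 0) : ∀ x : E3, r < ‖x‖ → 0 ≤ q x := by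
  have hvan : Van {x : E3 | r < ‖x‖} (fun x => min (q x) 0) :=
    van_of (C := {x | r ≤ ‖x‖}) (isClosed_le continuous_const continuous_norm) (fun x (hx : r < ‖x‖) => hx.le)
      (hc.inf continuousOn_const)
      (fun x hx hn => min_eq_right (hb x (le_antisymm (not_lt.1 hn) hx))) (fun η hη => by
        obtain ⟨R, hR⟩ := hi η hη
        refine ⟨R, fun x _ hx => ?_⟩
        have := abs_lt.1 (hR x hx)
        rw [abs_lt]
        exact ⟨lt_min this.1 (by linarith), (min_le_right _ _).trans_lt hη⟩)
  refine mp (Ω := {x : E3 | r < ‖x‖}) (isOpen_lt continuous_const continuous_norm) (q := q) (fun x hx => hs x hx) ?_ ?_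
  · intro η hη
    obtain ⟨K, hK, hKc, h⟩ := hvan η hη
    exact ⟨K, hK, hKc, fun y hy hn => by
      have := (abs_lt.1 (h y hy hn)).1
      exact this.trans_le (min_le_left _ _)⟩
  · intro x hx
    exact ⟨dl, Pos_near (fun i j => by simp [dl, eq_comm]) (l := 1 / 3) le_rfl (fun i j => by simp), fun _ => 0, hL x hx⟩

lemma ze_small {η : ℝ} (hη : 0 < η) {x : E3} (hx : η⁻¹ < ‖x‖) : ze x < η := by
  rw [ze]; exact inv_lt_of_inv_lt₀ hη hx

lemma rpow1_le {τ s : ℝ} (hτ : 0 < τ) (hs : 0 < s) (h1 : s < 1) : s ^ (1 + τ) ≤ s := by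
  rw [Real.rpow_add hs, Real.rpow_one]
  exact mul_le_of_le_one_right hs.le (rpow_le1 hτ hs h1)

lemma VS.rat {τ ε : ℝ} {a : E3 → Fin 3 → Fin 3 → ℝ} {b : E3 → Fin 3 → ℝ} {v : E3 → ℝ} (h : VS a b v) (H : Core τ ε a b)
    (he0 : 0 < ε) (he : ε ≤ 1 / 2000) (hτ : 1 / 2 < τ) (hτ2 : τ < 1) {x1 : E3} (hx1 : x1 ∈ Ex) {x : E3} (hx : ‖x1‖ < ‖x‖)
    {σ : ℝ} (hσ : |σ| = 1) :
    0 ≤ (10 ^ 41 * (τ * (1 - τ))⁻¹ * ε) * ((2 * ze x1 ^ τ - 1) * ze x + (ze x - ze x ^ (1 + τ))) + σ * (v x - v x1 * ‖x1‖ * ze x) := by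
  have hx1' : 1 < ‖x1‖ := hx1
  have hz1 := ze_pos (ne0 zero_le_one hx1)
  have hk := kt_ge hτ hτ2
  have hτ0 : 0 < τ := by linarith
  obtain ⟨D, hD⟩ : ∃ D, D = 10 ^ 41 * (τ * (1 - τ))⁻¹ * ε := ⟨_, rfl⟩
  have hD1 : 10 ^ 41 * ε ≤ D := by
    rw [hD]; apply mul_le_mul_of_nonneg_right _ he0.le; linarith
  have hD0 : 0 < D := by linarith
  rw [← hD]
  have nz : ∀ y : E3, ‖x1‖ ≤ ‖y‖ → y ≠ 0 := fun y hy => ne0 (c := 1) zero_le_one (by linarith)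
  have s1 : ∀ y : E3, ‖x1‖ ≤ ‖y‖ → Sm (fun x => ze x - ze x ^ (1 + τ)) y := fun y hy =>
    (sm_ze (nz y hy)).sub (sm_rpow (nz y hy) _)
  have s2 : ∀ y : E3, ‖x1‖ ≤ ‖y‖ → Sm (fun x => D * ((2 * ze x1 ^ τ - 1) * ze x + (ze x - ze x ^ (1 + τ)))) y := fun y hy =>
    contDiffAt_const.mul ((contDiffAt_const.mul (sm_ze (nz y hy))).add (s1 y hy))
  have mE : ∀ y : E3, ‖x1‖ < ‖y‖ → y ∈ Ex := fun y hy => hx1'.trans hy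
  have s3 : ∀ y : E3, ‖x1‖ < ‖y‖ → Sm (fun x => (v x - v x1 * ‖x1‖ * ze x)) y := fun y hy =>
    (h.s y (mE y hy)).sub (contDiffAt_const.mul (sm_ze (nz y hy.le)))
  refine cmp2 (r := ‖x1‖) (q := fun x => D * ((2 * ze x1 ^ τ - 1) * ze x + (ze x - ze x ^ (1 + τ))) + σ * (v x - v x1 * ‖x1‖ * ze x))
    ?_ (fun y hy => (s2 y hy.le).add (contDiffAt_const.mul (s3 y hy))) ?_ ?_ ?_ x hx
  · have zc : ContinuousOn ze {x | ‖x1‖ ≤ ‖x‖} := fun y hy => (sm_ze (nz y hy)).continuousAt.continuousWithinAt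
    refine ContinuousOn.add (fun y hy => (s2 y hy).continuousAt.continuousWithinAt) (continuousOn_const.mul (ContinuousOn.sub (h.c.mono ?_) (continuousOn_const.mul zc)))
    intro y (hy : ‖x1‖ ≤ ‖y‖)
    exact hx1'.le.trans hy
  · intro y hy
    have hzy : ze y = ze x1 := by rw [ze, ze, hy]
    have := h.osc H he0 he hτ hτ2 hx1 hy
    rw [← hD] at this
    have e1 : ‖x1‖ * ze x1 = 1 := by rw [ze]; exact mul_inv_cancel₀ (by linarith)
    have e2 : |σ * (v y - v x1 * ‖x1‖ * ze x1)| = |v y - v x1| := by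
      rw [abs_mul, hσ, one_mul, mul_assoc, e1, mul_one]
    rw [hzy, Real.rpow_add hz1, Real.rpow_one]
    have e3 := neg_abs_le (σ * (v y - v x1 * ‖x1‖ * ze x1))
    rw [e2] at e3
    linarith
  · intro η hη
    obtain ⟨P, hP⟩ : ∃ P, P = D * (|2 * ze x1 ^ τ - 1| + 1) + |v x1 * ‖x1‖| := ⟨_, rfl⟩
    have hP0 : 0 < P := by rw [hP]; positivity
    obtain ⟨R, hR⟩ := h.l (η / 2) (by linarith)
    refine ⟨max (max R 1) (η / 2 / P)⁻¹, fun y hy => ?_⟩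
    have y1 : R < ‖y‖ := ((le_max_left _ _).trans (le_max_left _ _)).trans_lt hy
    have y2 : 1 < ‖y‖ := ((le_max_right _ _).trans (le_max_left _ _)).trans_lt hy
    have y3 := ze_small (by positivity) ((le_max_right _ _).trans_lt hy)
    have hz := ze_pos (ne0 zero_le_one y2)
    have y4 := b0_le hτ0 hτ2 hz (ze_lt_one y2)
    have y5 := rpow1_le hτ0 hz (ze_lt_one y2)
    have hr := Real.rpow_nonneg hz.le (1 + τ)
    have t1 : |D * ((2 * ze x1 ^ τ - 1) * ze y + (ze y - ze y ^ (1 + τ)))| ≤ D * (|2 * ze x1 ^ τ - 1| * ze y + ze y) := by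
      rw [abs_mul, abs_of_pos hD0]
      refine mul_le_mul_of_nonneg_left ((abs_add_le _ _).trans ?_) hD0.le
      rw [abs_mul, abs_of_pos hz, abs_of_nonneg y4.1]; linarith
    have t2 : |σ * (v y - v x1 * ‖x1‖ * ze y)| ≤ |v y| + |v x1 * ‖x1‖| * ze y := by
      rw [abs_mul, hσ, one_mul]
      refine (abs_sub _ _).trans ?_
      rw [abs_mul _ (ze y), abs_of_pos hz]
    refine (abs_add_le _ _).trans_lt ?_
    have t3 : P * ze y < η / 2 := by
      rw [lt_div_iff₀ hP0] at y3; linarith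
    have t4 := hR y y1
    have t5 : P * ze y = D * (|2 * ze x1 ^ τ - 1| * ze y + ze y) + |v x1 * ‖x1‖| * ze y := by rw [hP]; ring
    linarith
  · intro y hy
    have hz := ze_pos (nz y hy.le)
    have l0 : L0 ze y = 0 := by
      unfold L0 Lo; rw [lap_ze (nz y hy.le)]; simp
    unfold L0 at l0 ⊢
    have sz := sm_ze (nz y hy.le)
    rw [Lo_add (s2 y hy.le) (contDiffAt_const.mul (s3 y hy)), Lo_cmul _ ((contDiffAt_const.mul sz).add (s1 y hy.le)),
      Lo_add (contDiffAt_const.mul sz) (s1 y hy.le), Lo_cmul _ sz, Lo_cmul _ (s3 y hy), Lo_sub (h.s y (mE y hy)) (contDiffAt_const.mul sz),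
      Lo_cmul _ sz, l0]
    have b1 := (Core_flat (τ := τ) he0).b0 he0 (by linarith) hτ hτ2 (mE y hy)
    have b2 := h.lap H he0 he hτ hτ2 (mE y hy)
    unfold L0 at b2
    obtain ⟨P, hP⟩ : ∃ P, P = ze y ^ τ * ze y ^ 3 := ⟨_, rfl⟩
    have hP0 : 0 < P := by rw [hP]; positivity
    rw [← hP] at b1 b2
    have b3 := le_abs_self (σ * Lo (fun _ => dl) (fun _ _ => 0) v y)
    rw [abs_mul, hσ, one_mul] at b3
    have b4 := mul_le_mul_of_nonneg_left b1 hD0.le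
    have b5 := mul_le_mul_of_nonneg_right hD1 hP0.le
    have b6 : 0 < ε * P := by positivity
    simp only [mul_zero, sub_zero, zero_add]
    linarith

lemma VS.rat2 {τ ε : ℝ} {a : E3 → Fin 3 → Fin 3 → ℝ} {b : E3 → Fin 3 → ℝ} {v : E3 → ℝ} (h : VS a b v) (H : Core τ ε a b)
    (he0 : 0 < ε) (he : ε ≤ 1 / 2000) (hτ : 1 / 2 < τ) (hτ2 : τ < 1) {x1 : E3} (hx1 : x1 ∈ Ex) {x : E3} (hx : ‖x1‖ < ‖x‖) :
    |v x * ‖x‖ - v x1 * ‖x1‖| ≤ (2 * 10 ^ 41 * (τ * (1 - τ))⁻¹) * ε * ze x1 ^ τ := by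
  have hxE : x ∈ Ex := (show 1 < ‖x1‖ from hx1).trans hx
  have hx0 : 0 < ‖x‖ := (norm_nonneg _).trans_lt hx
  have hz := ze_pos (ne0 zero_le_one hxE)
  have hk := kt_ge hτ hτ2
  have r1 := h.rat H he0 he hτ hτ2 hx1 hx (σ := 1) (by simp)
  have r2 := h.rat H he0 he hτ hτ2 hx1 hx (σ := -1) (by simp)
  have hD0 : 0 ≤ (10 ^ 41 * (τ * (1 - τ))⁻¹ * ε) := by positivity
  have r3 : (10 ^ 41 * (τ * (1 - τ))⁻¹ * ε) * ((2 * ze x1 ^ τ - 1) * ze x + (ze x - ze x ^ (1 + τ))) ≤ (10 ^ 41 * (τ * (1 - τ))⁻¹ * ε) * (2 * ze x1 ^ τ * ze x) := by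
    apply mul_le_mul_of_nonneg_left _ hD0
    linarith [Real.rpow_nonneg hz.le (1 + τ)]
  have e1 : ze x * ‖x‖ = 1 := by rw [ze]; exact inv_mul_cancel₀ hx0.ne'
  have e : |v x * ‖x‖ - v x1 * ‖x1‖| = |v x - v x1 * ‖x1‖ * ze x| * ‖x‖ := by
    rw [← abs_of_pos hx0, ← abs_mul, abs_of_pos hx0]; congr 1
    linear_combination (v x1 * ‖x1‖) * e1
  rw [e]
  have r4 : |v x - v x1 * ‖x1‖ * ze x| ≤ (10 ^ 41 * (τ * (1 - τ))⁻¹ * ε) * (2 * ze x1 ^ τ * ze x) := by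
    rw [abs_le]; constructor <;> linarith
  calc _ ≤ (10 ^ 41 * (τ * (1 - τ))⁻¹ * ε) * (2 * ze x1 ^ τ * ze x) * ‖x‖ := by gcongr
    _ = (10 ^ 41 * (τ * (1 - τ))⁻¹ * ε) * (2 * ze x1 ^ τ) * (ze x * ‖x‖) := by ring
    _ = _ := by rw [e1]; ring

lemma VS.lim {τ ε : ℝ} {a : E3 → Fin 3 → Fin 3 → ℝ} {b : E3 → Fin 3 → ℝ} {v : E3 → ℝ} (h : VS a b v) (H : Core τ ε a b)
    (he0 : 0 < ε) (he : ε ≤ 1 / 2000) (hτ : 1 / 2 < τ) (hτ2 : τ < 1) :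
    ∃ A, |A| ≤ 100 * ε ∧ ∀ x ∈ Ex, |v x - A * ze x| ≤ (2 * 10 ^ 41 * (τ * (1 - τ))⁻¹) * ε * (ze x ^ τ * ze x) := by
  obtain ⟨X, hX⟩ : ∃ X : ℕ → E3, ∀ n, ‖X n‖ = n + 2 :=
    ⟨fun n => EuclideanSpace.single 0 ((n:ℝ) + 2), fun n => by
      rw [EuclideanSpace.norm_single, Real.norm_of_nonneg]; positivity⟩
  have hXE : ∀ n, X n ∈ Ex := fun n => by
    change 1 < ‖X n‖; rw [hX]; have : (0:ℝ) ≤ n := n.cast_nonneg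
    linarith
  have hb : ∀ n, v (X n) * ‖X n‖ ∈ Set.Icc (-(100 * ε)) (100 * ε) := fun n => by
    have hp : 0 < ‖X n‖ := by have : 1 < ‖X n‖ := hXE n
                              linarith
    have hz := ze_pos (ne0 zero_le_one (hXE n))
    have e1 : ze (X n) * ‖X n‖ = 1 := by rw [ze]; exact inv_mul_cancel₀ hp.ne'
    rw [Set.mem_Icc, ← abs_le, abs_mul, abs_of_pos hp]
    calc |v (X n)| * ‖X n‖ ≤ 100 * ε * (ze (X n) * (1 - ze (X n))) * ‖X n‖ := by
          gcongr; exact h.st1 H he0 (by linarith) hτ hτ2 (hXE n)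
      _ = 100 * ε * (1 - ze (X n)) * (ze (X n) * ‖X n‖) := by ring
      _ ≤ 100 * ε := by rw [e1, mul_one]; exact mul_le_of_le_one_right (by positivity) (by linarith)
  obtain ⟨A, hA, ψ, hψ, hlim⟩ := isCompact_Icc.tendsto_subseq hb
  refine ⟨A, abs_le.2 hA, fun x hx => ?_⟩
  have hp : 0 < ‖x‖ := by have : 1 < ‖x‖ := hx
                          linarith
  have hz := ze_pos (ne0 zero_le_one hx)
  have e1 : ‖x‖ * ze x = 1 := by rw [ze]; exact mul_inv_cancel₀ hp.ne'
  have k : |A - v x * ‖x‖| ≤ (2 * 10 ^ 41 * (τ * (1 - τ))⁻¹) * ε * ze x ^ τ := by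
    refine le_of_tendsto (hlim.sub_const _).abs ?_
    obtain ⟨N, hN⟩ := exists_nat_gt ‖x‖
    filter_upwards [eventually_ge_atTop N] with n hn
    refine h.rat2 H he0 he hτ hτ2 hx ?_
    rw [hX]
    have : (N:ℝ) ≤ ψ n := by exact_mod_cast hn.trans (hψ.id_le n)
    linarith
  have e : |v x - A * ze x| = |A - v x * ‖x‖| * ze x := by
    rw [abs_sub_comm, ← abs_of_pos hz, ← abs_mul, abs_of_pos hz]; congr 1
    linear_combination (v x) * e1
  rw [e]
  calc _ ≤ (2 * 10 ^ 41 * (τ * (1 - τ))⁻¹) * ε * ze x ^ τ * ze x := by gcongr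
    _ = _ := by ring


lemma zt_le {τ s t : ℝ} (hτ : 1 / 2 < τ) (hτ2 : τ < 1) (hs : 0 < s) (ht : 0 < t) (h : s ≤ 2 * t) : s ^ τ ≤ 2 * t ^ τ := by
  calc s ^ τ ≤ (2 * t) ^ τ := Real.rpow_le_rpow hs.le h (by linarith)
    _ = 2 ^ τ * t ^ τ := Real.mul_rpow (by norm_num) ht.le
    _ ≤ 2 ^ (1:ℝ) * t ^ τ := by
      gcongr
      · norm_num
    _ = _ := by rw [Real.rpow_one]

lemma VS.fin {τ ε : ℝ} {a : E3 → Fin 3 → Fin 3 → ℝ} {b : E3 → Fin 3 → ℝ} {v : E3 → ℝ} (h : VS a b v) (H : Core τ ε a b)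
    (he0 : 0 < ε) (he : ε ≤ 1 / 2000) (hτ : 1 / 2 < τ) (hτ2 : τ < 1) {C : ℝ} (hC : C = 2 * 10 ^ 41 * (τ * (1 - τ))⁻¹) :
    ∃ A, |A| ≤ 100 * ε ∧ ∀ x ∈ Ex, |v x - A * ze x| ≤ 10 ^ 9 * C * ε * (ze x ^ τ * ze x) ∧
      (∀ i, |pd (fun y => v y - A * ze y) i x| ≤ 10 ^ 9 * C * ε * (ze x ^ τ * ze x ^ 2)) ∧
      ∀ i j, |Hs (fun y => v y - A * ze y) i j x| ≤ 10 ^ 9 * C * ε * (ze x ^ τ * ze x ^ 3) := by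
  obtain ⟨A, hA, hV⟩ := h.lim H he0 he hτ hτ2
  rw [← hC] at hV
  have hC1 : 10 ^ 41 ≤ C := by
    have := kt_ge hτ hτ2
    rw [hC]; linarith
  clear hC
  have hC0 : 0 < C := by linarith
  have hA1 : |A| ≤ 1 := by linarith
  have hτ0 : 0 < τ := by linarith
  refine ⟨A, hA, fun x hx => ?_⟩
  have hx' : 1 < ‖x‖ := hx
  have hz := ze_pos (ne0 zero_le_one hx)
  have hz1 := ze_lt_one hx
  have e0 : ze x * ‖x‖ = 1 := by rw [ze]; exact inv_mul_cancel₀ (by linarith)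
  refine ⟨(hV x hx).trans ?_, ?_⟩
  · gcongr
    linarith
  have sz : ∀ y ∈ Ex, Sm (fun y => A * ze y) y := fun y hy => contDiffAt_const.mul (sm_ze (ne0 zero_le_one hy))
  have sV : ∀ y ∈ Ex, Sm (fun y => v y - A * ze y) y := fun y hy => (h.s y hy).sub (sz y hy)
  rcases lt_or_ge ‖x‖ 2 with h2 | h2
  · have hzh : 1 / 2 ≤ ze x := by
      rw [ze, one_div]; exact inv_anti₀ (by linarith) h2.le
    have hzt : 1 / 2 ≤ ze x ^ τ := by
      have := Real.rpow_le_rpow_of_exponent_ge hz hz1.le hτ2.le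
      rw [Real.rpow_one] at this
      linarith
    constructor
    · intro i
      rw [pd_sub (h.s x hx).da (sz x hx).da, pd_cmul _ (sm_ze (ne0 zero_le_one hx)).da]
      refine (abs_sub _ _).trans ?_
      rw [abs_mul]
      have t1 := (h.st2 H he0 he hτ hτ2 hx).1 i
      have t2 := mul_le_mul hA (pd_ze_le (ne0 zero_le_one hx) i) (abs_nonneg _) (by positivity)
      have t3 : 10 ^ 9 * C * ε * (1 / 2 * ze x ^ 2) ≤ 10 ^ 9 * C * ε * (ze x ^ τ * ze x ^ 2) := by gcongr
      have t4 : 10 ^ 41 * (ε * ze x ^ 2) ≤ C * (ε * ze x ^ 2) := by gcongr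
      have t5 : 0 < ε * ze x ^ 2 := by positivity
      linarith
    · intro i j
      rw [Hs_sub (h.s x hx) (sz x hx), Hs_cmul _ (sm_ze (ne0 zero_le_one hx))]
      refine (abs_sub _ _).trans ?_
      rw [abs_mul]
      have t1 := h.p2 H he0 he hτ hτ2 hx i j
      have t2 := mul_le_mul hA (hs_ze_le (ne0 zero_le_one hx) i j) (abs_nonneg _) (by positivity)
      have t3 : 10 ^ 9 * C * ε * (1 / 2 * ze x ^ 3) ≤ 10 ^ 9 * C * ε * (ze x ^ τ * ze x ^ 3) := by gcongr
      have t4 : 10 ^ 41 * (ε * ze x ^ 3) ≤ C * (ε * ze x ^ 3) := by gcongr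
      have t5 : 0 < ε * ze x ^ 3 := by positivity
      linarith
  · obtain ⟨d, hde⟩ : ∃ d, d = ‖x‖ / 4 := ⟨_, rfl⟩
    have hd : 0 < d := by rw [hde]; linarith
    have hdr : d ≤ (‖x‖ - 1) / 2 := by rw [hde]; linarith
    have e1 : d * ze x = 1 / 4 := by rw [hde]; linarith
    have F := fun (y : E3) (hy : y ∈ Metric.closedBall x d) => ball_facts hx hd hdr hy
    have E2 : ∀ y ∈ Ex, 1 / 2 < ‖y‖ := fun y hy => by have : 1 < ‖y‖ := hy; linarith
    have h1A : |1 - A| ≤ 2 := by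
      have := abs_sub 1 A
      rw [abs_one] at this
      linarith
    have LV : ∀ y ∈ Ex, Lo a b (fun y => v y - A * ze y) y = (1 - A) * Lo a b ze y := fun y hy => by
      rw [Lo_sub (h.s y hy) (sz y hy), Lo_cmul _ (sm_ze (ne0 zero_le_one hy)), h.e y hy]; ring
    have sL : ∀ y ∈ Ex, DifferentiableAt ℝ (Lo a b ze) y := fun y hy => by
      have s := sm_ze (ne0 zero_le_one hy)
      have a1 := H.sa y (E2 y hy)
      have a2 := H.sb y (E2 y hy)
      exact (DifferentiableAt.fun_sum fun i _ => DifferentiableAt.fun_sum fun j _ => (a1 i j).da.fun_mul (s.hs i j).da).add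
        (DifferentiableAt.fun_sum fun i _ => (a2 i).da.fun_mul (s.pd i).da)
    have key := int_est (H.cb he0 hτ0 hx hd hdr) hd (by linarith) (M := 4 * C * ε * (ze x ^ τ * ze x)) (N := 5000 * ε * (ze x ^ τ * ze x ^ 3))
      (by positivity) (by positivity) (V := fun y => v y - A * ze y) (fun y hy => sV y (F y hy).1)
      (fun y hy => by
        obtain ⟨h1, h2, h3, h4, h5, h6, h7⟩ := F y hy
        refine (hV y h1).trans ?_
        calc C * ε * (ze y ^ τ * ze y) ≤ C * ε * ((2 * ze x ^ τ) * (2 * ze x)) := by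
              gcongr
              exact zt_le hτ hτ2 h4 hz h6
          _ = _ := by ring)
      (fun y hy => by
        obtain ⟨h1, h2, h3, h4, h5, h6, h7⟩ := F y hy
        rw [LV y h1, abs_mul]
        calc |1 - A| * |Lo a b ze y| ≤ 2 * (39 * ε * ((2 * ze x ^ τ) * (2 * ze x) ^ 3)) := by
              refine mul_le_mul h1A ((H.Lze (E2 y h1)).trans ?_) (abs_nonneg _) (by norm_num)
              gcongr
              exact zt_le hτ hτ2 h4 hz h6
          _ = 1248 * (ε * (ze x ^ τ * ze x ^ 3)) := by ring
          _ ≤ 5000 * (ε * (ze x ^ τ * ze x ^ 3)) := by gcongr; norm_num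
          _ = _ := by ring)
      (fun y hy k => by
        obtain ⟨h1, h2, h3, h4, h5, h6, h7⟩ := F y hy
        rw [pd_congr (g := fun y => (1 - A) * Lo a b ze y) (by filter_upwards [Ex_open.mem_nhds h1] with y hy using LV y hy), pd_cmul _ (sL y h1), abs_mul, le_div_iff₀ hd]
        calc |1 - A| * |pd (Lo a b ze) k y| * d ≤ 2 * (267 * ε * ((2 * ze x ^ τ) * (2 * ze x) ^ 4)) * d := by
              refine mul_le_mul_of_nonneg_right (mul_le_mul h1A ((H.dLze (E2 y h1) k).trans ?_) (abs_nonneg _) (by norm_num)) hd.le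
              gcongr
              exact zt_le hτ hτ2 h4 hz h6
          _ = 17088 * (d * ze x) * (ε * (ze x ^ τ * ze x ^ 3)) := by ring
          _ ≤ 5000 * (ε * (ze x ^ τ * ze x ^ 3)) := by rw [e1]; gcongr; norm_num
          _ = _ := by ring)
    have e2 : d⁻¹ = 4 * ze x := inv_eq_of_mul_eq_one_right (by linarith)
    have hdi : ∀ M, M / d = M * (4 * ze x) := fun M => by rw [div_eq_mul_inv, e2]
    constructor
    · intro i
      refine (key.1 i).trans ?_
      rw [hdi]
      obtain ⟨P, hP⟩ : ∃ P, P = ε * (ze x ^ τ * ze x ^ 2) := ⟨_, rfl⟩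
      have hP0 : 0 < P := by rw [hP]; positivity
      have f1 : 4 * (5000 * ε * (ze x ^ τ * ze x ^ 3)) * d + 80 * (4 * C * ε * (ze x ^ τ * ze x)) * (4 * ze x)
          = 20000 * P * (d * ze x) + 1280 * (C * P) := by rw [hP]; ring
      have f2 : 10 ^ 9 * C * ε * (ze x ^ τ * ze x ^ 2) = 10 ^ 9 * (C * P) := by rw [hP]; ring
      have f3 : 10 ^ 41 * P ≤ C * P := by gcongr
      rw [f1, f2, e1]
      linarith
    · intro i j
      refine (key.2 i j).trans ?_
      obtain ⟨P, hP⟩ : ∃ P, P = ε * (ze x ^ τ * ze x ^ 3) := ⟨_, rfl⟩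
      have hP0 : 0 < P := by rw [hP]; positivity
      have f1 : 4 * C * ε * (ze x ^ τ * ze x) / d ^ 2 = 64 * (C * P) := by
        rw [pow_two, ← div_div, hdi, hdi, hP]; ring
      have f2 : 10 ^ 9 * C * ε * (ze x ^ τ * ze x ^ 3) = 10 ^ 9 * (C * P) := by rw [hP]; ring
      have f3 : 10 ^ 41 * P ≤ C * P := by gcongr
      rw [f1, f2, mul_assoc 5000, ← hP]
      linarith


structure SA (τ c K : ℝ) (f : E3 → ℝ) (x : E3) : Prop where
  s : Sm f x
  v : |f x - c| ≤ K * ze x ^ τ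
  d : ∀ i, |pd f i x| ≤ K * ze x ^ τ * ze x
  h : ∀ i j, |Hs f i j x| ≤ K * ze x ^ τ * ze x ^ 2

def Sy (τ c : ℝ) (f : E3 → ℝ) : Prop := ∃ K ≥ 0, ∃ R ≥ 1, ∀ x : E3, R < ‖x‖ → SA τ c K f x

lemma SA.congr {τ c K : ℝ} {f g : E3 → ℝ} {x : E3} (h : SA τ c K f x) (e : f =ᶠ[𝓝 x] g) : SA τ c K g x :=
  ⟨ContDiffAt.congr_of_eventuallyEq h.s e.symm, by rw [← e.self_of_nhds]; exact h.v, fun i => by rw [← pd_congr e]; exact h.d i,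
    fun i j => by rw [← Hs_congr e]; exact h.h i j⟩

lemma mul_bd {a b A B : ℝ} (h1 : |a| ≤ A) (h2 : |b| ≤ B) : |a * b| ≤ A * B := by
  rw [abs_mul]; exact mul_le_mul h1 h2 (abs_nonneg _) ((abs_nonneg _).trans h1)

lemma Sy.const (τ c : ℝ) : Sy τ c (fun _ => c) := by
  refine ⟨0, le_rfl, 1, le_rfl, fun x _ => ⟨contDiffAt_const, by simp, fun i => ?_, fun i j => ?_⟩⟩
  · rw [pd_const]; simp
  · rw [Hs_const]; simp

lemma Sy.add {τ c d : ℝ} {f g : E3 → ℝ} (hf : Sy τ c f) (hg : Sy τ d g) : Sy τ (c + d) (fun x => f x + g x) := by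
  obtain ⟨K, hK, R, hR, hf⟩ := hf
  obtain ⟨L, hL, S, hS, hg⟩ := hg
  refine ⟨K + L, by positivity, max R S, hR.trans (le_max_left _ _), fun x hx => ?_⟩
  have a := hf x ((le_max_left _ _).trans_lt hx)
  have b := hg x ((le_max_right _ _).trans_lt hx)
  refine ⟨a.s.add b.s, ?_, fun i => ?_, fun i j => ?_⟩
  · have e : f x + g x - (c + d) = (f x - c) + (g x - d) := by ring
    rw [e]; exact (abs_add_le _ _).trans (by linarith [a.v, b.v])
  · rw [pd_add a.s.da b.s.da]; exact (abs_add_le _ _).trans (by linarith [a.d i, b.d i])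
  · rw [Hs_add a.s b.s]; exact (abs_add_le _ _).trans (by linarith [a.h i j, b.h i j])

lemma Sy.mul {τ c d : ℝ} (hτ : 0 < τ) {f g : E3 → ℝ} (hf : Sy τ c f) (hg : Sy τ d g) : Sy τ (c * d) (fun x => f x * g x) := by
  obtain ⟨K, hK, R, hR, hf⟩ := hf
  obtain ⟨L, hL, S, hS, hg⟩ := hg
  refine ⟨K * (|d| + L) + (|c| + K) * L + 2 * (K * L), by positivity, max R S, hR.trans (le_max_left _ _), fun x hx => ?_⟩
  have a := hf x ((le_max_left _ _).trans_lt hx)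
  have b := hg x ((le_max_right _ _).trans_lt hx)
  have hxE : x ∈ Ex := (hR.trans (le_max_left _ _)).trans_lt hx
  have hz := ze_pos (ne0 zero_le_one hxE)
  have ht := rpow_le1 hτ hz (ze_lt_one hxE)
  obtain ⟨t, hte⟩ : ∃ t, t = ze x ^ τ := ⟨_, rfl⟩
  obtain ⟨z, hze⟩ : ∃ z, z = ze x := ⟨_, rfl⟩
  have ht0 : 0 < t := by rw [hte]; positivity
  obtain ⟨as, av, ad, ah⟩ := a
  obtain ⟨bs, bv, bd, bh⟩ := b
  have hz0 : 0 < z := by rw [hze]; exact hz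
  rw [← hte] at ht av bv
  simp only [← hte] at ad ah bd bh
  simp only [← hze] at ad ah bd bh
  have ff : |f x| ≤ |c| + K := by
    have := abs_add_le (f x - c) c
    rw [sub_add_cancel] at this
    have : K * t ≤ K := mul_le_of_le_one_right hK ht
    linarith
  have gg : |g x| ≤ |d| + L := by
    have := abs_add_le (g x - d) d
    rw [sub_add_cancel] at this
    have : L * t ≤ L := mul_le_of_le_one_right hL ht
    linarith
  refine ⟨as.mul bs, ?_, fun i => ?_, fun i j => ?_⟩
  · have e : f x * g x - c * d = (f x - c) * g x + c * (g x - d) := by ring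
    rw [e]; refine (abs_add_le _ _).trans ?_
    have p := mul_bd av gg
    have q := mul_bd (le_refl |c|) bv
    rw [← hte]
    have : 0 ≤ K * L * t := by positivity
    linarith
  · rw [pd_mul as.da bs.da]; refine (abs_add_le _ _).trans ?_
    have p := mul_bd (ad i) gg
    have q := mul_bd ff (bd i)
    rw [← hte, ← hze]
    have : 0 ≤ K * L * t * z := by positivity
    linarith
  · rw [Hs_mul as bs]
    refine (abs_add_le _ _).trans ((add_le_add ((abs_add_le _ _).trans (add_le_add (abs_add_le _ _) le_rfl)) le_rfl).trans ?_)
    have p := mul_bd (ah i j) gg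
    have q := mul_bd ff (bh i j)
    have r := mul_bd (ad j) (bd i)
    have s := mul_bd (ad i) (bd j)
    rw [← hte, ← hze]
    have : K * t * z * (L * t * z) ≤ K * t * z * (L * 1 * z) := by gcongr
    linarith

lemma Sy.cmul {τ c : ℝ} (hτ : 0 < τ) (k : ℝ) {f : E3 → ℝ} (hf : Sy τ c f) : Sy τ (k * c) (fun x => k * f x) :=
  (Sy.const τ k).mul hτ hf

lemma Sy.sub {τ c d : ℝ} (hτ : 0 < τ) {f g : E3 → ℝ} (hf : Sy τ c f) (hg : Sy τ d g) : Sy τ (c - d) (fun x => f x - g x) := by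
  have := hf.add (hg.cmul hτ (-1))
  have e : (fun x => f x + -1 * g x) = fun x => f x - g x := by funext x; ring
  rw [e] at this
  convert this using 1; ring

lemma Sy.tend {τ c : ℝ} (hτ : 0 < τ) {f : E3 → ℝ} (hf : Sy τ c f) : ∀ P : ℝ → Prop, (∀ᶠ s in 𝓝 c, P s) → ∃ R ≥ 1, ∀ x : E3, R < ‖x‖ → P (f x) := by
  intro P hP
  obtain ⟨K, hK, R, hR, hf⟩ := hf
  obtain ⟨δ, hδ, h⟩ := Metric.eventually_nhds_iff.1 hP
  refine ⟨max R (((δ / (K + 1)) ^ (τ⁻¹))⁻¹), hR.trans (le_max_left _ _), fun x hx => h ?_⟩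
  have hxE : x ∈ Ex := (hR.trans (le_max_left _ _)).trans_lt hx
  have hz := ze_pos (ne0 zero_le_one hxE)
  have hs := ze_small (by positivity) ((le_max_right _ _).trans_lt hx)
  have h2 : ze x ^ τ < δ / (K + 1) := by
    have := Real.rpow_lt_rpow hz.le hs hτ
    rwa [← Real.rpow_mul (by positivity), inv_mul_cancel₀ hτ.ne', Real.rpow_one] at this
  rw [Real.dist_eq]
  refine (hf x ((le_max_left _ _).trans_lt hx)).v.trans_lt ?_
  rw [lt_div_iff₀ (by positivity)] at h2
  have : 0 < ze x ^ τ := by positivity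
  linarith

lemma Sy.comp {τ c : ℝ} (hτ : 0 < τ) {f : E3 → ℝ} (hf : Sy τ c f) {h h' h'' : ℝ → ℝ}
    (hs : ∀ᶠ s in 𝓝 c, ContDiffAt ℝ (⊤ : ℕ∞) h s) (h1 : ∀ᶠ s in 𝓝 c, HasDerivAt h (h' s) s) (h2 : ∀ᶠ s in 𝓝 c, HasDerivAt h' (h'' s) s)
    (hc : ContinuousAt h'' c) : Sy τ (h c) (fun x => h (f x)) := by
  have c1 : ∀ᶠ s in 𝓝 c, |h' s| ≤ |h' c| + 1 := by
    have : ContinuousAt h' c := h2.self_of_nhds.continuousAt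
    filter_upwards [this.abs.eventually (gt_mem_nhds (lt_add_one |h' c|))] with s hs using le_of_lt hs
  have c2 : ∀ᶠ s in 𝓝 c, |h'' s| ≤ |h'' c| + 1 := by
    filter_upwards [hc.abs.eventually (gt_mem_nhds (lt_add_one |h'' c|))] with s hs using le_of_lt hs
  obtain ⟨Q, hQ0, hQ⟩ := h1.self_of_nhds.isBigO_sub.exists_pos
  rw [Asymptotics.isBigOWith_iff] at hQ
  obtain ⟨S, hS, T⟩ := hf.tend hτ _ ((((hs.and h1.eventually_nhds).and h2).and c1).and (c2.and hQ))
  obtain ⟨K, hK, R, hR, hf⟩ := hf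
  refine ⟨Q * K + (|h'' c| + 1) * (K * K) + (|h' c| + 1) * K, by positivity, max R S, hR.trans (le_max_left _ _), fun x hx => ?_⟩
  obtain ⟨⟨⟨⟨k1, k2⟩, k3⟩, k4⟩, k5, k6⟩ := T x ((le_max_right _ _).trans_lt hx)
  obtain ⟨as, av, ad, ah⟩ := hf x ((le_max_left _ _).trans_lt hx)
  have hxE : x ∈ Ex := (hR.trans (le_max_left _ _)).trans_lt hx
  have hz := ze_pos (ne0 zero_le_one hxE)
  have ht := rpow_le1 hτ hz (ze_lt_one hxE)
  obtain ⟨t, hte⟩ : ∃ t, t = ze x ^ τ := ⟨_, rfl⟩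
  obtain ⟨z, hze⟩ : ∃ z, z = ze x := ⟨_, rfl⟩
  have ht0 : 0 < t := by rw [hte]; positivity
  obtain ⟨m, hm⟩ : ∃ m, m = |h' c| + 1 := ⟨_, rfl⟩
  obtain ⟨n, hn⟩ : ∃ n, n = |h'' c| + 1 := ⟨_, rfl⟩
  have hm0 : 0 ≤ m := by rw [hm]; positivity
  have hn0 : 0 ≤ n := by rw [hn]; positivity
  rw [← hm, ← hn]
  rw [← hm] at k4
  rw [← hn] at k5
  have hz0 : 0 < z := by rw [hze]; exact hz
  rw [← hte] at ht av
  simp only [← hte] at ad ah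
  simp only [← hze] at ad ah
  refine ⟨ContDiffAt.comp x k1 as, ?_, fun i => ?_, fun i j => ?_⟩
  · rw [Real.norm_eq_abs, Real.norm_eq_abs] at k6
    refine k6.trans ((mul_le_mul_of_nonneg_left av hQ0.le).trans ?_)
    rw [← hte]
    have : 0 ≤ n * (K * K) * t := by positivity
    have : 0 ≤ m * K * t := by positivity
    linarith
  · rw [pd_comp as.da k2.self_of_nhds]
    refine (mul_bd k4 (ad i)).trans ?_
    rw [← hte, ← hze]
    have : 0 ≤ n * (K * K) * t * z := by positivity
    have : 0 ≤ Q * K * t * z := by positivity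
    linarith
  · rw [Hs_comp as k2 k3]
    refine (abs_add_le _ _).trans ((add_le_add (mul_bd k5 (mul_bd (ad i) (ad j))) (mul_bd k4 (ah i j))).trans ?_)
    rw [← hte, ← hze]
    have : n * (K * t * z * (K * t * z)) ≤ n * (K * t * z * (K * 1 * z)) := by gcongr
    have : 0 ≤ Q * K * t * z ^ 2 := by positivity
    linarith

lemma rs_deriv {s : ℝ} (hs : 0 < s) (p : ℝ) : HasDerivAt (fun s : ℝ => s ^ p) (p * s ^ (p - 1)) s :=
  Real.hasDerivAt_rpow_const (Or.inl hs.ne')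

lemma Sy.rpow {τ : ℝ} (hτ : 0 < τ) {f : E3 → ℝ} (hf : Sy τ 1 f) (p : ℝ) : Sy τ 1 (fun x => f x ^ p) := by
  have hp : ∀ᶠ s in 𝓝 (1:ℝ), 0 < s := lt_mem_nhds one_pos
  have := hf.comp hτ (h := fun s => s ^ p) (h' := fun s => p * s ^ (p - 1)) (h'' := fun s => p * ((p - 1) * s ^ (p - 1 - 1)))
    (hp.mono fun s hs => contDiffAt_id.rpow_const_of_ne hs.ne') (hp.mono fun s hs => rs_deriv hs p)
    (hp.mono fun s hs => (rs_deriv hs (p - 1)).const_mul p) ?_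
  · simpa using this
  · exact continuousAt_const.mul ((rs_deriv one_pos (p - 1 - 1)).continuousAt.const_mul _)

/-- the coefficients -/
lemma Sy.coef {τ : ℝ} (hτ : 0 < τ) {g : E3 → Matrix (Fin 3) (Fin 3) ℝ}
    (hg : ∀ i j, Sy τ ((1 : Matrix (Fin 3) (Fin 3) ℝ) i j) (fun x => g x i j)) :
    (∃ R ≥ 1, ∀ x : E3, R < ‖x‖ → 0 < (g x).det) ∧
    ∀ i j, Sy τ (dl i j) (fun x => (g x).adjugate i j * (g x).det ^ (-(1/2) : ℝ)) := by
  have hd : Sy τ 1 (fun x => (g x).det) := by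
    have := Matrix.det_fin_three (1 : Matrix (Fin 3) (Fin 3) ℝ)
    rw [Matrix.det_one] at this
    rw [this]
    simp only [Matrix.det_fin_three]
    have m3 := fun (i j k l m n : Fin 3) => ((hg i j).mul hτ (hg k l)).mul hτ (hg m n)
    exact (((((m3 _ _ _ _ _ _).sub hτ (m3 _ _ _ _ _ _)).sub hτ (m3 _ _ _ _ _ _)).add (m3 _ _ _ _ _ _)).add (m3 _ _ _ _ _ _)).sub hτ (m3 _ _ _ _ _ _)
  refine ⟨hd.tend hτ _ (lt_mem_nhds one_pos), fun i j => ?_⟩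
  have ha : Sy τ (dl i j) (fun x => (g x).adjugate i j) := by
    have e : dl i j = (1 : Matrix (Fin 3) (Fin 3) ℝ).adjugate i j := by rw [Matrix.adjugate_one, Matrix.one_apply]
    rw [e]
    simp only [Matrix.adjugate_fin_succ_eq_det_submatrix, Matrix.det_fin_two, Matrix.submatrix_apply]
    exact (((hg _ _).mul hτ (hg _ _)).sub hτ ((hg _ _).mul hτ (hg _ _))).cmul hτ _
  have := ha.mul hτ (hd.rpow hτ (-(1/2)))
  rwa [mul_one] at this

lemma coef_eq {M : Matrix (Fin 3) (Fin 3) ℝ} (h : 0 < M.det) (i j : Fin 3) :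
    √M.det * M⁻¹ i j = M.adjugate i j * M.det ^ (-(1/2) : ℝ) := by
  rw [Matrix.inv_def, Matrix.smul_apply, Ring.inverse_eq_inv', smul_eq_mul, Real.rpow_neg h.le, ← Real.sqrt_eq_rpow]
  have h1 := Real.sqrt_pos.2 h
  have h2 := Real.mul_self_sqrt h.le
  field_simp
  rw [pow_two, h2]


lemma pd_scale {f : E3 → ℝ} {ρ : ℝ} {x : E3} (hf : DifferentiableAt ℝ f (ρ • x)) (i : Fin 3) :
    pd (fun y => f (ρ • y)) i x = ρ * pd f i (ρ • x) := by
  have h : HasFDerivAt (fun y : E3 => f (ρ • y)) ((fderiv ℝ f (ρ • x)).comp (ρ • ContinuousLinearMap.id ℝ E3)) x :=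
    HasFDerivAt.comp x hf.hasFDerivAt ((hasFDerivAt_id x).const_smul ρ)
  rw [pd, h.fderiv]
  simp [pd]

lemma sm_scale {f : E3 → ℝ} {ρ : ℝ} {x : E3} (hf : Sm f (ρ • x)) : Sm (fun y => f (ρ • y)) x :=
  ContDiffAt.comp x hf (contDiff_const_smul ρ).contDiffAt

lemma hs_scale {f : E3 → ℝ} {ρ : ℝ} {x : E3} (hf : Sm f (ρ • x)) (i j : Fin 3) :
    Hs (fun y => f (ρ • y)) i j x = ρ ^ 2 * Hs f i j (ρ • x) := by
  have hc : ContinuousAt (fun y : E3 => ρ • y) x := by fun_prop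
  have hev : pd (fun y => f (ρ • y)) j =ᶠ[𝓝 x] fun y => ρ * pd f j (ρ • y) := by
    filter_upwards [hc.eventually hf.ev] with y hy using pd_scale hy j
  unfold Hs
  rw [pd_congr hev, pd_cmul _ (sm_scale (hf.pd j)).da, pd_scale (hf.pd j).da]; ring

lemma ze_scale {ρ : ℝ} (hρ : 0 < ρ) (x : E3) : ze (ρ • x) = ρ⁻¹ * ze x := by
  rw [ze, ze, norm_smul, Real.norm_of_nonneg hρ.le, mul_inv]

lemma sum3_le {p : Fin 3 → ℝ} {Q : ℝ} (h : ∀ i, |p i| ≤ Q) : |∑ i, p i| ≤ 3 * Q := by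
  rw [Fin.sum_univ_three]
  refine (abs_add_le _ _).trans ((add_le_add (abs_add_le _ _) le_rfl).trans ?_)
  linarith [h 0, h 1, h 2]

lemma core_of {τ K R ρ : ℝ} {P : Fin 3 → Fin 3 → E3 → ℝ} (hK : 0 ≤ K) (hR : 1 ≤ R) (hρ : 2 * R ≤ ρ)
    (hP : ∀ i j, ∀ x : E3, R < ‖x‖ → SA τ (dl i j) K (P i j) x) (hs : ∀ i j, ∀ x : E3, R < ‖x‖ → P i j x = P j i x) :
    Core τ ((3 * K + 1) * ρ ^ (-τ)) (fun y i j => P i j (ρ • y)) (fun y j => ρ * ∑ i, pd (P i j) i (ρ • y)) := by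
  have hρ0 : 0 < ρ := by linarith
  have m : ∀ y : E3, 1 / 2 < ‖y‖ → R < ‖ρ • y‖ := fun y hy => by
    rw [norm_smul, Real.norm_of_nonneg hρ0.le]
    nlinarith
  have zt : ∀ y : E3, 1 / 2 < ‖y‖ → ze (ρ • y) ^ τ = ρ ^ (-τ) * ze y ^ τ := fun y hy => by
    rw [ze_scale hρ0, Real.mul_rpow (by positivity) (ze_pos (ne0 (by norm_num) hy)).le, Real.inv_rpow hρ0.le, Real.rpow_neg hρ0.le]
  have hT : 0 < ρ ^ (-τ) := by positivity
  have e1 : ρ * ρ⁻¹ = 1 := mul_inv_cancel₀ hρ0.ne'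
  have sp : ∀ y : E3, 1 / 2 < ‖y‖ → ∀ i j, Sm (fun y => pd (P i j) i (ρ • y)) y := fun y hy i j =>
    sm_scale ((hP i j _ (m y hy)).s.pd i)
  have ss : ∀ y : E3, 1 / 2 < ‖y‖ → ∀ j, Sm (fun y => ∑ i, pd (P i j) i (ρ • y)) y := fun y hy j =>
    ContDiffAt.sum fun i _ => sp y hy i j
  refine ⟨fun y hy i j => sm_scale (hP i j _ (m y hy)).s, fun y hy j => contDiffAt_const.mul (ss y hy j),
    fun y hy i j => hs i j _ (m y hy), fun y hy i j => ?_, fun y hy i j k => ?_, fun y hy j => ?_, fun y hy j k => ?_⟩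
  · have h := (hP i j _ (m y hy)).v
    have hz := ze_pos (ne0 (by norm_num) hy)
    rw [zt y hy] at h
    have : 0 < ρ ^ (-τ) * ze y ^ τ := by positivity
    have : 0 ≤ K * (ρ ^ (-τ) * ze y ^ τ) := by positivity
    linarith
  · have h := (hP i j _ (m y hy)).d k
    have hz := ze_pos (ne0 (by norm_num) hy)
    rw [zt y hy, ze_scale hρ0] at h
    rw [pd_scale (hP i j _ (m y hy)).s.da, abs_mul, abs_of_pos hρ0]
    have t := mul_le_mul_of_nonneg_left h hρ0.le
    have e : ρ * (K * (ρ ^ (-τ) * ze y ^ τ) * (ρ⁻¹ * ze y)) = K * (ρ ^ (-τ) * ze y ^ τ * ze y) := by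
      linear_combination (K * (ρ ^ (-τ) * ze y ^ τ * ze y)) * e1
    rw [e] at t
    have : 0 < ρ ^ (-τ) * ze y ^ τ * ze y := by positivity
    have : 0 ≤ K * (ρ ^ (-τ) * ze y ^ τ * ze y) := by positivity
    linarith
  · have h := sum3_le fun i => (hP i j _ (m y hy)).d i
    have hz := ze_pos (ne0 (by norm_num) hy)
    rw [zt y hy, ze_scale hρ0] at h
    rw [abs_mul, abs_of_pos hρ0]
    have t := mul_le_mul_of_nonneg_left h hρ0.le
    have e : ρ * (3 * (K * (ρ ^ (-τ) * ze y ^ τ) * (ρ⁻¹ * ze y))) = 3 * K * (ρ ^ (-τ) * ze y ^ τ * ze y) := by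
      linear_combination (3 * K * (ρ ^ (-τ) * ze y ^ τ * ze y)) * e1
    rw [e] at t
    have : 0 < ρ ^ (-τ) * ze y ^ τ * ze y := by positivity
    linarith
  · have h := sum3_le fun i => (hP i j _ (m y hy)).h k i
    have hz := ze_pos (ne0 (by norm_num) hy)
    rw [zt y hy, ze_scale hρ0] at h
    rw [pd_cmul _ (ss y hy j).da, pd_sum (fun i => (sp y hy i j).da)]
    have e0 : ∀ i, pd (fun y => pd (P i j) i (ρ • y)) k y = ρ * Hs (P i j) k i (ρ • y) := fun i => by
      rw [pd_scale ((hP i j _ (m y hy)).s.pd i).da]; rfl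
    simp only [e0]
    rw [← Finset.mul_sum, abs_mul, abs_mul, abs_of_pos hρ0]
    have t := mul_le_mul_of_nonneg_left (mul_le_mul_of_nonneg_left h hρ0.le) hρ0.le
    have e : ρ * (ρ * (3 * (K * (ρ ^ (-τ) * ze y ^ τ) * (ρ⁻¹ * ze y) ^ 2))) = 3 * K * (ρ ^ (-τ) * ze y ^ τ * ze y ^ 2) := by
      linear_combination (3 * K * (ρ ^ (-τ) * ze y ^ τ * ze y ^ 2)) * (ρ * ρ⁻¹ + 1) * e1
    rw [e] at t
    have : 0 < ρ ^ (-τ) * ze y ^ τ * ze y ^ 2 := by positivity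
    linarith

lemma far_of {φ : E3 → ℝ} (hl : Tendsto φ (cocompact E3) (𝓝 1)) {η : ℝ} (hη : 0 < η) : ∃ R, ∀ x : E3, R < ‖x‖ → |φ x - 1| < η := by
  rw [← Metric.cobounded_eq_cocompact, ← comap_norm_atTop] at hl
  have := hl (Metric.ball_mem_nhds 1 hη)
  rw [Filter.mem_map, Filter.mem_comap] at this
  obtain ⟨t, ht, h⟩ := this
  obtain ⟨R, hR⟩ := Filter.mem_atTop_sets.1 ht
  exact ⟨R, fun x hx => by simpa [Real.dist_eq] using h (hR _ hx.le)⟩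

lemma vs_of {ρ : ℝ} (hρ : 0 < ρ) {P : Fin 3 → Fin 3 → E3 → ℝ} {φ : E3 → ℝ} (hc : ContinuousOn φ {x | ρ ≤ ‖x‖})
    (hs : ∀ x : E3, ρ < ‖x‖ → Sm φ x) (h0 : ∀ x : E3, ‖x‖ = ρ → φ x = 0) (hl : Tendsto φ (cocompact E3) (𝓝 1))
    (hE : ∀ x : E3, ρ < ‖x‖ → ∑ i, ∑ j, (pd (P i j) i x * pd φ j x + P i j x * Hs φ i j x) = 0) :
    VS (fun y i j => P i j (ρ • y)) (fun y j => ρ * ∑ i, pd (P i j) i (ρ • y)) (fun y => φ (ρ • y) - 1 + ze y) := by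
  have nm : ∀ y : E3, ‖ρ • y‖ = ρ * ‖y‖ := fun y => by rw [norm_smul, Real.norm_of_nonneg hρ.le]
  have m : ∀ y ∈ Ex, ρ < ‖ρ • y‖ := fun y hy => by
    rw [nm]; exact lt_mul_of_one_lt_right hρ hy
  have su : ∀ y ∈ Ex, Sm (fun y => φ (ρ • y)) y := fun y hy => sm_scale (hs _ (m y hy))
  have su1 : ∀ y ∈ Ex, Sm (fun y => φ (ρ • y) - 1) y := fun y hy => (su y hy).sub contDiffAt_const
  refine ⟨?_, fun y hy => (su1 y hy).add (sm_ze (ne0 zero_le_one hy)), ?_, ?_, ?_⟩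
  · refine ContinuousOn.add (ContinuousOn.sub (hc.comp (by fun_prop) ?_) continuousOn_const) fun y hy => ?_
    · intro y (hy : 1 ≤ ‖y‖)
      change ρ ≤ ‖ρ • y‖
      rw [nm]; exact le_mul_of_one_le_right hρ.le hy
    · have : 1 ≤ ‖y‖ := hy
      exact (sm_ze (norm_pos_iff.1 (by linarith))).continuousAt.continuousWithinAt
  · intro y hy
    rw [h0 _ (by rw [nm, hy, mul_one]), ze, hy]; norm_num
  · intro η hη
    obtain ⟨R, hR⟩ := far_of hl (by linarith : 0 < η / 2)
    refine ⟨max (R / ρ) (η / 2)⁻¹, fun y hy => ?_⟩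
    have h1 := hR (ρ • y) (by
      rw [nm]
      have := (le_max_left _ _).trans_lt hy
      rw [div_lt_iff₀ hρ] at this; linarith)
    have h2 := ze_small (by positivity) ((le_max_right _ _).trans_lt hy)
    have h3 : 0 ≤ ze y := by rw [ze]; positivity
    refine (abs_add_le _ _).trans_lt ?_
    rw [abs_of_nonneg h3]; linarith
  · intro y hy
    have hsy := hs _ (m y hy)
    rw [Lo_add (su1 y hy) (sm_ze (ne0 zero_le_one hy)), Lo_sub (su y hy) contDiffAt_const, Lo_const, sub_zero]
    suffices h : Lo (fun y i j => P i j (ρ • y)) (fun y j => ρ * ∑ i, pd (P i j) i (ρ • y)) (fun y => φ (ρ • y)) y = 0 by rw [h, zero_add]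
    have h := hE _ (m y hy)
    unfold Lo
    simp only [hs_scale hsy, pd_scale hsy.da]
    simp only [Fin.sum_univ_three] at h ⊢
    linear_combination ρ ^ 2 * h


lemma bdry {f : E3 → ℝ} {x : E3} {M : ℝ} (i : Fin 3) (hM : 0 ≤ M)
    (h : ∀ y : E3, ‖x‖ < ‖y‖ → DifferentiableAt ℝ f y ∧ |pd f i y| ≤ M) : |pd f i x| ≤ M := by
  by_cases hf : DifferentiableAt ℝ f x
  swap
  · simp [pd, fderiv_zero_of_not_differentiableAt hf, hM]
  obtain ⟨σ, hσ, hσx⟩ : ∃ σ : ℝ, σ * σ = 1 ∧ 0 ≤ σ * x i := by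
    rcases le_total 0 (x i) with h | h
    · exact ⟨1, by norm_num, by linarith⟩
    · exact ⟨-1, by norm_num, by linarith⟩
  set v : E3 := EuclideanSpace.single i σ with hv
  have hv1 : v = σ • EuclideanSpace.single i (1 : ℝ) := by
    ext k; simp [hv]
  have ex : ∀ t : ℝ, 0 < t → ‖x‖ < ‖x + t • v‖ := fun t ht => by
    have e : ‖x + t • v‖ ^ 2 = ‖x‖ ^ 2 + 2 * t * (σ * x i) + t ^ 2 := by
      rw [norm_add_sq_real, norm_smul, inner_smul_right, hv, EuclideanSpace.inner_single_right, mul_pow, PiLp.norm_single]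
      have : ‖σ‖ ^ 2 = 1 := by rw [Real.norm_eq_abs, sq_abs, sq, hσ]
      rw [this, Real.norm_eq_abs, sq_abs]; simp; ring
    refine lt_of_pow_lt_pow_left₀ 2 (norm_nonneg _) ?_
    rw [e]; have := mul_nonneg ht.le hσx; nlinarith [sq_pos_of_pos ht]
  have hd : ∀ y : E3, DifferentiableAt ℝ f y → ∀ t, y = x + t • v → HasDerivAt (fun s : ℝ => f (x + s • v)) (σ * pd f i y) t := by
    intro y hy t e
    subst e
    have h1 : HasDerivAt (fun s : ℝ => x + s • v) v t := by
      simpa using ((hasDerivAt_id t).smul_const v).const_add x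
    have := hy.hasFDerivAt.comp_hasDerivAt t h1
    rw [hv1, map_smul] at this
    rw [← hv1] at this
    exact this
  have h0 := hd x hf 0 (by simp)
  have hσa : |σ| = 1 := by
    rcases mul_self_eq_one_iff.1 hσ with h | h <;> simp [h]
  have key : |σ * pd f i x| ≤ M := by
    rw [hasDerivAt_iff_tendsto_slope] at h0
    have h0' := (h0.mono_left (nhdsWithin_mono (0 : ℝ) (s := Set.Ioi 0) (fun t ht => ne_of_gt ht))).abs
    refine le_of_tendsto h0' ?_
    filter_upwards [self_mem_nhdsWithin] with t (ht : 0 < t)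
    obtain ⟨s, hs, e⟩ := exists_hasDerivAt_eq_slope (fun s : ℝ => f (x + s • v)) (fun s => σ * pd f i (x + s • v)) ht
      (fun s hs => by
        rcases hs.1.eq_or_lt with h' | h'
        · rw [← h']; exact (hd x hf 0 (by simp)).continuousAt.continuousWithinAt
        · exact (hd _ (h _ (ex s h')).1 s rfl).continuousAt.continuousWithinAt)
      (fun s hs => hd _ (h _ (ex s hs.1)).1 s rfl)
    rw [slope_def_field, ← e, abs_mul, hσa, one_mul]
    exact (h _ (ex s hs.1)).2
  rwa [abs_mul, hσa, one_mul] at key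

lemma zr {x : E3} (hx : x ≠ 0) (τ : ℝ) (n : ℕ) : ‖x‖ ^ (-τ - n) = ze x ^ τ * ze x ^ n := by
  have h := norm_pos_iff.2 hx
  rw [ze, Real.inv_rpow h.le, ← Real.rpow_neg h.le, Real.rpow_sub h, Real.rpow_natCast, inv_pow, div_eq_mul_inv]

lemma zd {x : E3} (hx : x ≠ 0) (τ : ℝ) (n : ℕ) : 1 / ‖x‖ ^ (n + τ) = ze x ^ τ * ze x ^ n := by
  rw [← zr hx, one_div, ← Real.rpow_neg (norm_nonneg _)]; congr 1; ring

lemma hg_of {τ C₀ : ℝ} {g : E3 → Matrix (Fin 3) (Fin 3) ℝ}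
    (hsmooth : ∀ i j, ContDiffOn ℝ (⊤ : ℕ∞) (fun x => g x i j) {x : E3 | 1 ≤ ‖x‖})
    (hC₀ : 0 < C₀)
    (h0 : ∀ x : E3, 1 ≤ ‖x‖ → ∀ i j,
      |g x i j - (1 : Matrix (Fin 3) (Fin 3) ℝ) i j| ≤ C₀ * ‖x‖ ^ (-τ))
    (h1 : ∀ x : E3, 1 ≤ ‖x‖ → ∀ i j k,
      |pd (fun y => g y i j) k x| ≤ C₀ * ‖x‖ ^ (-τ - 1))
    (h2 : ∀ x : E3, 1 ≤ ‖x‖ → ∀ i j k l,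
      |pd (fun y => pd (fun z => g z i j) k y) l x| ≤ C₀ * ‖x‖ ^ (-τ - 2)) (i j : Fin 3) :
    Sy τ ((1 : Matrix (Fin 3) (Fin 3) ℝ) i j) (fun x => g x i j) := by
  refine ⟨C₀, hC₀.le, 1, le_rfl, fun x hx => ?_⟩
  have hx0 : x ≠ 0 := ne0 zero_le_one hx
  have e0 := zr hx0 τ 0
  have e1 := zr hx0 τ 1
  have e2 := zr hx0 τ 2
  norm_num at e0 e1 e2
  refine ⟨(hsmooth i j).contDiffAt (mem_of_superset (Ex_open.mem_nhds hx) fun y (hy : 1 < ‖y‖) => hy.le), ?_, fun k => ?_, fun k l => ?_⟩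
  · rw [← e0]; exact h0 x hx.le i j
  · rw [mul_assoc, ← e1]; exact h1 x hx.le i j k
  · rw [mul_assoc, ← e2]; exact h2 x hx.le i j l k

lemma Sy.unif {τ : ℝ} {c : Fin 3 → Fin 3 → ℝ} {P : Fin 3 → Fin 3 → E3 → ℝ} (h : ∀ i j, Sy τ (c i j) (P i j)) :
    ∃ K ≥ 0, ∃ R ≥ 1, ∀ i j, ∀ x : E3, R < ‖x‖ → SA τ (c i j) K (P i j) x := by
  choose K hK R hR hh using h
  have lK : ∀ i j, K i j ≤ ∑ i, ∑ j, K i j := fun i j =>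
    (Finset.single_le_sum (fun k _ => hK i k) (Finset.mem_univ j)).trans
      (Finset.single_le_sum (f := fun i => ∑ j, K i j) (fun k _ => Finset.sum_nonneg fun l _ => hK k l) (Finset.mem_univ i))
  have hR0 : ∀ i j, 0 ≤ R i j := fun i j => zero_le_one.trans (hR i j)
  have lR : ∀ i j, R i j ≤ ∑ i, ∑ j, R i j := fun i j =>
    (Finset.single_le_sum (fun k _ => hR0 i k) (Finset.mem_univ j)).trans
      (Finset.single_le_sum (f := fun i => ∑ j, R i j) (fun k _ => Finset.sum_nonneg fun l _ => hR0 k l) (Finset.mem_univ i))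
  refine ⟨∑ i, ∑ j, K i j, (hK 0 0).trans (lK 0 0), ∑ i, ∑ j, R i j, (hR 0 0).trans (lR 0 0), fun i j x hx => ?_⟩
  have s := hh i j x ((lR i j).trans_lt hx)
  have hz : 0 ≤ ze x := by rw [ze]; positivity
  refine ⟨s.s, s.v.trans ?_, fun k => (s.d k).trans ?_, fun k l => (s.h k l).trans ?_⟩
  · gcongr; exact lK i j
  · gcongr; exact lK i j
  · gcongr; exact lK i j

lemma hE_of {R ρ : ℝ} (hRρ : R ≤ ρ) {g : E3 → Matrix (Fin 3) (Fin 3) ℝ} {P : Fin 3 → Fin 3 → E3 → ℝ} {φ : E3 → ℝ}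
    (hP : ∀ i j y, P i j y = (g y).adjugate i j * (g y).det ^ (-(1/2) : ℝ))
    (hd : ∀ x : E3, R < ‖x‖ → 0 < (g x).det) (hS : ∀ i j, ∀ x : E3, R < ‖x‖ → Sm (P i j) x)
    (hs : ∀ x : E3, ρ < ‖x‖ → Sm φ x)
    (hE : ∀ x : E3, ρ < ‖x‖ →
        ∑ i, pd (fun y => Real.sqrt (g y).det * ∑ j, (g y)⁻¹ i j * pd φ j y) i x = 0) (x : E3) (hx : ρ < ‖x‖) :
    ∑ i, ∑ j, (pd (P i j) i x * pd φ j x + P i j x * Hs φ i j x) = 0 := by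
  rw [← hE x hx]
  refine Finset.sum_congr rfl fun i _ => ?_
  have hev : (fun y => Real.sqrt (g y).det * ∑ j, (g y)⁻¹ i j * pd φ j y) =ᶠ[𝓝 x] fun y => ∑ j, P i j y * pd φ j y := by
    filter_upwards [(isOpen_lt continuous_const continuous_norm).mem_nhds (hRρ.trans_lt hx)] with y (hy : R < ‖y‖)
    rw [Finset.mul_sum]
    refine Finset.sum_congr rfl fun j _ => ?_
    rw [← mul_assoc, coef_eq (hd y hy), hP]
  have hPx := fun j => (hS i j x (hRρ.trans_lt hx)).da
  have hφ := fun j => ((hs x hx).pd j).da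
  rw [pd_congr hev, pd_sum (f := fun j y => P i j y * pd φ j y) fun j => (hPx j).mul (hφ j)]
  refine Finset.sum_congr rfl fun j _ => ?_
  rw [pd_mul (hPx j) (hφ j)]; rfl


lemma fin_of {τ ε A D ρ : ℝ} (hτ : 0 ≤ τ) (hρ : 0 < ρ) (hD : 0 ≤ D) {φ : E3 → ℝ}
    (hs : ∀ x : E3, ρ < ‖x‖ → Sm φ x) (h0 : ∀ x : E3, ‖x‖ = ρ → φ x = 0) (hA : |A| ≤ D * ε) (he : ε * ρ ^ τ = 1)
    (h : ∀ x ∈ Ex, |φ (ρ • x) - 1 + ze x - A * ze x| ≤ D * ε * (ze x ^ τ * ze x) ∧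
      (∀ i, |pd (fun y => φ (ρ • y) - 1 + ze y - A * ze y) i x| ≤ D * ε * (ze x ^ τ * ze x ^ 2)) ∧
      ∀ i j, |Hs (fun y => φ (ρ • y) - 1 + ze y - A * ze y) i j x| ≤ D * ε * (ze x ^ τ * ze x ^ 3)) :
    |ρ * (1 - A) - ρ| ≤ D * ρ ^ (1 - τ) ∧
        ∀ x : E3, ρ ≤ ‖x‖ →
          |φ x - 1 + ρ * (1 - A) / ‖x‖| ≤ D * ρ / ‖x‖ ^ (1 + τ) ∧
          (∀ i, |pd (fun y => φ y - 1 + ρ * (1 - A) / ‖y‖) i x| ≤ D * ρ / ‖x‖ ^ (2 + τ)) ∧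
          (∀ i j, |pd (fun y => pd (fun z => φ z - 1 + ρ * (1 - A) / ‖z‖) j y) i x|
            ≤ D * ρ / ‖x‖ ^ (3 + τ)) := by
  have hpt : 0 < ρ ^ τ := by positivity
  have he' : ε = (ρ ^ τ)⁻¹ := eq_inv_of_mul_eq_one_left he
  refine ⟨?_, ?_⟩
  · have : ρ * (1 - A) - ρ = -(ρ * A) := by ring
    rw [this, abs_neg, abs_mul, abs_of_pos hρ, Real.rpow_sub hρ, Real.rpow_one, div_eq_mul_inv, ← he']
    have := mul_le_mul_of_nonneg_left hA hρ.le
    linarith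
  set V : E3 → ℝ := fun y => φ (ρ • y) - 1 + ze y - A * ze y with hV
  set W : E3 → ℝ := fun z => φ z - 1 + ρ * (1 - A) / ‖z‖ with hW
  have hWV : W = fun z => V (ρ⁻¹ • z) := by
    funext z
    simp only [hW, hV]
    rw [smul_smul, mul_inv_cancel₀ hρ.ne', one_smul, ze_scale (inv_pos.2 hρ), inv_inv, ze]; ring
  have sW : ∀ x : E3, ρ < ‖x‖ → Sm W x := fun x hx => by
    have e : W = fun z => φ z - 1 + ρ * (1 - A) * ze z := by funext z; simp only [hW, ze]; ring
    rw [e]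
    exact ((hs x hx).sub contDiffAt_const).add (contDiffAt_const.mul (sm_ze (ne0 hρ.le hx)))
  have nm : ∀ x : E3, ‖ρ⁻¹ • x‖ = ρ⁻¹ * ‖x‖ := fun x => by rw [norm_smul, Real.norm_of_nonneg (inv_pos.2 hρ).le]
  have hx1 : ∀ x : E3, ρ < ‖x‖ → ρ⁻¹ • x ∈ Ex := fun x hx => by
    change 1 < ‖ρ⁻¹ • x‖
    rw [nm, inv_mul_eq_div, one_lt_div hρ]; exact hx
  have sV : ∀ x : E3, ρ < ‖x‖ → Sm V (ρ⁻¹ • x) := fun x hx => by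
    have hm := hx1 x hx
    have z := sm_ze (ne0 zero_le_one hm)
    refine ((sm_scale ?_).sub contDiffAt_const |>.add z).sub (contDiffAt_const.mul z)
    rw [smul_smul, mul_inv_cancel₀ hρ.ne', one_smul]; exact hs x hx
  have zt : ∀ x : E3, ρ < ‖x‖ → ze (ρ⁻¹ • x) ^ τ = ρ ^ τ * ze x ^ τ := fun x hx => by
    rw [ze_scale (inv_pos.2 hρ), inv_inv, Real.mul_rpow hρ.le (ze_pos (ne0 hρ.le hx)).le]
  have e1 : ρ⁻¹ * ρ = 1 := inv_mul_cancel₀ hρ.ne'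
  have key : ∀ x : E3, ρ < ‖x‖ → |W x| ≤ D * ρ / ‖x‖ ^ (1 + τ) ∧ (∀ i, |pd W i x| ≤ D * ρ / ‖x‖ ^ (2 + τ)) ∧
      ∀ i j, |Hs W i j x| ≤ D * ρ / ‖x‖ ^ (3 + τ) := by
    intro x hx
    obtain ⟨a0, a1, a2⟩ := h _ (hx1 x hx)
    have hx0 : x ≠ 0 := ne0 hρ.le hx
    have d1 := zd hx0 τ 1
    have d2 := zd hx0 τ 2
    have d3 := zd hx0 τ 3
    push_cast at d1 d2 d3
    change |V (ρ⁻¹ • x)| ≤ _ at a0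
    rw [zt x hx, ze_scale (inv_pos.2 hρ), inv_inv] at a0
    simp only [zt x hx] at a1 a2
    simp only [ze_scale (inv_pos.2 hρ), inv_inv] at a1 a2
    refine ⟨?_, fun i => ?_, fun i j => ?_⟩
    · rw [div_eq_mul_one_div, d1, hWV]
      refine a0.trans (le_of_eq ?_)
      linear_combination (D * ρ * ze x ^ τ * ze x) * he
    · rw [div_eq_mul_one_div, d2, hWV, pd_scale (sV x hx).da, abs_mul, abs_of_pos (inv_pos.2 hρ)]
      refine (mul_le_mul_of_nonneg_left (a1 i) (inv_pos.2 hρ).le).trans (le_of_eq ?_)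
      linear_combination (D * ρ * ze x ^ τ * ze x ^ 2) * (he * ρ⁻¹ * ρ + e1)
    · rw [div_eq_mul_one_div, d3, hWV, hs_scale (sV x hx), abs_mul, abs_of_pos (by positivity : 0 < ρ⁻¹ ^ 2)]
      refine (mul_le_mul_of_nonneg_left (a2 i j) (by positivity)).trans (le_of_eq ?_)
      linear_combination (D * ρ * ze x ^ τ * ze x ^ 3) * (he * (ρ⁻¹ * ρ) ^ 2 + e1 * (ρ⁻¹ * ρ + 1))
  intro x hx
  rcases hx.lt_or_eq with hx | hx
  · exact key x hx
  have hxp : 0 < ‖x‖ := hx ▸ hρ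
  have mono : ∀ (p : ℝ) (y : E3), 0 ≤ p → ‖x‖ < ‖y‖ → D * ρ / ‖y‖ ^ p ≤ D * ρ / ‖x‖ ^ p := fun p y hp hy => by
    refine div_le_div_of_nonneg_left (by positivity) (by positivity) ?_
    exact Real.rpow_le_rpow hxp.le hy.le hp
  refine ⟨?_, fun i => bdry i (by positivity) fun y hy => ?_, fun i j => bdry i (by positivity) fun y hy => ?_⟩
  · rw [h0 x hx.symm, ← hx, Real.rpow_add hρ, Real.rpow_one, mul_div_mul_comm, mul_comm ρ (1 - A), mul_div_assoc, div_self hρ.ne']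
    have : (0 : ℝ) - 1 + (1 - A) * 1 = -A := by ring
    rw [this, abs_neg]
    refine hA.trans (le_of_eq ?_)
    rw [he']; field_simp
  · exact ⟨(sW y (hx ▸ hy)).da, ((key y (hx ▸ hy)).2.1 i).trans (mono _ y (by linarith) hy)⟩
  · exact ⟨((sW y (hx ▸ hy)).pd j).da, ((key y (hx ▸ hy)).2.2 i j).trans (mono _ y (by linarith) hy)⟩

/-- **Uniform `1/|x|` expansion of capacitary potentials of large coordinate balls.**
Let `1/2 < τ < 1` and let `g` be a smooth metric on `E = {|x| ≥ 1}` with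
`|g_ij − δ_ij| ≤ C₀|x|^{−τ}`, `|∂g| ≤ C₀|x|^{−τ−1}`, `|∂²g| ≤ C₀|x|^{−τ−2}`.
Then there are `ρ₀ ≥ 1` and `k₁ > 0` such that for all `ρ ≥ ρ₀`, every `g`-capacitary
potential `φ` of the coordinate ball `{|x| ≤ ρ}` admits `c` with `|c − ρ| ≤ k₁ρ^{1−τ}` such
that `W = φ − 1 + c/|x|` satisfies `|W| ≤ k₁ρ|x|^{−1−τ}`, `|∂W| ≤ k₁ρ|x|^{−2−τ}`,
`|∂²W| ≤ k₁ρ|x|^{−3−τ}` on `{|x| ≥ ρ}`. -/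
theorem capacitary_potential_expansion (τ : ℝ) (hτ1 : 1 / 2 < τ) (hτ2 : τ < 1)
    (g : E3 → Matrix (Fin 3) (Fin 3) ℝ)
    (hsmooth : ∀ i j, ContDiffOn ℝ (⊤ : ℕ∞) (fun x => g x i j) {x : E3 | 1 ≤ ‖x‖})
    (hsym : ∀ x : E3, 1 ≤ ‖x‖ → (g x).IsSymm)
    (hpos : ∀ x : E3, 1 ≤ ‖x‖ → (g x).PosDef)
    (C₀ : ℝ) (hC₀ : 0 < C₀)
    (h0 : ∀ x : E3, 1 ≤ ‖x‖ → ∀ i j,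
      |g x i j - (1 : Matrix (Fin 3) (Fin 3) ℝ) i j| ≤ C₀ * ‖x‖ ^ (-τ))
    (h1 : ∀ x : E3, 1 ≤ ‖x‖ → ∀ i j k,
      |pd (fun y => g y i j) k x| ≤ C₀ * ‖x‖ ^ (-τ - 1))
    (h2 : ∀ x : E3, 1 ≤ ‖x‖ → ∀ i j k l,
      |pd (fun y => pd (fun z => g z i j) k y) l x| ≤ C₀ * ‖x‖ ^ (-τ - 2)) :
    ∃ ρ₀ ≥ (1 : ℝ), ∃ k₁ > (0 : ℝ), ∀ ρ ≥ ρ₀, ∀ φ : E3 → ℝ,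
      ContinuousOn φ {x : E3 | ρ ≤ ‖x‖} →
      ContDiffOn ℝ (⊤ : ℕ∞) φ {x : E3 | ρ < ‖x‖} →
      (∀ x : E3, ρ < ‖x‖ →
        ∑ i, pd (fun y => Real.sqrt (g y).det * ∑ j, (g y)⁻¹ i j * pd φ j y) i x = 0) →
      (∀ x : E3, ‖x‖ = ρ → φ x = 0) →
      Tendsto φ (cocompact E3) (𝓝 1) →
      ∃ c : ℝ, |c - ρ| ≤ k₁ * ρ ^ (1 - τ) ∧
        ∀ x : E3, ρ ≤ ‖x‖ →
          |φ x - 1 + c / ‖x‖| ≤ k₁ * ρ / ‖x‖ ^ (1 + τ) ∧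
          (∀ i, |pd (fun y => φ y - 1 + c / ‖y‖) i x| ≤ k₁ * ρ / ‖x‖ ^ (2 + τ)) ∧
          (∀ i j, |pd (fun y => pd (fun z => φ z - 1 + c / ‖z‖) j y) i x|
            ≤ k₁ * ρ / ‖x‖ ^ (3 + τ)) := by
  obtain ⟨⟨R₁, hR₁, hd⟩, hP⟩ := Sy.coef (by linarith) (hg_of hsmooth hC₀ h0 h1 h2)
  obtain ⟨K, hK, R₂, hR₂, hS⟩ := Sy.unif hP
  set P : Fin 3 → Fin 3 → E3 → ℝ := fun i j x => (g x).adjugate i j * (g x).det ^ (-(1/2) : ℝ) with hPd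
  set R := max R₁ R₂ with hR
  have hR1 : 1 ≤ R := hR₁.trans (le_max_left _ _)
  have hsy : ∀ i j, ∀ x : E3, R < ‖x‖ → P i j x = P j i x := fun i j x hx => by
    have e : (g x).adjugate i j = (g x).adjugate j i := by
      conv_lhs => rw [← (hsym x (hR1.trans hx.le)).eq, ← Matrix.adjugate_transpose]
      rfl
    simp only [hPd, e]
  set C := 2 * 10 ^ 41 * (τ * (1 - τ))⁻¹ with hC
  have hCp : 0 < C := by
    have : 0 < τ * (1 - τ) := mul_pos (by linarith) (by linarith)
    positivity
  have htd : Tendsto (fun ρ : ℝ => (3 * K + 1) * ρ ^ (-τ)) atTop (𝓝 0) := by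
    simpa using (tendsto_rpow_neg_atTop (by linarith : 0 < τ)).const_mul (3 * K + 1)
  obtain ⟨r, hr⟩ := eventually_atTop.1 (htd.eventually_le_const (by norm_num : (0 : ℝ) < 1 / 2000))
  refine ⟨max (2 * R) r, le_max_of_le_left (by linarith), (10 ^ 9 * C + 100) * (3 * K + 1), by positivity, ?_⟩
  intro ρ hρ φ hc hsm hE hb hl
  have hρ2 : 2 * R ≤ ρ := (le_max_left _ _).trans hρ
  have hρ0 : 0 < ρ := by linarith
  have hs : ∀ x : E3, ρ < ‖x‖ → Sm φ x := fun x hx =>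
    hsm.contDiffAt ((isOpen_lt continuous_const continuous_norm).mem_nhds hx)
  have hSR : ∀ i j, ∀ x : E3, R < ‖x‖ → SA τ (dl i j) K (P i j) x := fun i j x hx => hS i j x ((le_max_right _ _).trans_lt hx)
  have hE' := hE_of (P := P) (by linarith : R ≤ ρ) (fun _ _ _ => rfl) (fun x hx => hd x ((le_max_left _ _).trans_lt hx))
    (fun i j x hx => (hSR i j x hx).s) hs hE
  have hpt : 0 < ρ ^ (-τ) := by positivity
  obtain ⟨A, hA, hB⟩ := (vs_of hρ0 hc hs hb hl hE').fin (core_of hK hR1 hρ2 hSR hsy) (by positivity) (hr ρ ((le_max_right _ _).trans hρ)) hτ1 hτ2 hC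
  have b1 : 10 ^ 9 * C * ((3 * K + 1) * ρ ^ (-τ)) ≤ (10 ^ 9 * C + 100) * (3 * K + 1) * ρ ^ (-τ) := by
    have : 0 ≤ (3 * K + 1) * ρ ^ (-τ) := by positivity
    linarith
  have b2 : 100 * ((3 * K + 1) * ρ ^ (-τ)) ≤ (10 ^ 9 * C + 100) * (3 * K + 1) * ρ ^ (-τ) := by
    have : 0 ≤ C * ((3 * K + 1) * ρ ^ (-τ)) := by positivity
    linarith
  refine ⟨ρ * (1 - A), fin_of (by linarith) hρ0 (by positivity) hs hb (hA.trans b2) (by rw [← Real.rpow_add hρ0]; simp) fun x hx => ?_⟩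
  have hz : 0 < ze x := ze_pos (ne0 zero_le_one hx)
  obtain ⟨a0, a1, a2⟩ := hB x hx
  exact ⟨a0.trans (mul_le_mul_of_nonneg_right b1 (by positivity)), fun i => (a1 i).trans (mul_le_mul_of_nonneg_right b1 (by positivity)),
    fun i j => (a2 i j).trans (mul_le_mul_of_nonneg_right b1 (by positivity))⟩
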